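/- There exists a constant C > 0 such that for all distinct primes h, k, q with q ≥ 4hk and each choice of sign ±: |M_±(h,k;q) − (±1)·M_±(h,q;k) − (±1)·M_±(k,q;h) − (1/2)·(q/(hk))^{1/2}·(log(q/(hk)) + γ − log(8π) ∓ π/2)| ≤ C·log q. -/

import Mathlib

open Complex Real Finset

open scoped Classical in
/-- `M_±(h,k;q)`: the doubly twisted second moment over primitive (= nontrivial, for
prime `q`) characters mod `q` of parity `χ(-1) = ε` (an empty sum being `0`). -/
noncomputable def Mpm (ε : ℤ) (h k : ℤ) (q : ℕ) [NeZero q] : ℂ :=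
  (Real.sqrt q / (Nat.totient q : ℝ)) *
    ∑ χ : DirichletCharacter ℂ q, if χ ≠ 1 ∧ χ (-1 : ZMod q) = (ε : ℂ) then
      (‖χ.LFunction (1/2)‖^2 : ℂ) * χ (h : ZMod q) * (starRingEnd ℂ) (χ (k : ZMod q))
    else 0

namespace TTR

/-! ### Kernels -/

/-- sign factor: `1` on `x ≥ 0`, `ε` on `x < 0`. -/
noncomputable def sg (ε x : ℝ) : ℝ := if 0 ≤ x then 1 else ε

/-- the kernel `|x|^{-1/2}` (with a sign if `ε = -1`). -/
noncomputable def ker (ε x : ℝ) : ℝ := sg ε x / √|x|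

/-- first antiderivative of `ker`. -/
noncomputable def S1 (ε x : ℝ) : ℝ := 2 * (sg (-ε) x * √|x|)

/-- second antiderivative of `ker`. -/
noncomputable def S2 (ε x : ℝ) : ℝ := 4 / 3 * (sg ε x * (|x| * √|x|))

/-- derivative of `ker`. -/
noncomputable def kd (ε x : ℝ) : ℝ := -(sg (-ε) x / (2 * (|x| * √|x|)))

/-- triangle-kernel average of `ker` at scale `V`. -/
noncomputable def bb (ε V x : ℝ) : ℝ := (S2 ε (x + V) - 2 * S2 ε x + S2 ε (x - V)) / V ^ 2

noncomputable def bd (ε V x : ℝ) : ℝ := (S1 ε (x + V) - 2 * S1 ε x + S1 ε (x - V)) / V ^ 2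

noncomputable def tau (ε V x : ℝ) : ℝ := ker ε x - bb ε V x

noncomputable def td (ε V x : ℝ) : ℝ := kd ε x - bd ε V x

lemma sg_abs {ε : ℝ} (he : ε = 1 ∨ ε = -1) (x : ℝ) : |sg ε x| = 1 := by
  unfold sg; rcases he with rfl | rfl <;> split_ifs <;> simp

lemma neg_he {ε : ℝ} (he : ε = 1 ∨ ε = -1) : -ε = 1 ∨ -ε = -1 := by
  rcases he with rfl | rfl <;> simp

lemma sq_he {ε : ℝ} (he : ε = 1 ∨ ε = -1) : ε * ε = 1 := by
  rcases he with rfl | rfl <;> simp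

lemma abs_he {ε : ℝ} (he : ε = 1 ∨ ε = -1) : |ε| = 1 := by
  rcases he with rfl | rfl <;> simp

lemma sg_neg {ε : ℝ} (he : ε = 1 ∨ ε = -1) {x : ℝ} (hx : x ≠ 0) :
    sg ε (-x) = ε * sg ε x := by
  unfold sg
  rcases lt_or_gt_of_ne hx with h | h
  · rw [if_pos (by linarith), if_neg (by linarith), sq_he he]
  · rw [if_neg (by linarith), if_pos (by linarith), mul_one]

lemma sg_scale (ε : ℝ) {l : ℝ} (hl : 0 < l) (x : ℝ) : sg ε (l * x) = sg ε x := by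
  unfold sg
  have : 0 ≤ l * x ↔ 0 ≤ x := by constructor
                                 · intro h; exact nonneg_of_mul_nonneg_right h hl
                                 · intro h; positivity
  simp only [this]

lemma ker_zero (ε : ℝ) : ker ε 0 = 0 := by simp [ker]
lemma S2_zero (ε : ℝ) : S2 ε 0 = 0 := by simp [S2]
lemma S1_zero (ε : ℝ) : S1 ε 0 = 0 := by simp [S1]

lemma ker_neg {ε : ℝ} (he : ε = 1 ∨ ε = -1) (x : ℝ) : ker ε (-x) = ε * ker ε x := by
  by_cases hx : x = 0
  · subst hx; simp [ker_zero]
  · unfold ker; rw [sg_neg he hx, abs_neg, mul_div_assoc]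

lemma S2_neg {ε : ℝ} (he : ε = 1 ∨ ε = -1) (x : ℝ) : S2 ε (-x) = ε * S2 ε x := by
  by_cases hx : x = 0
  · subst hx; simp [S2_zero]
  · unfold S2; rw [sg_neg he hx, abs_neg]; ring

lemma S1_neg {ε : ℝ} (he : ε = 1 ∨ ε = -1) (x : ℝ) : S1 ε (-x) = -ε * S1 ε x := by
  by_cases hx : x = 0
  · subst hx; simp [S1_zero]
  · unfold S1; rw [sg_neg (neg_he he) hx, abs_neg]; ring

lemma kd_neg {ε : ℝ} (he : ε = 1 ∨ ε = -1) (x : ℝ) : kd ε (-x) = -ε * kd ε x := by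
  by_cases hx : x = 0
  · subst hx; simp [kd]
  · unfold kd; rw [sg_neg (neg_he he) hx, abs_neg]; ring

lemma bb_neg {ε : ℝ} (he : ε = 1 ∨ ε = -1) (V x : ℝ) : bb ε V (-x) = ε * bb ε V x := by
  unfold bb
  rw [show -x + V = -(x - V) by ring, show -x - V = -(x + V) by ring, S2_neg he, S2_neg he,
    S2_neg he]; ring

lemma bd_neg {ε : ℝ} (he : ε = 1 ∨ ε = -1) (V x : ℝ) : bd ε V (-x) = -ε * bd ε V x := by
  unfold bd
  rw [show -x + V = -(x - V) by ring, show -x - V = -(x + V) by ring, S1_neg he, S1_neg he,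
    S1_neg he]; ring

lemma tau_neg {ε : ℝ} (he : ε = 1 ∨ ε = -1) (V x : ℝ) : tau ε V (-x) = ε * tau ε V x := by
  unfold tau; rw [ker_neg he, bb_neg he]; ring

lemma td_neg {ε : ℝ} (he : ε = 1 ∨ ε = -1) (V x : ℝ) : td ε V (-x) = -ε * td ε V x := by
  unfold td; rw [kd_neg he, bd_neg he]; ring

lemma ker_scale (ε : ℝ) {l : ℝ} (hl : 0 < l) (x : ℝ) : ker ε (l * x) = ker ε x / √l := by
  unfold ker
  rw [sg_scale ε hl, abs_mul, abs_of_pos hl, Real.sqrt_mul hl.le, div_div, mul_comm (√l)]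

lemma S2_scale (ε : ℝ) {l : ℝ} (hl : 0 < l) (x : ℝ) : S2 ε (l * x) = S2 ε x * (l * √l) := by
  unfold S2
  rw [sg_scale ε hl, abs_mul, abs_of_pos hl, Real.sqrt_mul hl.le]; ring

lemma S1_scale (ε : ℝ) {l : ℝ} (hl : 0 < l) (x : ℝ) : S1 ε (l * x) = S1 ε x * √l := by
  unfold S1
  rw [sg_scale _ hl, abs_mul, abs_of_pos hl, Real.sqrt_mul hl.le]; ring

lemma kd_scale (ε : ℝ) {l : ℝ} (hl : 0 < l) (x : ℝ) : kd ε (l * x) = kd ε x / (l * √l) := by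
  unfold kd
  rw [sg_scale _ hl, abs_mul, abs_of_pos hl, Real.sqrt_mul hl.le, neg_div, div_div]; ring_nf

lemma bb_scale (ε : ℝ) {l : ℝ} (hl : 0 < l) (V x : ℝ) :
    bb ε (l * V) (l * x) = bb ε V x / √l := by
  unfold bb
  rw [← mul_add, ← mul_sub, S2_scale ε hl, S2_scale ε hl, S2_scale ε hl]
  by_cases hV : V = 0
  · subst hV; simp
  have h1 : √l * √l = l := Real.mul_self_sqrt hl.le
  have h2 : √l ≠ 0 := (Real.sqrt_pos.mpr hl).ne'
  rw [div_div, div_eq_div_iff (by positivity) (by positivity)]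
  have : l * √l * √l = l ^ 2 := by rw [mul_assoc, h1]; ring
  linear_combination ((S2 ε (x + V) - 2 * S2 ε x + S2 ε (x - V)) * V^2) * this

lemma bd_scale (ε : ℝ) {l : ℝ} (hl : 0 < l) (V x : ℝ) :
    bd ε (l * V) (l * x) = bd ε V x / (l * √l) := by
  unfold bd
  rw [← mul_add, ← mul_sub, S1_scale ε hl, S1_scale ε hl, S1_scale ε hl]
  by_cases hV : V = 0
  · subst hV; simp
  have h1 : √l * √l = l := Real.mul_self_sqrt hl.le
  have h2 : √l ≠ 0 := (Real.sqrt_pos.mpr hl).ne'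
  rw [div_div, div_eq_div_iff (by positivity) (by positivity)]
  linear_combination ((S1 ε (x + V) - 2 * S1 ε x + S1 ε (x - V)) * V^2 * l) * h1

lemma tau_scale (ε : ℝ) {l : ℝ} (hl : 0 < l) (V x : ℝ) :
    tau ε (l * V) (l * x) = tau ε V x / √l := by
  unfold tau; rw [ker_scale ε hl, bb_scale ε hl, sub_div]

lemma td_scale (ε : ℝ) {l : ℝ} (hl : 0 < l) (V x : ℝ) :
    td ε (l * V) (l * x) = td ε V x / (l * √l) := by
  unfold td; rw [kd_scale ε hl, bd_scale ε hl, sub_div]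

/-! ### Derivatives -/

lemma hasDerivAt_ker_pos (ε : ℝ) {x : ℝ} (hx : 0 < x) : HasDerivAt (ker ε) (kd ε x) x := by
  have h := (Real.hasDerivAt_sqrt hx.ne').inv (Real.sqrt_pos.mpr hx).ne'
  have e : kd ε x = -(1 / (2 * √x)) / √x ^ 2 := by
    have h2 : √x ≠ 0 := (Real.sqrt_pos.mpr hx).ne'
    unfold kd sg
    rw [if_pos hx.le, abs_of_pos hx, Real.sq_sqrt hx.le]; field_simp
  rw [e]
  refine h.congr_of_eventuallyEq ?_
  filter_upwards [lt_mem_nhds hx] with y hy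
  simp [ker, sg, hy.le, abs_of_pos hy]

lemma hasDerivAt_S1_pos (ε : ℝ) {x : ℝ} (hx : 0 < x) : HasDerivAt (S1 ε) (ker ε x) x := by
  have h := (Real.hasDerivAt_sqrt hx.ne').const_mul 2
  have e : ker ε x = 2 * (1 / (2 * √x)) := by
    have h2 : √x ≠ 0 := (Real.sqrt_pos.mpr hx).ne'
    unfold ker sg
    rw [if_pos hx.le, abs_of_pos hx]; field_simp
  rw [e]
  refine h.congr_of_eventuallyEq ?_
  filter_upwards [lt_mem_nhds hx] with y hy
  simp [S1, sg, hy.le, abs_of_pos hy]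

lemma hasDerivAt_S2_pos (ε : ℝ) {x : ℝ} (hx : 0 < x) : HasDerivAt (S2 ε) (S1 ε x) x := by
  have h := ((hasDerivAt_id x).mul (Real.hasDerivAt_sqrt hx.ne')).const_mul (4/3)
  have e : S1 ε x = 4/3 * (1 * √x + id x * (1 / (2 * √x))) := by
    have h2 : √x ≠ 0 := (Real.sqrt_pos.mpr hx).ne'
    have h3 : √x * √x = x := Real.mul_self_sqrt hx.le
    unfold S1 sg
    rw [if_pos hx.le, abs_of_pos hx]; simp only [id]; field_simp
    nlinarith
  rw [e]
  refine h.congr_of_eventuallyEq ?_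
  filter_upwards [lt_mem_nhds hx] with y hy
  simp [S2, sg, hy.le, abs_of_pos hy]

lemma hasDerivAt_of_neg {F : ℝ → ℝ} {c : ℝ} (hF : ∀ x, F (-x) = c * F x) (hc : c * c = 1)
    {x F' : ℝ} (h : HasDerivAt F F' (-x)) : HasDerivAt F (-(c * F')) x := by
  have h1 : HasDerivAt (fun y => F (-y)) (-F') x := by
    exact (h.comp x (hasDerivAt_neg x)).congr_deriv (by ring)
  have h2 := h1.const_mul c
  have : (fun y => c * F (-y)) = F := by
    funext y; rw [hF, ← mul_assoc, hc, one_mul]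
  rw [this] at h2
  exact h2.congr_deriv (by ring)

lemma hasDerivAt_ker {ε : ℝ} (he : ε = 1 ∨ ε = -1) {x : ℝ} (hx : x ≠ 0) :
    HasDerivAt (ker ε) (kd ε x) x := by
  rcases lt_or_gt_of_ne hx with h | h
  · have := hasDerivAt_of_neg (ker_neg he) (sq_he he) (hasDerivAt_ker_pos ε (neg_pos.mpr h))
    convert this using 1
    rw [kd_neg he]; linear_combination - (kd ε x) * sq_he he
  · exact hasDerivAt_ker_pos ε h

lemma hasDerivAt_S1 {ε : ℝ} (he : ε = 1 ∨ ε = -1) {x : ℝ} (hx : x ≠ 0) :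
    HasDerivAt (S1 ε) (ker ε x) x := by
  rcases lt_or_gt_of_ne hx with h | h
  · have := hasDerivAt_of_neg (S1_neg he) (sq_he (neg_he he)) (hasDerivAt_S1_pos ε (neg_pos.mpr h))
    convert this using 1
    rw [ker_neg he]; linear_combination - (ker ε x) * sq_he he
  · exact hasDerivAt_S1_pos ε h

lemma S2_abs {ε : ℝ} (he : ε = 1 ∨ ε = -1) (x : ℝ) : |S2 ε x| = 4/3 * (|x| * √|x|) := by
  unfold S2; rw [abs_mul, abs_mul, sg_abs he, abs_mul, abs_abs, abs_of_nonneg (Real.sqrt_nonneg _)]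
  norm_num

lemma S1_abs {ε : ℝ} (he : ε = 1 ∨ ε = -1) (x : ℝ) : |S1 ε x| = 2 * √|x| := by
  unfold S1; rw [abs_mul, abs_mul, sg_abs (neg_he he), abs_of_nonneg (Real.sqrt_nonneg _)]
  norm_num

lemma ker_abs {ε : ℝ} (he : ε = 1 ∨ ε = -1) (x : ℝ) : |ker ε x| = 1 / √|x| := by
  unfold ker; rw [abs_div, sg_abs he, abs_of_nonneg (Real.sqrt_nonneg _)]

lemma kd_abs {ε : ℝ} (he : ε = 1 ∨ ε = -1) (x : ℝ) : |kd ε x| = 1 / (2 * (|x| * √|x|)) := by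
  unfold kd; rw [abs_neg, abs_div, sg_abs (neg_he he), abs_of_nonneg (by positivity)]

lemma hasDerivAt_S2 {ε : ℝ} (he : ε = 1 ∨ ε = -1) (x : ℝ) :
    HasDerivAt (S2 ε) (S1 ε x) x := by
  rcases lt_trichotomy x 0 with h | h | h
  · have := hasDerivAt_of_neg (S2_neg he) (sq_he he) (hasDerivAt_S2_pos ε (neg_pos.mpr h))
    convert this using 1
    rw [S1_neg he]; linear_combination - (S1 ε x) * sq_he he
  · subst h
    rw [S1_zero, hasDerivAt_iff_isLittleO]
    simp only [S2_zero, sub_zero, smul_zero]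
    rw [Asymptotics.isLittleO_iff]
    intro c hc
    have : Filter.Tendsto (fun y : ℝ => 4/3 * √|y|) (nhds 0) (nhds 0) := by
      have : Continuous (fun y : ℝ => 4/3 * √|y|) := by fun_prop
      simpa using this.tendsto 0
    filter_upwards [this.eventually (gt_mem_nhds hc)] with y hy
    rw [Real.norm_eq_abs, Real.norm_eq_abs, S2_abs he]
    have := abs_nonneg y
    nlinarith
  · exact hasDerivAt_S2_pos ε h

lemma continuous_S2 {ε : ℝ} (he : ε = 1 ∨ ε = -1) : Continuous (S2 ε) :=
  continuous_iff_continuousAt.mpr fun x => (hasDerivAt_S2 he x).continuousAt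

lemma hasDerivAt_bb {ε : ℝ} (he : ε = 1 ∨ ε = -1) (V x : ℝ) :
    HasDerivAt (bb ε V) (bd ε V x) x := by
  have h1 : HasDerivAt (fun y => S2 ε (y + V)) (S1 ε (x + V)) x :=
    (hasDerivAt_S2 he (x+V)).comp_add_const x V
  have h2 : HasDerivAt (fun y => S2 ε (y - V)) (S1 ε (x - V)) x :=
    (hasDerivAt_S2 he (x-V)).comp_sub_const x V
  exact ((h1.sub ((hasDerivAt_S2 he x).const_mul 2)).add h2).div_const _

lemma continuous_bb {ε : ℝ} (he : ε = 1 ∨ ε = -1) (V : ℝ) : Continuous (bb ε V) :=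
  continuous_iff_continuousAt.mpr fun x => (hasDerivAt_bb he V x).continuousAt

lemma hasDerivAt_tau {ε : ℝ} (he : ε = 1 ∨ ε = -1) (V : ℝ) {x : ℝ} (hx : x ≠ 0) :
    HasDerivAt (tau ε V) (td ε V x) x :=
  (hasDerivAt_ker he hx).sub (hasDerivAt_bb he V x)

lemma measurable_sg (ε : ℝ) : Measurable (sg ε) :=
  Measurable.ite measurableSet_Ici measurable_const measurable_const

lemma measurable_ker (ε : ℝ) : Measurable (ker ε) := by
  unfold ker; exact (measurable_sg ε).div (by fun_prop)

lemma measurable_S1 (ε : ℝ) : Measurable (S1 ε) := by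
  unfold S1; exact ((measurable_sg _).mul (by fun_prop)).const_mul _

lemma measurable_kd (ε : ℝ) : Measurable (kd ε) := by
  unfold kd; exact ((measurable_sg _).div (by fun_prop)).neg

lemma measurable_tau {ε : ℝ} (he : ε = 1 ∨ ε = -1) (V : ℝ) : Measurable (tau ε V) :=
  (measurable_ker ε).sub (continuous_bb he V).measurable

lemma measurable_td (ε : ℝ) (V : ℝ) : Measurable (td ε V) := by
  have := measurable_S1 ε
  unfold td bd
  refine (measurable_kd ε).sub ?_
  refine Measurable.div_const ?_ _
  exact ((this.comp (measurable_id.add_const V)).sub (this.const_mul 2)).add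
    (this.comp (measurable_id.sub_const V))

/-! ### Second difference estimate -/

lemma second_diff {F F1 F2 : ℝ → ℝ} {y M : ℝ} 
    (h1 : ∀ x ∈ Set.Icc (y-1) (y+1), HasDerivAt F (F1 x) x)
    (h2 : ∀ x ∈ Set.Icc (y-1) (y+1), HasDerivAt F1 (F2 x) x)
    (hM : ∀ x ∈ Set.Icc (y-1) (y+1), |F2 x - F2 y| ≤ M) :
    |F (y+1) - 2 * F y + F (y-1) - F2 y| ≤ 2 * M := by
  have hM0 : 0 ≤ M := (abs_nonneg _).trans (hM y (by constructor <;> linarith))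
  set G : ℝ → ℝ := fun t => F (y+t) - 2 * F y + F (y-t) - t^2 * F2 y
  set G1 : ℝ → ℝ := fun t => F1 (y+t) - F1 (y-t) - 2 * t * F2 y
  have hG : ∀ t ∈ Set.Icc (0:ℝ) 1, HasDerivAt G (G1 t) t := by
    intro t ht
    have a1 : HasDerivAt (fun t => F (y+t)) (F1 (y+t)) t :=
      (h1 (y+t) ⟨by linarith [ht.1], by linarith [ht.2]⟩).comp_const_add y t
    have a2 : HasDerivAt (fun t => F (y-t)) (-F1 (y-t)) t :=
      (h1 (y-t) ⟨by linarith [ht.2], by linarith [ht.1]⟩).comp_const_sub y t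
    have a3 : HasDerivAt (fun t : ℝ => t^2 * F2 y) (2 * t * F2 y) t := by
      simpa using (hasDerivAt_pow 2 t).mul_const (F2 y)
    exact (((a1.sub_const (2 * F y)).add a2).sub a3).congr_deriv (by simp only [G1]; ring)
  have hG1 : ∀ t ∈ Set.Icc (0:ℝ) 1, HasDerivAt G1 (F2 (y+t) + F2 (y-t) - 2 * F2 y) t := by
    intro t ht
    have a1 : HasDerivAt (fun t => F1 (y+t)) (F2 (y+t)) t :=
      (h2 (y+t) ⟨by linarith [ht.1], by linarith [ht.2]⟩).comp_const_add y t
    have a2 : HasDerivAt (fun t => F1 (y-t)) (-F2 (y-t)) t :=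
      (h2 (y-t) ⟨by linarith [ht.2], by linarith [ht.1]⟩).comp_const_sub y t
    have a3 : HasDerivAt (fun t : ℝ => 2 * t * F2 y) (2 * F2 y) t := by
      simpa using ((hasDerivAt_id t).const_mul 2).mul_const (F2 y)
    exact ((a1.sub a2).sub a3).congr_deriv (by ring)
  have b1 : ∀ t ∈ Set.Icc (0:ℝ) 1, ‖G1 t‖ ≤ 2 * M := by
    intro t ht
    have := (convex_Icc (0:ℝ) 1).norm_image_sub_le_of_norm_hasDerivWithin_le (f := G1)
      (C := 2 * M) (fun x hx => (hG1 x hx).hasDerivWithinAt) (fun x hx => ?_)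
      (Set.left_mem_Icc.mpr zero_le_one) ht
    · have e : G1 0 = 0 := by simp [G1]
      rw [e, sub_zero, sub_zero] at this
      refine this.trans ?_
      rw [Real.norm_eq_abs, abs_of_nonneg ht.1]
      nlinarith [ht.2]
    · have c1 := hM (y+x) ⟨by linarith [hx.1], by linarith [hx.2]⟩
      have c2 := hM (y-x) ⟨by linarith [hx.2], by linarith [hx.1]⟩
      rw [Real.norm_eq_abs, show F2 (y+x) + F2 (y-x) - 2 * F2 y =
        (F2 (y+x) - F2 y) + (F2 (y-x) - F2 y) by ring]
      exact (abs_add_le _ _).trans (by linarith)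
  have := (convex_Icc (0:ℝ) 1).norm_image_sub_le_of_norm_hasDerivWithin_le (f := G)
      (C := 2 * M) (fun x hx => (hG x hx).hasDerivWithinAt) b1
      (Set.left_mem_Icc.mpr zero_le_one) (Set.right_mem_Icc.mpr zero_le_one)
  have e : G 0 = 0 := by simp [G]; ring
  rw [e] at this
  simpa [G] using this

end TTR

namespace TTR

/-! ### Kernel bounds -/

lemma S2_le {ε : ℝ} (he : ε = 1 ∨ ε = -1) {x : ℝ} (hx : |x| ≤ 3) : |S2 ε x| ≤ 8 := by
  rw [S2_abs he]
  have h1 : √|x| ≤ 2 := by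
    rw [Real.sqrt_le_left (by norm_num)]; linarith
  nlinarith [abs_nonneg x, Real.sqrt_nonneg |x|]

lemma S1_le {ε : ℝ} (he : ε = 1 ∨ ε = -1) {x : ℝ} (hx : |x| ≤ 3) : |S1 ε x| ≤ 4 := by
  rw [S1_abs he]
  have h1 : √|x| ≤ 2 := by
    rw [Real.sqrt_le_left (by norm_num)]; linarith
  linarith

lemma bb_small {ε : ℝ} (he : ε = 1 ∨ ε = -1) {y : ℝ} (hy : 0 < y) (hy2 : y ≤ 2) :
    |bb ε 1 y| ≤ 32 := by
  have a1 := S2_le he (x := y+1) (by rw [abs_le]; constructor <;> linarith)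
  have a2 := S2_le he (x := y) (by rw [abs_le]; constructor <;> linarith)
  have a3 := S2_le he (x := y-1) (by rw [abs_le]; constructor <;> linarith)
  unfold bb; rw [abs_le] at *; norm_num; constructor <;> linarith [a1.1, a1.2, a2.1,a2.2,a3.1,a3.2]

lemma bd_small {ε : ℝ} (he : ε = 1 ∨ ε = -1) {y : ℝ} (hy : 0 < y) (hy2 : y ≤ 2) :
    |bd ε 1 y| ≤ 16 := by
  have a1 := S1_le he (x := y+1) (by rw [abs_le]; constructor <;> linarith)
  have a2 := S1_le he (x := y) (by rw [abs_le]; constructor <;> linarith)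
  have a3 := S1_le he (x := y-1) (by rw [abs_le]; constructor <;> linarith)
  unfold bd; rw [abs_le] at *; norm_num; constructor <;> linarith [a1.1, a1.2, a2.1,a2.2,a3.1,a3.2]

lemma ker_of_pos (ε : ℝ) {x : ℝ} (hx : 0 < x) : ker ε x = (√x)⁻¹ := by
  simp [ker, sg, hx.le, abs_of_pos hx]

lemma kd_of_pos (ε : ℝ) {x : ℝ} (hx : 0 < x) : kd ε x = -((√x)⁻¹)^3/2 := by
  have h3 : √x * √x = x := Real.mul_self_sqrt hx.le
  have h2 : 0 < √x := (Real.sqrt_pos.mpr hx)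
  simp only [kd, sg, hx.le, abs_of_pos hx, if_true]
  field_simp
  nlinarith

lemma inv_sqrt_diff {x y : ℝ} (hy : 2 ≤ y) (hx : x ∈ Set.Icc (y-1) (y+1)) :
    |(√x)⁻¹ - (√y)⁻¹| ≤ 3/2 * ((√y)⁻¹)^3 ∧ (√x)⁻¹ ≤ 3/2 * (√y)⁻¹ := by
  have hx0 : 0 < x := by linarith [hx.1]
  have hy0 : 0 < y := by linarith
  have hs : 0 < √x := Real.sqrt_pos.mpr hx0
  have ht : 0 < √y := Real.sqrt_pos.mpr hy0
  have hs2 : √x * √x = x := Real.mul_self_sqrt hx0.le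
  have ht2 : √y * √y = y := Real.mul_self_sqrt hy0.le
  have key : √y ≤ 3/2 * √x := by
    rw [Real.sqrt_le_left (by positivity)]
    nlinarith [hx.1]
  have k2 : (√x)⁻¹ ≤ 3/2 * (√y)⁻¹ := by
    rw [inv_eq_one_div, inv_eq_one_div, mul_one_div, div_le_div_iff₀ hs ht]; linarith
  refine ⟨?_, k2⟩
  have e : (√x)⁻¹ - (√y)⁻¹ = (y - x) * ((√x)⁻¹ * (√y)⁻¹ * (√x + √y)⁻¹) := by
    field_simp; nlinarith
  have h1 : |y - x| ≤ 1 := by rw [abs_le]; constructor <;> linarith [hx.1, hx.2]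
  have hi : 0 < (√y)⁻¹ := by positivity
  have h3 : (√x + √y)⁻¹ ≤ (√y)⁻¹ := inv_anti₀ ht (by linarith)
  rw [e, abs_mul, abs_of_pos (by positivity : 0 < (√x)⁻¹ * (√y)⁻¹ * (√x + √y)⁻¹)]
  calc |y-x| * ((√x)⁻¹ * (√y)⁻¹ * (√x + √y)⁻¹) ≤ 1 * ((3/2 * (√y)⁻¹) * (√y)⁻¹ * (√y)⁻¹) := by
        gcongr
    _ = _ := by ring

lemma tau_large {ε : ℝ} (he : ε = 1 ∨ ε = -1) {y : ℝ} (hy : 2 ≤ y) :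
    |tau ε 1 y| ≤ 3 * ((√y)⁻¹)^3 := by
  have := second_diff (F := S2 ε) (F1 := S1 ε) (F2 := ker ε) (y := y) (M := 3/2 * ((√y)⁻¹)^3)
    (fun x hx => hasDerivAt_S2 he x)
    (fun x hx => hasDerivAt_S1 he (by linarith [hx.1] : 0 < x).ne')
    (fun x hx => by
      rw [ker_of_pos ε (by linarith [hx.1]), ker_of_pos ε (by linarith)]
      exact (inv_sqrt_diff hy hx).1)
  unfold tau bb
  rw [abs_sub_comm, one_pow, div_one]
  linarith

lemma td_large {ε : ℝ} (he : ε = 1 ∨ ε = -1) {y : ℝ} (hy : 2 ≤ y) :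
    |td ε 1 y| ≤ 10 * ((√y)⁻¹)^5 := by
  have := second_diff (F := S1 ε) (F1 := ker ε) (F2 := kd ε) (y := y) (M := 5 * ((√y)⁻¹)^5)
    (fun x hx => hasDerivAt_S1 he (by linarith [hx.1] : 0 < x).ne')
    (fun x hx => hasDerivAt_ker he (by linarith [hx.1] : 0 < x).ne')
    (fun x hx => by
      rw [kd_of_pos ε (by linarith [hx.1]), kd_of_pos ε (by linarith)]
      obtain ⟨h1, h2⟩ := inv_sqrt_diff hy hx
      have h3 : 0 < (√x)⁻¹ := by
        have : 0 < x := by linarith [hx.1]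
        positivity
      have h4 : 0 < (√y)⁻¹ := by
        have : 0 < y := by linarith
        positivity
      generalize (√x)⁻¹ = a at *
      generalize (√y)⁻¹ = b at *
      rw [show -a^3/2 - -b^3/2 = -((a - b) * ((a^2+a*b+b^2)/2)) by ring, abs_neg, abs_mul,
        abs_of_pos (by positivity : 0 < (a^2+a*b+b^2)/2)]
      calc |a-b| * ((a^2+a*b+b^2)/2) ≤ (3/2*b^3) * (((3/2*b)^2+(3/2*b)*b+b^2)/2) := by gcongr
        _ ≤ 5 * b^5 := by ring_nf; nlinarith [pow_pos h4 5])
  unfold td bd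
  rw [abs_sub_comm, one_pow, div_one]
  linarith

lemma tau_one {ε : ℝ} (he : ε = 1 ∨ ε = -1) {y : ℝ} (hy : 0 < y) :
    |tau ε 1 y| ≤ 50 * (√y)⁻¹ ∧ |tau ε 1 y| ≤ 100 * ((√y)⁻¹)^3 ∧ |bb ε 1 y| ≤ 32 ∧
    |td ε 1 y| ≤ 50 * ((√y)⁻¹)^3 ∧ |td ε 1 y| ≤ 100 * ((√y)⁻¹)^4 := by
  have hi : 0 < (√y)⁻¹ := by positivity
  rcases le_total y 2 with h | h
  · have b0 := bb_small he hy h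
    have b1 := bd_small he hy h
    have hs : 2/3 ≤ (√y)⁻¹ := by
      rw [le_inv_comm₀ (by norm_num) (by positivity), Real.sqrt_le_left (by positivity)]; linarith
    have t1 : |tau ε 1 y| ≤ (√y)⁻¹ + 32 := by
      unfold tau; refine (abs_sub _ _).trans ?_
      rw [ker_of_pos ε hy, abs_of_pos hi]; linarith
    have t2 : |td ε 1 y| ≤ ((√y)⁻¹)^3/2 + 16 := by
      unfold td; refine (abs_sub _ _).trans ?_
      rw [kd_of_pos ε hy, neg_div, abs_neg, abs_of_pos (by positivity)]; linarith
    have hs2 : 1/2 ≤ ((√y)⁻¹)^2 := by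
      rw [inv_pow, Real.sq_sqrt hy.le, one_div]; exact inv_anti₀ hy h
    generalize (√y)⁻¹ = b at *
    have h3 : 1/3 ≤ b^3 := by nlinarith
    have h4 : 1/4 ≤ b^4 := by nlinarith
    refine ⟨by linarith, by nlinarith, b0, by linarith, by nlinarith⟩
  · have t1 := tau_large he h
    have t2 := td_large he h
    have hs : (√y)⁻¹ ≤ 1 := inv_le_one_of_one_le₀ (by rw [Real.one_le_sqrt]; linarith)
    have b1 : |bb ε 1 y| ≤ |tau ε 1 y| + (√y)⁻¹ := by
      have : bb ε 1 y = ker ε y - tau ε 1 y := by unfold tau; ring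
      rw [this]; refine (abs_sub _ _).trans ?_
      rw [ker_of_pos ε hy, abs_of_pos hi]; linarith
    generalize (√y)⁻¹ = b at *
    have p1 : b^3 ≤ b := by nlinarith [sq_nonneg b, mul_nonneg hi.le hi.le]
    have p2 : b^5 ≤ b^3 := pow_le_pow_of_le_one hi.le hs (by norm_num)
    have p3 : b^5 ≤ b^4 := pow_le_pow_of_le_one hi.le hs (by norm_num)
    have := pow_pos hi 3
    have := pow_pos hi 4
    exact ⟨by linarith, by linarith, by linarith, by linarith, by linarith⟩

lemma tau_one' {ε : ℝ} (he : ε = 1 ∨ ε = -1) {x : ℝ} (hx : x ≠ 0) :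
    |tau ε 1 x| ≤ 50 * (√|x|)⁻¹ ∧ |tau ε 1 x| ≤ 100 * ((√|x|)⁻¹)^3 ∧ |bb ε 1 x| ≤ 32 ∧
    |td ε 1 x| ≤ 50 * ((√|x|)⁻¹)^3 ∧ |td ε 1 x| ≤ 100 * ((√|x|)⁻¹)^4 := by
  rcases lt_or_gt_of_ne hx with h | h
  · have := tau_one he (y := -x) (by linarith)
    rw [tau_neg he, td_neg he, bb_neg he, abs_mul, abs_mul, abs_mul, abs_he he, abs_neg, abs_he he,
      one_mul, one_mul, one_mul] at this
    rwa [abs_of_neg h]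
  · rw [abs_of_pos h]; exact tau_one he h

lemma sqrt_cube {x : ℝ} (hx : 0 ≤ x) : (√x)^3 = x * √x := by
  rw [pow_succ, Real.sq_sqrt hx]

lemma tau_eq_one (ε : ℝ) {V : ℝ} (hV : 0 < V) (x : ℝ) : tau ε V x = tau ε 1 (x/V) / √V := by
  rw [← tau_scale ε hV, mul_one, mul_div_cancel₀ _ hV.ne']
lemma td_eq_one (ε : ℝ) {V : ℝ} (hV : 0 < V) (x : ℝ) : td ε V x = td ε 1 (x/V) / (V*√V) := by
  rw [← td_scale ε hV, mul_one, mul_div_cancel₀ _ hV.ne']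
lemma bb_eq_one (ε : ℝ) {V : ℝ} (hV : 0 < V) (x : ℝ) : bb ε V x = bb ε 1 (x/V) / √V := by
  rw [← bb_scale ε hV, mul_one, mul_div_cancel₀ _ hV.ne']

lemma tau_bd1 {ε : ℝ} (he : ε = 1 ∨ ε = -1) {V x : ℝ} (hV : 0 < V) (hx : x ≠ 0) :
    |tau ε V x| ≤ 50 / √|x| := by
  have h := (tau_one' he (div_ne_zero hx hV.ne')).1
  rw [tau_eq_one ε hV, abs_div, abs_of_nonneg (Real.sqrt_nonneg V), div_le_iff₀ (by positivity)]
  refine h.trans (le_of_eq ?_)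
  rw [abs_div, abs_of_pos hV, Real.sqrt_div (abs_nonneg _)]; field_simp

lemma tau_bd3 {ε : ℝ} (he : ε = 1 ∨ ε = -1) {V x : ℝ} (hV : 0 < V) (hx : x ≠ 0) :
    |tau ε V x| ≤ 100 * V / (|x| * √|x|) := by
  have h := (tau_one' he (div_ne_zero hx hV.ne')).2.1
  rw [tau_eq_one ε hV, abs_div, abs_of_nonneg (Real.sqrt_nonneg V), div_le_iff₀ (by positivity)]
  refine h.trans (le_of_eq ?_)
  rw [abs_div, abs_of_pos hV, Real.sqrt_div (abs_nonneg _), ← sqrt_cube (abs_nonneg _)]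
  have : 0 < |x| := abs_pos.mpr hx
  have h2 : V = √V^2 := (Real.sq_sqrt hV.le).symm
  field_simp
  exact h2.symm

lemma td_bd3 {ε : ℝ} (he : ε = 1 ∨ ε = -1) {V x : ℝ} (hV : 0 < V) (hx : x ≠ 0) :
    |td ε V x| ≤ 50 / (|x| * √|x|) := by
  have h := (tau_one' he (div_ne_zero hx hV.ne')).2.2.2.1
  rw [td_eq_one ε hV, abs_div, abs_of_nonneg (by positivity : 0 ≤ V * √V),
    div_le_iff₀ (by positivity)]
  refine h.trans (le_of_eq ?_)
  rw [abs_div, abs_of_pos hV, Real.sqrt_div (abs_nonneg _), ← sqrt_cube (abs_nonneg _),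
    ← sqrt_cube hV.le]
  have : 0 < |x| := abs_pos.mpr hx
  field_simp

lemma td_bd4 {ε : ℝ} (he : ε = 1 ∨ ε = -1) {V x : ℝ} (hV : 0 < V) (hx : x ≠ 0) :
    |td ε V x| ≤ 100 * √V / (|x| * |x|) := by
  have h := (tau_one' he (div_ne_zero hx hV.ne')).2.2.2.2
  rw [td_eq_one ε hV, abs_div, abs_of_nonneg (by positivity : 0 ≤ V * √V),
    div_le_iff₀ (by positivity)]
  refine h.trans (le_of_eq ?_)
  have : 0 < |x| := abs_pos.mpr hx
  have h2 : √|x|^4 = |x| * |x| := by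
    rw [show √|x|^4 = √|x|^2 * √|x|^2 by ring, Real.sq_sqrt this.le]
  rw [abs_div, abs_of_pos hV, Real.sqrt_div (abs_nonneg _), ← sqrt_cube hV.le, ← h2]
  field_simp

lemma bb_zero_le {ε : ℝ} (he : ε = 1 ∨ ε = -1) : |bb ε 1 0| ≤ 32 := by
  have a1 := S2_le he (x := 1) (by norm_num)
  have a3 := S2_le he (x := -1) (by norm_num)
  unfold bb; rw [S2_zero]; norm_num; rw [abs_le] at *; constructor <;> linarith [a1.1, a1.2, a3.1,a3.2]

lemma bb_bd {ε : ℝ} (he : ε = 1 ∨ ε = -1) {V : ℝ} (hV : 0 < V) (x : ℝ) :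
    |bb ε V x| ≤ 32 / √V := by
  rw [bb_eq_one ε hV, abs_div, abs_of_nonneg (Real.sqrt_nonneg V)]
  gcongr
  by_cases hx : x / V = 0
  · rw [hx]; exact bb_zero_le he
  · exact (tau_one' he hx).2.2.1

lemma bd_bd {ε : ℝ} (he : ε = 1 ∨ ε = -1) {V : ℝ} (hV : 0 < V) {x : ℝ} (hx : |x| ≤ V) :
    |bd ε V x| ≤ 16 / (V * √V) := by
  have h0 : bd ε V x = bd ε 1 (x/V) / (V*√V) := by
    rw [← bd_scale ε hV, mul_one, mul_div_cancel₀ _ hV.ne']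
  rw [h0, abs_div, abs_of_nonneg (by positivity : 0 ≤ V * √V)]
  gcongr
  have hx' : |x/V| ≤ 1 := by rw [abs_div, abs_of_pos hV, div_le_one hV]; exact hx
  generalize x/V = y at *
  rw [abs_le] at hx'
  have a1 := S1_le he (x := y+1) (by rw [abs_le]; constructor <;> linarith)
  have a2 := S1_le he (x := y) (by rw [abs_le]; constructor <;> linarith)
  have a3 := S1_le he (x := y-1) (by rw [abs_le]; constructor <;> linarith)
  unfold bd; rw [abs_le] at *; norm_num; constructor <;> linarith [a1.1, a1.2, a2.1,a2.2,a3.1,a3.2]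

end TTR

namespace TTR

/-! ### Periodization -/

lemma rpow_three_half {x : ℝ} (hx : 0 ≤ x) : x ^ (3/2 : ℝ) = x * √x := by
  rcases hx.eq_or_lt with h | h
  · rw [← h]; simp
  · rw [show (3/2:ℝ) = 1 + 1/2 by norm_num, Real.rpow_add h, Real.rpow_one, Real.sqrt_eq_rpow]

lemma summable_base (y : ℝ) : Summable (fun n : ℤ => 1 / (|y + n| * √|y + n|)) := by
  have := (Real.summable_one_div_int_add_rpow y (3/2)).mpr (by norm_num)
  refine this.congr fun n => ?_
  rw [rpow_three_half (abs_nonneg _), add_comm]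

/-- finitely many junk points do not hurt -/
lemma summable_tau {ε : ℝ} (he : ε = 1 ∨ ε = -1) {V : ℝ} (hV : 0 < V) (y : ℝ) :
    Summable (fun n : ℤ => tau ε V (y + n)) := by
  have h1 := (summable_base y).mul_left (100 * V)
  refine Summable.of_norm_bounded_eventually h1 ?_
  have : ({n : ℤ | y + n = 0}).Finite := by
    refine Set.Subsingleton.finite fun a ha b hb => ?_
    simp only [Set.mem_ofPred_eq] at ha hb
    have : (a:ℝ) = b := by linarith
    exact_mod_cast this
  filter_upwards [this.compl_mem_cofinite] with n hn
  have := tau_bd3 he hV (x := y + n) hn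
  rw [Real.norm_eq_abs]
  refine this.trans (le_of_eq ?_)
  ring

/-- The periodic function. -/
noncomputable def f (ε y : ℝ) : ℝ := ∑' n : ℤ, tau ε 1 (y + n)

lemma bb_nat (ε : ℝ) (m : ℕ) (x : ℝ) :
    bb ε m x = (∑ j ∈ range m, ∑ i ∈ range m, bb ε 1 (x + i - j)) / (m:ℝ)^2 := by
  unfold bb
  congr 1
  simp only [one_pow, div_one]
  have h1 : ∀ j : ℕ, ∑ i ∈ range m, (S2 ε (x + i - j + 1) - 2 * S2 ε (x + i - j) + S2 ε (x + i - j - 1))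
      = (S2 ε (x - j + m) - S2 ε (x - j + m - 1)) - (S2 ε (x - j) - S2 ε (x - j - 1)) := by
    intro j
    have := Finset.sum_range_sub (fun i : ℕ => S2 ε (x - j + i) - S2 ε (x - j + i - 1)) m
    simp only [Nat.cast_zero, add_zero] at this
    rw [← this]
    refine Finset.sum_congr rfl fun i _ => ?_
    push_cast
    rw [show x + i - j + 1 = x - j + (i + 1) by ring, show x + i - j = x - j + i by ring,
      show x - j + (i+1:ℝ) - 1 = x - j + i by ring]
    ring
  simp_rw [h1]
  have := Finset.sum_range_sub (fun j : ℕ => S2 ε (x - j) - S2 ε (x - j + m)) m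
  simp only [Nat.cast_zero, sub_zero] at this
  rw [show S2 ε (x + m) - 2 * S2 ε x + S2 ε (x - m) = (S2 ε (x - m) - S2 ε (x - m + m)) -
    (S2 ε x - S2 ε (x + m)) by rw [sub_add_cancel]; ring, ← this]
  refine Finset.sum_congr rfl fun j _ => ?_
  push_cast
  rw [show x - (j + 1 : ℝ) = x - j - 1 by ring, show x - j - 1 + (m:ℝ) = x - j + m - 1 by ring]
  ring

lemma bb_decay {ε : ℝ} (he : ε = 1 ∨ ε = -1) {x : ℝ} (hx : x ≠ 0) : |bb ε 1 x| ≤ 51 / √|x| := by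
  have h1 := tau_bd1 he one_pos hx
  have h2 := ker_abs he x
  have : bb ε 1 x = ker ε x - tau ε 1 x := by unfold tau; ring
  rw [this]
  refine (abs_sub _ _).trans ?_
  rw [h2, show 51 / √|x| = 1 / √|x| + 50 / √|x| by ring]; linarith

lemma bb_tendsto {ε : ℝ} (he : ε = 1 ∨ ε = -1) :
    Filter.Tendsto (bb ε 1) (Filter.cocompact ℝ) (nhds 0) := by
  have h : Filter.Tendsto (fun x : ℝ => 51 / √|x|) (Filter.cocompact ℝ) (nhds 0) := by
    have h1 : Filter.Tendsto (fun x : ℝ => |x|) (Filter.cocompact ℝ) Filter.atTop :=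
      tendsto_norm_cocompact_atTop
    exact (Real.tendsto_sqrt_atTop.comp h1).const_div_atTop 51
  refine squeeze_zero_norm' ?_ h
  have : ({0} : Set ℝ)ᶜ ∈ Filter.cocompact ℝ := isCompact_singleton.compl_mem_cocompact
  filter_upwards [this] with x hx
  exact bb_decay he hx

lemma bb_tendsto_nat {ε : ℝ} (he : ε = 1 ∨ ε = -1) (y : ℝ) :
    Filter.Tendsto (fun N : ℕ => bb ε 1 (y + N)) Filter.atTop (nhds 0) := by
  refine (bb_tendsto he).comp (Filter.Tendsto.mono_right ?_ atTop_le_cocompact)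
  exact Filter.tendsto_atTop_add_const_left _ _ tendsto_natCast_atTop_atTop

lemma bb_tendsto_nat' {ε : ℝ} (he : ε = 1 ∨ ε = -1) (y : ℝ) :
    Filter.Tendsto (fun N : ℕ => bb ε 1 (y - N)) Filter.atTop (nhds 0) := by
  refine (bb_tendsto he).comp (Filter.Tendsto.mono_right ?_ atBot_le_cocompact)
  simp only [sub_eq_add_neg]
  exact Filter.tendsto_atBot_add_const_left _ _
    (Filter.tendsto_neg_atTop_atBot.comp tendsto_natCast_atTop_atTop)

/-- sum over the window `[-N, N)` -/
noncomputable def win (g : ℝ → ℝ) (N : ℕ) (y : ℝ) : ℝ := ∑ n ∈ range (2 * N), g (y - N + n)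

lemma win_eq (g : ℝ → ℝ) (N : ℕ) (y : ℝ) :
    win g N y = ∑ n ∈ Finset.Ico (-(N:ℤ)) N, g (y + n) := by
  unfold win
  refine Finset.sum_bij (fun n _ => (n:ℤ) - N) ?_ ?_ ?_ ?_
  · intro a ha; simp at ha ⊢; omega
  · intro a _ b _ hab; omega
  · intro b hb; simp at hb
    exact ⟨(b + N).toNat, by simp; omega, by simp; omega⟩
  · intro a _; push_cast; congr 1; ring

lemma win_tendsto {g : ℝ → ℝ} {y s : ℝ} (h : HasSum (fun n : ℤ => g (y + n)) s) :
    Filter.Tendsto (fun N : ℕ => win g N y) Filter.atTop (nhds s) := by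
  have h1 : Filter.Tendsto (fun N : ℕ => Finset.Ico (-(N:ℤ)) N) Filter.atTop Filter.atTop := by
    refine Filter.tendsto_atTop_finset_of_monotone (fun a b hab => ?_) (fun x => ?_)
    · apply Finset.Ico_subset_Ico <;> omega
    · exact ⟨x.natAbs + 1, by rw [Finset.mem_Ico]; omega⟩
  have h2 := h.comp h1
  refine h2.congr fun N => ?_
  simp only [Function.comp]
  rw [win_eq]

lemma win_shift (g : ℝ → ℝ) (N : ℕ) (y : ℝ) :
    win g N (y + 1) - win g N y = g (y + N) - g (y - N) := by
  unfold win
  rw [← Finset.sum_sub_distrib]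
  have := Finset.sum_range_sub (fun i : ℕ => g (y - N + i)) (2 * N)
  simp only [Nat.cast_zero, add_zero] at this
  rw [show y + (N:ℝ) = y - N + (2 * N : ℕ) by push_cast; ring, ← this]
  refine Finset.sum_congr rfl fun i _ => ?_
  push_cast
  congr 2; ring

lemma win_shift_nat {ε : ℝ} (he : ε = 1 ∨ ε = -1) (y : ℝ) (m : ℕ) :
    Filter.Tendsto (fun N : ℕ => win (bb ε 1) N (y + m) - win (bb ε 1) N y)
      Filter.atTop (nhds 0) := by
  induction m with
  | zero => simp
  | succ m ih =>
    have h1 := (bb_tendsto_nat he (y+m)).sub (bb_tendsto_nat' he (y + m))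
    have := h1.add ih
    simp only [sub_zero, add_zero] at this
    refine this.congr fun N => ?_
    rw [← win_shift]
    push_cast
    rw [show y + (m + 1 : ℝ) = y + m + 1 by ring]; ring

lemma win_shift_int {ε : ℝ} (he : ε = 1 ∨ ε = -1) (y : ℝ) (i j : ℕ) :
    Filter.Tendsto (fun N : ℕ => win (bb ε 1) N (y + i - j) - win (bb ε 1) N y)
      Filter.atTop (nhds 0) := by
  have h1 := win_shift_nat he (y - j) i
  have h2 := win_shift_nat he (y - j) j
  have := h1.sub h2
  simp only [sub_zero] at this
  refine this.congr fun N => ?_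
  rw [sub_add_cancel, show y + i - (j:ℝ) = y - j + i by ring]; ring

lemma hasSum_tau {ε : ℝ} (he : ε = 1 ∨ ε = -1) {m : ℕ} (hm : 0 < m) (y : ℝ) :
    HasSum (fun n : ℤ => tau ε m (y + n)) (f ε y) := by
  have hm' : (0:ℝ) < m := by exact_mod_cast hm
  have s1 := (summable_tau he one_pos y).hasSum
  have s2 := (summable_tau he hm' y).hasSum
  suffices h : ∑' n : ℤ, tau ε m (y + n) = f ε y by rwa [h] at s2
  have t1 := win_tendsto s1
  have t2 := win_tendsto s2
  have t3 := t2.sub t1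
  have t4 : Filter.Tendsto (fun N => win (tau ε m) N y - win (tau ε 1) N y) Filter.atTop (nhds 0) := by
    have : Filter.Tendsto (fun N => -(∑ j ∈ range m, ∑ i ∈ range m,
        (win (bb ε 1) N (y + i - j) - win (bb ε 1) N y)) / (m:ℝ)^2) Filter.atTop
        (nhds (-(∑ j ∈ range m, ∑ i ∈ range m, 0) / (m:ℝ)^2)) := by
      refine Filter.Tendsto.div_const (Filter.Tendsto.neg ?_) _
      exact tendsto_finsetSum _ fun j _ => tendsto_finsetSum _ fun i _ => win_shift_int he y i j
    simp only [Finset.sum_const_zero, neg_zero, zero_div] at this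
    refine this.congr fun N => ?_
    have e1 : win (tau ε m) N y - win (tau ε 1) N y = win (bb ε 1) N y - win (bb ε m) N y := by
      unfold win; rw [← Finset.sum_sub_distrib, ← Finset.sum_sub_distrib]
      refine Finset.sum_congr rfl fun n _ => ?_
      unfold tau; ring
    have e2 : win (bb ε m) N y = (∑ j ∈ range m, ∑ i ∈ range m, win (bb ε 1) N (y + i - j)) / (m:ℝ)^2 := by
      unfold win
      simp_rw [bb_nat ε m]
      rw [← Finset.sum_div, Finset.sum_comm]
      congr 1
      refine Finset.sum_congr rfl fun j _ => ?_
      rw [Finset.sum_comm]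
      refine Finset.sum_congr rfl fun i _ => ?_
      refine Finset.sum_congr rfl fun n _ => ?_
      congr 1; ring
    rw [e1, e2]
    simp only [Finset.sum_sub_distrib, Finset.sum_const, Finset.card_range, nsmul_eq_mul]
    field_simp
    ring
  have := tendsto_nhds_unique t3 t4
  unfold f; linarith

lemma hasSum_tau_scaled {ε : ℝ} (he : ε = 1 ∨ ε = -1) {m : ℕ} (hm : 0 < m) {l : ℝ} (hl : 0 < l)
    (y : ℝ) : HasSum (fun n : ℤ => tau ε (l * m) (y + l * n)) (f ε (y / l) / √l) := by
  have := (hasSum_tau he hm (y / l)).div_const (√l)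
  refine HasSum.congr_fun this fun n => ?_
  rw [← tau_scale ε hl]
  congr 1
  field_simp

lemma f_add_int (ε y : ℝ) (m : ℤ) : f ε (y + m) = f ε y := by
  unfold f
  rw [← (Equiv.addRight m).tsum_eq (fun n : ℤ => tau ε 1 (y + n))]
  refine tsum_congr fun n => ?_
  simp only [Equiv.coe_addRight]; push_cast; congr 1; ring

lemma f_neg {ε : ℝ} (he : ε = 1 ∨ ε = -1) (y : ℝ) : f ε (-y) = ε * f ε y := by
  unfold f
  rw [← (Equiv.neg ℤ).tsum_eq (fun n : ℤ => tau ε 1 (-y + n)), ← tsum_mul_left]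
  refine tsum_congr fun n => ?_
  simp only [Equiv.neg_apply]; push_cast; rw [← tau_neg he]; congr 1; ring

/-- `Σ_{n<N} (n+x)^{-1/2}` -/
noncomputable def Z (N : ℕ) (x : ℝ) : ℝ := ∑ n ∈ range N, (√(n + x))⁻¹

noncomputable def gN (ε : ℝ) (N : ℕ) (x : ℝ) : ℝ :=
  (Z N x - 2 * √N) + ε * (Z N (1 - x) - 2 * √N)

lemma win_ker {ε : ℝ} (he : ε = 1 ∨ ε = -1) {x : ℝ} (hx : x ∈ Set.Ioo (0:ℝ) 1) (N : ℕ) :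
    win (ker ε) N x = Z N x + ε * Z N (1 - x) := by
  unfold win Z
  rw [two_mul, Finset.sum_range_add, add_comm]
  congr 1
  · refine Finset.sum_congr rfl fun n _ => ?_
    push_cast
    rw [show x - N + (N + n : ℝ) = n + x by ring, ker_of_pos ε (by have := hx.1; positivity)]
  · rw [← Finset.sum_range_reflect, Finset.mul_sum]
    refine Finset.sum_congr rfl fun n hn => ?_
    have hn' := Finset.mem_range.mp hn
    rw [Nat.cast_sub (by omega), Nat.cast_sub (by omega), Nat.cast_one,
      show x - N + ((N:ℝ) - 1 - n) = -(n + (1 - x)) by ring, ker_neg he,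
      ker_of_pos ε (by have := hx.2; have : (0:ℝ) ≤ n := n.cast_nonneg; linarith)]

lemma S2_step {ε : ℝ} (he : ε = 1 ∨ ε = -1) {N : ℕ} (hN : 1 ≤ N) {z : ℝ} (h1 : (N:ℝ) - 1 ≤ z)
    (h2 : z ≤ N) : |S2 ε (z + 1) - S2 ε z - 2 * √N| ≤ 2 / √N := by
  have hN' : (1:ℝ) ≤ N := by exact_mod_cast hN
  obtain ⟨c, hc, hc'⟩ := exists_hasDerivAt_eq_slope (S2 ε) (S1 ε) (show z < z + 1 by linarith)
    (continuous_S2 he).continuousOn (fun x _ => hasDerivAt_S2 he x)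
  have hc0 : 0 < c := by linarith [hc.1]
  have e : S2 ε (z+1) - S2 ε z = 2 * √c := by
    rw [add_sub_cancel_left, div_one] at hc'
    rw [← hc']; simp [S1, sg, hc0.le, abs_of_pos hc0]
  have p1 : 0 < √c := Real.sqrt_pos.mpr hc0
  have p2 : 0 < √(N:ℝ) := Real.sqrt_pos.mpr (by linarith)
  have q1 : √c * √c = c := Real.mul_self_sqrt hc0.le
  have q2 : √(N:ℝ) * √N = N := Real.mul_self_sqrt (by linarith)
  rw [e, le_div_iff₀ p2, ← mul_sub, abs_mul, abs_two, mul_assoc]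
  have : |√c - √N| * √N ≤ |√c - √N| * (√c + √N) := by gcongr; linarith
  have h3 : |√c - √N| * (√c + √N) ≤ 1 := by
    rw [← abs_of_pos (by positivity : 0 < √c + √N), ← abs_mul,
      show (√c - √N) * (√c + √N) = c - N by nlinarith, abs_le]
    constructor <;> linarith [hc.1, hc.2]
  linarith

lemma win_bb {ε : ℝ} (he : ε = 1 ∨ ε = -1) {x : ℝ} (hx : x ∈ Set.Ioo (0:ℝ) 1) {N : ℕ} (hN : 1 ≤ N) :
    |win (bb ε 1) N x - (2 * √N + ε * (2 * √N))| ≤ 4 / √N := by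
  have e : win (bb ε 1) N x = (S2 ε (x + N - 1 + 1) - S2 ε (x + N - 1)) +
      ε * (S2 ε (N - x + 1) - S2 ε (N - x)) := by
    have := Finset.sum_range_sub (fun i : ℕ => S2 ε (x - N + i) - S2 ε (x - N + i - 1)) (2*N)
    simp only [Nat.cast_zero, add_zero] at this
    have e2 : ε * (S2 ε (N - x + 1) - S2 ε (N - x)) = S2 ε (x - N - 1) - S2 ε (x - N) := by
      rw [mul_sub, ← S2_neg he, ← S2_neg he]; congr 2 <;> ring
    have e3 : win (bb ε 1) N x = ∑ i ∈ range (2*N), (S2 ε (x - N + (i+1:ℕ)) - S2 ε (x - N + (i+1:ℕ) - 1)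
       - (S2 ε (x - N + i) - S2 ε (x - N + i - 1))) := by
      unfold win bb
      refine Finset.sum_congr rfl fun i _ => ?_
      push_cast
      rw [show x - N + (i + 1 : ℝ) = x - N + i + 1 by ring, add_sub_cancel_right]; ring
    rw [e3, this, e2]; push_cast
    rw [show x - N + 2 * (N:ℝ) = x + N by ring, sub_add_cancel]; ring
  have a1 := S2_step he hN (z := x + N - 1) (by linarith [hx.1]) (by linarith [hx.2])
  have a2 := S2_step he hN (z := N - x) (by linarith [hx.2]) (by linarith [hx.1])
  rw [e, show ∀ a b c : ℝ, a + ε * b - (c + ε * c) = (a - c) + ε * (b - c) by intros; ring]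
  refine (abs_add_le _ _).trans ?_
  rw [abs_mul, abs_he he, one_mul, show 4 / √(N:ℝ) = 2 / √N + 2 / √N by ring]
  linarith

lemma gN_win {ε : ℝ} (he : ε = 1 ∨ ε = -1) {x : ℝ} (hx : x ∈ Set.Ioo (0:ℝ) 1) {N : ℕ} (hN : 1 ≤ N) :
    |gN ε N x - win (tau ε 1) N x| ≤ 4 / √N := by
  have e : win (tau ε 1) N x = win (ker ε) N x - win (bb ε 1) N x := by
    unfold win tau; rw [Finset.sum_sub_distrib]
  rw [e, win_ker he hx]
  refine le_trans (le_of_eq ?_) (win_bb he hx hN)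
  congr 1; unfold gN; ring

lemma f_hasSum {ε : ℝ} (he : ε = 1 ∨ ε = -1) (y : ℝ) : HasSum (fun n : ℤ => tau ε 1 (y+n)) (f ε y) :=
  (summable_tau he one_pos y).hasSum

lemma gN_tendsto {ε : ℝ} (he : ε = 1 ∨ ε = -1) {x : ℝ} (hx : x ∈ Set.Ioo (0:ℝ) 1) :
    Filter.Tendsto (fun N => gN ε N x) Filter.atTop (nhds (f ε x)) := by
  have h1 := win_tendsto (f_hasSum he x)
  have h2 : Filter.Tendsto (fun N : ℕ => gN ε N x - win (tau ε 1) N x) Filter.atTop (nhds 0) := by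
    have h : Filter.Tendsto (fun N : ℕ => 4 / √(N:ℝ)) Filter.atTop (nhds 0) :=
      (Real.tendsto_sqrt_atTop.comp tendsto_natCast_atTop_atTop).const_div_atTop 4
    refine squeeze_zero_norm' ?_ h
    filter_upwards [Filter.eventually_ge_atTop 1] with N hN
    exact gN_win he hx hN
  have := h1.add h2
  simp only [add_zero] at this
  refine this.congr fun N => by ring

/-- majorant -/
noncomputable def UU (n : ℤ) : ℝ := 100 * (1 / (|(0:ℝ) + n| * √|(0:ℝ) + n|)) +
  100 * (1 / (|(1:ℝ) + n| * √|(1:ℝ) + n|)) + (if n = 0 then 32 else 0) + (if n = -1 then 32 else 0)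

lemma UU_nonneg (n : ℤ) : 0 ≤ UU n := by
  unfold UU
  have : (0:ℝ) ≤ (if n = 0 then 32 else 0) := by split_ifs <;> norm_num
  have : (0:ℝ) ≤ (if n = -1 then 32 else 0) := by split_ifs <;> norm_num
  positivity

lemma UU_summable : Summable UU := by
  unfold UU
  refine Summable.add (Summable.add (((summable_base 0).mul_left _).add
    ((summable_base 1).mul_left _)) ?_) ?_
  · exact summable_of_ne_finset_zero (s := {0}) (fun b hb => by simp at hb; simp [hb])
  · exact summable_of_ne_finset_zero (s := {-1}) (fun b hb => by simp at hb; simp [hb])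

noncomputable def KU : ℝ := ∑' n, UU n

lemma ww_bd {ε : ℝ} (he : ε = 1 ∨ ε = -1) {x : ℝ} (hx : x ∈ Set.Ioo (0:ℝ) 1) (n : ℤ) :
    |tau ε 1 (x + n) - (if n = 0 then ker ε x else 0) - (if n = -1 then ker ε (x - 1) else 0)| ≤ UU n := by
  have hb := bb_bd he one_pos
  unfold UU
  by_cases h0 : n = 0
  · subst h0
    have : tau ε 1 x - ker ε x = - bb ε 1 x := by unfold tau; ring
    have h1 := hb x
    simp [this] at h1 ⊢
    linarith
  by_cases h1 : n = -1
  · subst h1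
    have : tau ε 1 (x-1) - ker ε (x-1) = - bb ε 1 (x-1) := by unfold tau; ring
    have h1 := hb (x-1)
    simp [← sub_eq_add_neg, this] at h1 ⊢
    linarith
  rw [if_neg h0, if_neg h1, if_neg h0, if_neg h1, sub_zero, sub_zero, add_zero, add_zero]
  have mono : ∀ a b : ℝ, 0 < a → a ≤ b → 100 * 1 / (b * √b) ≤ 100 * (1 / (a * √a)) := by
    intro a b ha hab
    have hb0 : 0 ≤ b := ha.le.trans hab
    rw [mul_div_assoc]; gcongr
  rcases lt_or_gt_of_ne h0 with h | h
  · have h2 : n ≤ -2 := by omega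
    have h2' : (n:ℝ) ≤ -2 := by exact_mod_cast h2
    have hne : x + n < 0 := by linarith [hx.2]
    have := tau_bd3 he one_pos hne.ne
    refine this.trans ((mono (|1 + n|) _ ?_ ?_).trans ?_)
    · rw [abs_pos]; linarith
    · rw [abs_of_neg hne, abs_of_neg (by linarith)]; linarith [hx.2]
    · have : 0 ≤ 100 * (1 / (|0 + (n:ℝ)| * √|0 + (n:ℝ)|)) := by positivity
      linarith
  · have h2 : 1 ≤ n := by omega
    have h2' : (1:ℝ) ≤ n := by exact_mod_cast h2
    have hne : 0 < x + n := by linarith [hx.1]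
    have := tau_bd3 he one_pos hne.ne'
    refine this.trans ((mono (|0 + n|) _ ?_ ?_).trans ?_)
    · rw [abs_pos]; linarith
    · rw [abs_of_pos hne, abs_of_pos (by linarith)]; linarith [hx.1]
    · have : 0 ≤ 100 * (1 / (|1 + (n:ℝ)| * √|1 + (n:ℝ)|)) := by positivity
      linarith

lemma win_bdd {ε : ℝ} (he : ε = 1 ∨ ε = -1) {x : ℝ} (hx : x ∈ Set.Ioo (0:ℝ) 1) {N : ℕ} (hN : 1 ≤ N) :
    |win (tau ε 1) N x - ker ε x - ker ε (x-1)| ≤ KU := by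
  have e : win (tau ε 1) N x - ker ε x - ker ε (x-1) = ∑ n ∈ Finset.Ico (-(N:ℤ)) N,
    (tau ε 1 (x + n) - (if n = 0 then ker ε x else 0) - (if n = -1 then ker ε (x - 1) else 0)) := by
    rw [Finset.sum_sub_distrib, Finset.sum_sub_distrib, Finset.sum_ite_eq', Finset.sum_ite_eq',
      if_pos (by rw [Finset.mem_Ico]; omega), if_pos (by rw [Finset.mem_Ico]; omega), win_eq]
  rw [e]
  refine (Finset.abs_sum_le_sum_abs _ _).trans ((Finset.sum_le_sum fun n _ => ww_bd he hx n).trans ?_)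
  exact UU_summable.sum_le_tsum _ (fun n _ => UU_nonneg n)

lemma f_bdd {ε : ℝ} (he : ε = 1 ∨ ε = -1) {x : ℝ} (hx : x ∈ Set.Ioo (0:ℝ) 1) :
    |f ε x - ker ε x - ker ε (x-1)| ≤ KU := by
  have h1 := (((win_tendsto (f_hasSum he x)).sub_const (ker ε x)).sub_const (ker ε (x-1))).abs
  refine le_of_tendsto h1 ?_
  filter_upwards [Filter.eventually_ge_atTop 1] with N hN using win_bdd he hx hN

lemma KU_nonneg : 0 ≤ KU := tsum_nonneg UU_nonneg

lemma gN_bdd {ε : ℝ} (he : ε = 1 ∨ ε = -1) {x : ℝ} (hx : x ∈ Set.Ioo (0:ℝ) 1) {N : ℕ} (hN : 1 ≤ N) :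
    |gN ε N x - ker ε x - ker ε (x-1)| ≤ KU + 4 := by
  have h1 := win_bdd he hx hN
  have h2 := gN_win he hx hN
  have h3 : 4 / √(N:ℝ) ≤ 4 := div_le_self (by norm_num) (by rw [Real.one_le_sqrt]; exact_mod_cast hN)
  rw [abs_le] at *
  constructor <;> linarith [h1.1, h1.2, h2.1, h2.2]

/-- `|f - ker| ≤ KU + 2` on `0 < |y| ≤ 1/2` -/
lemma f_ker {ε : ℝ} (he : ε = 1 ∨ ε = -1) {y : ℝ} (hy : y ≠ 0) (hy2 : |y| ≤ 1/2) :
    |f ε y - ker ε y| ≤ KU + 2 := by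
  have key : ∀ y : ℝ, 0 < y → y ≤ 1/2 → |f ε y - ker ε y| ≤ KU + 2 := by
    intro y h1 h2
    have h3 := f_bdd he (x := y) ⟨h1, by linarith⟩
    have h4 : |ker ε (y - 1)| ≤ 2 := by
      rw [ker_abs he, abs_of_neg (by linarith), div_le_iff₀ (Real.sqrt_pos.mpr (by linarith))]
      have : 1/2 ≤ √(-(y-1)) := Real.le_sqrt_of_sq_le (by norm_num; linarith)
      linarith
    rw [abs_le] at *
    constructor <;> linarith [h3.1, h3.2, h4.1, h4.2]
  rcases lt_or_gt_of_ne hy with h | h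
  · have := key (-y) (by linarith) (by linarith [abs_of_neg h])
    rwa [f_neg he, ker_neg he, ← mul_sub, abs_mul, abs_he he, one_mul] at this
  · exact key y h (by rwa [abs_of_pos h] at hy2)

lemma measurable_f {ε : ℝ} (he : ε = 1 ∨ ε = -1) : Measurable (f ε) := by
  have h : Filter.Tendsto (fun N : ℕ => win (tau ε 1) N) Filter.atTop (nhds (f ε)) := by
    rw [tendsto_pi_nhds]; intro x; exact win_tendsto (f_hasSum he x)
  refine measurable_of_tendsto_metrizable (fun N => ?_) h
  unfold win
  refine Finset.measurable_fun_sum _ fun n _ => ?_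
  exact (measurable_tau he 1).comp (by fun_prop)

end TTR

namespace TTR

/-! ### Hurwitz zeta at 1/2 -/

noncomputable def TT (x : ℝ) (n : ℕ) (s : ℂ) : ℂ :=
  (((n:ℝ) + 1 + x : ℝ) : ℂ) ^ (-s) - (((n:ℝ) + 2 : ℝ) : ℂ) ^ (-s)

lemma TT_bd {x : ℝ} (hx : x ∈ Set.Ioo (0:ℝ) 1) (n : ℕ) {s : ℂ} {R σ : ℝ} (hσ : 0 < σ)
    (h1 : σ < s.re) (h2 : ‖s‖ < R) : ‖TT x n s‖ ≤ R * (1 / ((n:ℝ)+1) ^ (1 + σ)) := by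
  have hn : (0:ℝ) ≤ n := n.cast_nonneg
  have hs : s ≠ 0 := by intro h; rw [h] at h1; simp at h1; linarith
  have key := (convex_Icc ((n:ℝ)+1) (n+2)).norm_image_sub_le_of_norm_hasDerivWithin_le
    (f := fun t : ℝ => (t:ℂ) ^ (-s)) (f' := fun t : ℝ => (-s) * (t:ℂ) ^ (-s-1))
    (C := R * (1 / ((n:ℝ)+1) ^ (1 + σ))) (x := (n:ℝ)+2) (y := (n:ℝ)+1+x) ?_ ?_
    ⟨by linarith, by linarith⟩ ⟨by linarith [hx.1], by linarith [hx.2]⟩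
  · refine key.trans ?_
    have hR : 0 ≤ R * (1 / ((n:ℝ)+1) ^ (1 + σ)) := by
      have := (norm_nonneg s).trans h2.le
      positivity
    have : ‖(n:ℝ) + 1 + x - (n + 2)‖ ≤ 1 := by
      rw [Real.norm_eq_abs, abs_le]; constructor <;> linarith [hx.1, hx.2]
    nlinarith
  · intro t ht
    have ht0 : t ≠ 0 := by linarith [ht.1]
    exact (hasDerivAt_ofReal_cpow_const ht0 (neg_ne_zero.mpr hs)).hasDerivWithinAt
  · intro t ht
    have ht0 : 0 < t := by linarith [ht.1]
    rw [norm_mul, norm_neg, Complex.norm_cpow_eq_rpow_re_of_pos ht0]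
    have : t ^ (-s-1).re ≤ 1 / ((n:ℝ)+1) ^ (1 + σ) := by
      rw [one_div, ← Real.rpow_neg (by positivity)]
      simp only [Complex.sub_re, Complex.neg_re, Complex.one_re]
      calc t ^ (-s.re - 1) ≤ ((n:ℝ)+1) ^ (-s.re - 1) :=
            Real.rpow_le_rpow_of_nonpos (by positivity) ht.1 (by linarith)
        _ ≤ ((n:ℝ)+1) ^ (-(1 + σ)) := Real.rpow_le_rpow_of_exponent_le (by linarith) (by linarith)
    have h0 := (norm_nonneg s)
    have hR : 0 ≤ R := h0.trans h2.le
    gcongr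

lemma TT_sum_bd {R σ : ℝ} (hσ : 0 < σ) : Summable fun n : ℕ => R * (1 / ((n:ℝ)+1) ^ (1 + σ)) := by
  refine Summable.mul_left _ ?_
  have := (Real.summable_one_div_nat_rpow (p := 1 + σ)).mpr (by linarith)
  have := (summable_nat_add_iff 1).mpr this
  refine this.congr fun n => by push_cast; rfl

lemma TT_summable {x : ℝ} (hx : x ∈ Set.Ioo (0:ℝ) 1) {s : ℂ} (hs : 0 < s.re) :
    Summable (fun n => TT x n s) := by
  refine Summable.of_norm_bounded (TT_sum_bd (R := ‖s‖ + 1) (half_pos hs)) fun n => ?_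
  exact TT_bd hx n (half_pos hs) (by linarith) (by linarith)

lemma TT_diff {x : ℝ} (hx : x ∈ Set.Ioo (0:ℝ) 1) :
    DifferentiableOn ℂ (fun s => ∑' n, TT x n s) {s : ℂ | 0 < s.re} := by
  intro s hs
  simp only [Set.mem_ofPred_eq] at hs
  have ho : IsOpen {w : ℂ | s.re/2 < w.re ∧ ‖w‖ < ‖s‖ + 1} :=
    (isOpen_lt continuous_const Complex.continuous_re).inter (isOpen_lt continuous_norm continuous_const)
  have := differentiableOn_tsum_of_summable_norm (F := fun n s => TT x n s)
    (TT_sum_bd (R := ‖s‖ + 1) (half_pos hs)) (fun n => ?_) ho (fun n w hw => TT_bd hx n (half_pos hs) hw.1 hw.2)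
  · refine ((this s ⟨by linarith, by linarith⟩).differentiableAt (ho.mem_nhds ⟨by linarith, by linarith⟩)).differentiableWithinAt
  · intro w hw
    refine DifferentiableAt.differentiableWithinAt ?_
    unfold TT
    have h1 : (((n:ℝ) + 1 + x : ℝ) : ℂ) ≠ 0 := by
      have : (0:ℝ) < (n:ℝ) + 1 + x := by have := hx.1; positivity
      exact_mod_cast this.ne'
    have h2 : (((n:ℝ) + 2 : ℝ) : ℂ) ≠ 0 := by
      have : (0:ℝ) < (n:ℝ) + 2 := by positivity
      exact_mod_cast this.ne'
    exact (differentiableAt_id.neg.const_cpow (Or.inl h1)).sub (differentiableAt_id.neg.const_cpow (Or.inl h2))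

lemma hurwitz_eq {x : ℝ} (hx : x ∈ Set.Ioo (0:ℝ) 1) {s : ℂ} (hs : 0 < s.re) :
    (x:ℂ) ^ (-s) - 1 + ∑' n, TT x n s =
      HurwitzZeta.hurwitzZeta (x : UnitAddCircle) s - HurwitzZeta.hurwitzZeta ((1:ℝ) : UnitAddCircle) s := by
  have ho : IsOpen {w : ℂ | 0 < w.re} := isOpen_lt continuous_const Complex.continuous_re
  have hpre : IsPreconnected {w : ℂ | 0 < w.re} := (convex_halfSpace_re_gt 0).isPreconnected
  have hx0 : (x:ℂ) ≠ 0 := by exact_mod_cast hx.1.ne'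
  have a1 : AnalyticOnNhd ℂ (fun s => (x:ℂ) ^ (-s) - 1 + ∑' n, TT x n s) {w : ℂ | 0 < w.re} := by
    refine DifferentiableOn.analyticOnNhd ?_ ho
    refine DifferentiableOn.add (fun w _ => ?_) (TT_diff hx)
    exact ((differentiableAt_id.neg.const_cpow (Or.inl hx0)).sub_const 1).differentiableWithinAt
  have a2 : AnalyticOnNhd ℂ (fun s => HurwitzZeta.hurwitzZeta (x : UnitAddCircle) s -
      HurwitzZeta.hurwitzZeta ((1:ℝ) : UnitAddCircle) s) {w : ℂ | 0 < w.re} :=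
    (HurwitzZeta.differentiable_hurwitzZeta_sub_hurwitzZeta _ _).differentiableOn.analyticOnNhd ho
  refine a1.eqOn_of_preconnected_of_eventuallyEq a2 hpre (z₀ := 2) (by simp) ?_ hs
  have : {w : ℂ | 1 < w.re} ∈ nhds (2:ℂ) :=
    (isOpen_lt continuous_const Complex.continuous_re).mem_nhds (by simp)
  filter_upwards [this] with w hw
  replace hw : 1 < w.re := hw
  have b1 := HurwitzZeta.hasSum_hurwitzZeta_of_one_lt_re (a := x) ⟨hx.1.le, hx.2.le⟩ hw
  have b2 := HurwitzZeta.hasSum_hurwitzZeta_of_one_lt_re (a := 1) ⟨by norm_num, le_rfl⟩ hw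
  have b3 := b1.sub b2
  have b4 := (hasSum_nat_add_iff' 1).mpr b3
  simp only [Finset.sum_range_one] at b4
  have b5 : HasSum (fun n => TT x n w) (HurwitzZeta.hurwitzZeta (x : UnitAddCircle) w -
      HurwitzZeta.hurwitzZeta ((1:ℝ) : UnitAddCircle) w - ((x:ℂ) ^ (-w) - 1)) := by
    have e1 : ((x:ℂ) ^ (-w) - 1) = (1 / (((0:ℕ):ℂ) + x) ^ w - 1 / (((0:ℕ):ℂ) + ((1:ℝ):ℂ)) ^ w) := by
      rw [Complex.cpow_neg]; simp
    rw [e1]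
    refine b4.congr_fun fun n => ?_
    unfold TT
    rw [Complex.cpow_neg, Complex.cpow_neg]
    push_cast
    rw [one_div, one_div, show (n:ℂ) + 1 + 1 = n + 2 by ring]
  rw [b5.tsum_eq]; ring

lemma Z_tendsto {x : ℝ} (hx : x ∈ Set.Ioo (0:ℝ) 1) :
    Filter.Tendsto (fun N : ℕ => ((Z N x - Z N 1 : ℝ) : ℂ)) Filter.atTop
      (nhds (HurwitzZeta.hurwitzZeta (x : UnitAddCircle) (1/2) -
        HurwitzZeta.hurwitzZeta ((1:ℝ) : UnitAddCircle) (1/2))) := by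
  have hr : (0:ℝ) < (1/2 : ℂ).re := by norm_num
  rw [← hurwitz_eq hx hr]
  have h1 := (TT_summable hx hr).hasSum.tendsto_sum_nat.const_add ((x:ℂ) ^ (-(1/2:ℂ)) - 1)
  rw [← Filter.tendsto_add_atTop_iff_nat 1]
  refine h1.congr fun N => ?_
  have e : ∀ t : ℝ, 0 < t → (((√t)⁻¹ : ℝ) : ℂ) = (t:ℂ) ^ (-(1/2:ℂ)) := by
    intro t ht
    rw [Real.sqrt_eq_rpow, ← Real.rpow_neg ht.le, Complex.ofReal_cpow ht.le]; push_cast; rfl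
  unfold Z
  rw [Finset.sum_range_succ', Finset.sum_range_succ', add_sub_add_comm, ← Finset.sum_sub_distrib]
  push_cast
  rw [add_comm]
  congr 1
  · refine Finset.sum_congr rfl fun n _ => ?_
    unfold TT
    rw [← e _ (by have := hx.1; positivity), ← e _ (by positivity)]
    push_cast
    congr 3
    ring_nf
  · rw [← e x hx.1]; simp

/-- `L(1/2,χ)` in terms of `f`. -/
lemma L_eq {q : ℕ} [NeZero q] (hq : 1 < q) {ε : ℝ} (he : ε = 1 ∨ ε = -1)
    (χ : DirichletCharacter ℂ q) (hχ : χ ≠ 1) (hpar : χ (-1) = (ε : ℂ)) :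
    χ.LFunction (1/2) = (q:ℂ) ^ (-(1/2:ℂ)) * ((1/2) * ∑ a : ZMod q, χ a * (f ε (a.val / q) : ℂ)) := by
  haveI : Fact (1 < q) := ⟨hq⟩
  have hq0 : (0:ℝ) < q := by exact_mod_cast (by omega : 0 < q)
  have hsum : ∑ a : ZMod q, χ a = 0 := by
    exact MulChar.sum_eq_zero_of_ne_one hχ
  have hχ0 : χ 0 = 0 := MulChar.map_zero χ
  have hmem : ∀ a : ZMod q, a ≠ 0 → ((a.val:ℝ) / q) ∈ Set.Ioo (0:ℝ) 1 := by
    intro a ha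
    have h1 : 0 < a.val := by rw [Nat.pos_iff_ne_zero]; simpa using ha
    have h2 := a.val_lt
    constructor
    · have : (0:ℝ) < a.val := by exact_mod_cast h1
      positivity
    · rw [div_lt_one hq0]; exact_mod_cast h2
  have hneg : ∀ a : ZMod q, a ≠ 0 → (((-a).val:ℝ) / q) = 1 - (a.val:ℝ)/q := by
    intro a ha
    have : NeZero a := ⟨ha⟩
    rw [ZMod.val_neg_of_ne_zero, Nat.cast_sub a.val_lt.le, sub_div, div_self hq0.ne']
  have hp : ∀ a : ZMod q, χ (-a) = ε * χ a := by
    intro a; rw [← hpar, ← map_mul, neg_one_mul]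
  have heC : (ε:ℂ) * ε = 1 := by exact_mod_cast sq_he he
  unfold DirichletCharacter.LFunction ZMod.LFunction
  congr 1
  -- the limit
  set H := HurwitzZeta.hurwitzZeta ((1:ℝ) : UnitAddCircle) (1/2) with hH
  have e1 : ∑ j : ZMod q, χ j * HurwitzZeta.hurwitzZeta (ZMod.toAddCircle j) (1/2) =
      ∑ j : ZMod q, χ j * (HurwitzZeta.hurwitzZeta (((j.val:ℝ)/q : ℝ) : UnitAddCircle) (1/2) - H) := by
    simp only [mul_sub, Finset.sum_sub_distrib, ← Finset.sum_mul, hsum, zero_mul, sub_zero,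
      ZMod.toAddCircle_apply]
  have t1 : Filter.Tendsto (fun N : ℕ => ∑ j : ZMod q, χ j * ((Z N (j.val/q) - Z N 1 : ℝ) : ℂ))
      Filter.atTop (nhds (∑ j : ZMod q, χ j *
        (HurwitzZeta.hurwitzZeta (((j.val:ℝ)/q : ℝ) : UnitAddCircle) (1/2) - H))) := by
    refine tendsto_finsetSum _ fun j _ => ?_
    by_cases hj : j = 0
    · subst hj; simp only [hχ0, zero_mul]; exact tendsto_const_nhds
    · exact (Z_tendsto (hmem j hj)).const_mul _
  have t2 : Filter.Tendsto (fun N : ℕ => (1/2:ℂ) * ∑ j : ZMod q, χ j * ((gN ε N (j.val/q) : ℝ) : ℂ))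
      Filter.atTop (nhds ((1/2:ℂ) * ∑ j : ZMod q, χ j * (f ε (j.val/q) : ℂ))) := by
    refine Filter.Tendsto.const_mul _ (tendsto_finsetSum _ fun j _ => ?_)
    by_cases hj : j = 0
    · subst hj; simp only [hχ0, zero_mul]; exact tendsto_const_nhds
    · exact ((Complex.continuous_ofReal.tendsto _).comp (gN_tendsto he (hmem j hj))).const_mul _
  rw [e1]
  refine tendsto_nhds_unique t1 (t2.congr fun N => ?_)
  have k1 : ∀ c : ℝ, ∑ j : ZMod q, χ j * ((Z N (j.val/q) - c : ℝ) : ℂ) =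
      ∑ j : ZMod q, χ j * (Z N (j.val/q) : ℂ) := by
    intro c
    simp only [Complex.ofReal_sub, mul_sub, Finset.sum_sub_distrib, ← Finset.sum_mul, hsum, zero_mul,
      sub_zero]
  have k2 : ∑ j : ZMod q, χ j * ((ε * (Z N (1 - j.val/q) - 2 * √N) : ℝ) : ℂ) =
      ∑ j : ZMod q, χ j * (Z N (j.val/q) : ℂ) := by
    rw [← k1 (2 * √N), ← Equiv.sum_comp (Equiv.neg (ZMod q))]
    refine Finset.sum_congr rfl fun j _ => ?_
    simp only [Equiv.neg_apply]
    by_cases hj : j = 0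
    · subst hj; simp [hχ0]
    rw [hp, hneg j hj, sub_sub_cancel]
    push_cast
    linear_combination (χ j * ((Z N (j.val/q) : ℂ) - 2 * (√(N:ℝ) : ℂ))) * heC
  rw [k1]
  unfold gN
  simp only [Complex.ofReal_add, mul_add, Finset.sum_add_distrib]
  rw [k2, k1]; ring

end TTR

namespace TTR

/-! ### The moment in terms of `f` -/

/-- `ZMod q × ℤ ≃ ℤ`. -/
noncomputable def resEquiv (q : ℕ) [NeZero q] : ZMod q × ℤ ≃ ℤ where
  toFun p := p.1.val + q * p.2
  invFun m := ((m : ZMod q), m / q)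
  left_inv p := by
    obtain ⟨a, n⟩ := p
    have hq : (0:ℤ) < q := by exact_mod_cast NeZero.pos q
    ext
    · simp
    · simp only
      rw [Int.add_mul_ediv_left _ _ hq.ne', Int.ediv_eq_zero_of_lt (by positivity) (by exact_mod_cast a.val_lt),
        zero_add]
  right_inv m := by
    simp only [ZMod.val_intCast]
    exact Int.emod_add_mul_ediv m q

lemma sum_res {q : ℕ} [NeZero q] {g : ℤ → ℝ} (hg : Summable g) :
    ∑ a : ZMod q, ∑' n : ℤ, g (a.val + q * n) = ∑' m, g m := by
  rw [← (resEquiv q).tsum_eq g]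
  have : Summable (fun p : ZMod q × ℤ => g (resEquiv q p)) := (resEquiv q).summable_iff.mpr hg
  rw [this.tsum_prod, tsum_fintype]
  rfl

lemma f_congr {q : ℕ} [NeZero q] (ε : ℝ) {m n : ℤ} (h : (m : ZMod q) = n) :
    f ε ((m:ℝ) / q) = f ε ((n:ℝ) / q) := by
  rw [ZMod.intCast_eq_intCast_iff_dvd_sub] at h
  obtain ⟨c, hc⟩ := h
  have hq : (q:ℝ) ≠ 0 := by exact_mod_cast (NeZero.ne q)
  have : (n:ℝ) / q = (m:ℝ)/q + c := by
    have h2 : (n:ℝ) - m = q * c := by exact_mod_cast hc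
    field_simp; linarith
  rw [this, f_add_int]

noncomputable def SS (ε : ℝ) (h k : ℤ) (q : ℕ) [NeZero q] : ℝ :=
  ∑ a : ZMod q, f ε (a.val * h / q) * f ε (a.val * k / q)

noncomputable def FF (ε : ℝ) (q : ℕ) (a : ZMod q) : ℝ := f ε (a.val / q)

lemma FF_int {q : ℕ} [NeZero q] (ε : ℝ) (m : ℤ) : FF ε q (m : ZMod q) = f ε (m / q) := by
  unfold FF
  have := f_congr ε (q := q) (m := ((m : ZMod q).val : ℤ)) (n := m) (by simp)
  rw [← this]; simp

lemma FF_mul {q : ℕ} [NeZero q] (ε : ℝ) (a : ZMod q) (h : ℤ) : FF ε q (a * h) = f ε (a.val * h / q) := by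
  have : a * h = ((a.val * h : ℤ) : ZMod q) := by push_cast; simp
  rw [this, FF_int]; push_cast; rfl

lemma SS_eq (ε : ℝ) (h k : ℤ) (q : ℕ) [NeZero q] :
    SS ε h k q = ∑ a : ZMod q, FF ε q (a * h) * FF ε q (a * k) := by
  unfold SS; simp only [FF_mul]

lemma FF_neg {q : ℕ} [NeZero q] {ε : ℝ} (he : ε = 1 ∨ ε = -1) (a : ZMod q) : FF ε q (-a) = ε * FF ε q a := by
  have h1 : -a = ((-(a.val:ℤ) : ℤ) : ZMod q) := by push_cast; simp
  rw [h1, FF_int]; push_cast; rw [neg_div, f_neg he]; rfl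

lemma sum_FF {q : ℕ} [NeZero q] {ε : ℝ} (he : ε = 1 ∨ ε = -1) : ∑ a : ZMod q, FF ε q a = √q * f ε 0 := by
  have hq : (0:ℝ) < q := by exact_mod_cast NeZero.pos q
  have h1 := (hasSum_tau_scaled he (NeZero.pos q) (l := (q:ℝ)⁻¹) (by positivity) 0)
  rw [inv_mul_cancel₀ hq.ne'] at h1
  rw [zero_div, Real.sqrt_inv, div_inv_eq_mul] at h1
  rw [mul_comm, ← h1.tsum_eq, ← sum_res (q := q) h1.summable]
  refine Finset.sum_congr rfl fun a _ => ?_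
  unfold FF f
  refine tsum_congr fun n => ?_
  push_cast; congr 1; field_simp; ring

noncomputable def PP (ε : ℝ) (q : ℕ) [NeZero q] (χ : DirichletCharacter ℂ q) : ℂ :=
  ∑ a : ZMod q, χ a * (FF ε q a : ℂ)

lemma PP_zero {q : ℕ} [NeZero q] {ε : ℝ} (he : ε = 1 ∨ ε = -1) (χ : DirichletCharacter ℂ q)
    (h : χ (-1) ≠ ε) : PP ε q χ = 0 := by
  have h1 : χ (-1) = -ε := by
    have h2 : χ (-1) * χ (-1) = 1 := by rw [← map_mul]; simp
    have h3 : (ε:ℂ) * ε = 1 := by exact_mod_cast sq_he he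
    have h4 : (χ (-1) - ε) * (χ (-1) + ε) = 0 := by linear_combination h2 - h3
    rcases mul_eq_zero.mp h4 with h5 | h5
    · exact absurd (sub_eq_zero.mp h5) h
    · exact eq_neg_of_add_eq_zero_left h5
  have h3 : (ε:ℂ) * ε = 1 := by exact_mod_cast sq_he he
  have : PP ε q χ = - PP ε q χ := by
    conv_lhs => unfold PP
    rw [← Equiv.sum_comp (Equiv.neg (ZMod q))]
    unfold PP
    rw [← Finset.sum_neg_distrib]
    refine Finset.sum_congr rfl fun a _ => ?_
    simp only [Equiv.neg_apply]
    rw [FF_neg he, ← neg_one_mul a, map_mul, h1]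
    push_cast
    linear_combination (-(χ a * (FF ε q a : ℂ))) * h3
  have h2 : (2:ℂ) * PP ε q χ = 0 := by linear_combination this
  simpa using h2

lemma norm_L_sq {q : ℕ} [NeZero q] (hq : 1 < q) {ε : ℝ} (he : ε = 1 ∨ ε = -1)
    (χ : DirichletCharacter ℂ q) (hχ : χ ≠ 1) (hpar : χ (-1) = (ε : ℂ)) :
    ((‖χ.LFunction (1/2)‖:ℂ)^2) = 1 / (4 * q) * (PP ε q χ * (starRingEnd ℂ) (PP ε q χ)) := by
  have hq0 : (0:ℝ) < q := by exact_mod_cast (by omega : 0 < q)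
  have e : χ.LFunction (1/2) = (q:ℂ) ^ (-(1/2:ℂ)) * ((1/2) * PP ε q χ) := L_eq hq he χ hχ hpar
  rw [e, Complex.mul_conj, Complex.normSq_eq_norm_sq]
  have e2 : ‖(q:ℂ) ^ (-(1/2:ℂ))‖ ^ 2 = 1 / q := by
    have := Complex.norm_cpow_eq_rpow_re_of_pos hq0 (-(1/2:ℂ))
    push_cast at this
    rw [this, ← Real.rpow_natCast, ← Real.rpow_mul hq0.le]
    norm_num
    rw [Real.rpow_neg_one]
  rw [norm_mul, norm_mul]
  have : ((‖(q:ℂ) ^ (-(1/2:ℂ))‖ * (‖(1/2:ℂ)‖ * ‖PP ε q χ‖)) ^ 2 : ℝ) = 1/(4*q) * (‖PP ε q χ‖^2) := by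
    rw [mul_pow, mul_pow, e2]; norm_num; field_simp
  have h := congrArg (fun x : ℝ => (x:ℂ)) this
  push_cast at h ⊢; exact h

/-- orthogonality -/
lemma sum_all {q : ℕ} [NeZero q] [Fact q.Prime] (ε : ℝ) {h k : ℤ} (hh : (h : ZMod q) ≠ 0)
    (hk : (k : ZMod q) ≠ 0) :
    ∑ χ : DirichletCharacter ℂ q, (PP ε q χ * (starRingEnd ℂ) (PP ε q χ)) * χ (h : ZMod q) *
      (starRingEnd ℂ) (χ (k : ZMod q)) = (q.totient : ℂ) * ((SS ε h k q - (f ε 0)^2 : ℝ) : ℂ) := by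
  have conj_inv : ∀ (χ : DirichletCharacter ℂ q) (d : ZMod q), (starRingEnd ℂ) (χ d) = χ d⁻¹ := by
    intro χ d
    rw [← RCLike.star_def, MulChar.star_apply', MulChar.inv_apply']
  have twist : ∀ (χ : DirichletCharacter ℂ q) (u : ZMod q), u ≠ 0 → PP ε q χ * (starRingEnd ℂ) (χ u)
      = ∑ c : ZMod q, χ c * (FF ε q (c * u) : ℂ) := by
    intro χ u hu
    unfold PP
    rw [← Equiv.sum_comp (Equiv.mulRight₀ u hu), Finset.sum_mul]
    refine Finset.sum_congr rfl fun c _ => ?_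
    simp only [Equiv.mulRight₀_apply, conj_inv]
    rw [map_mul]
    have : χ u * χ u⁻¹ = 1 := by rw [← map_mul, mul_inv_cancel₀ hu, map_one]
    linear_combination (χ c * (FF ε q (c * u) : ℂ)) * this
  have step : ∀ χ : DirichletCharacter ℂ q, (PP ε q χ * (starRingEnd ℂ) (PP ε q χ)) * χ (h : ZMod q) *
      (starRingEnd ℂ) (χ (k : ZMod q)) = ∑ d : ZMod q, ∑ c : ZMod q, (χ d⁻¹ * χ c) *
        ((FF ε q (c * k) : ℂ) * (FF ε q (d * h) : ℂ)) := by
    intro χ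
    have e1 := twist χ k hk
    have e2 := congrArg (starRingEnd ℂ) (twist χ h hh)
    rw [map_mul, Complex.conj_conj, map_sum] at e2
    rw [show (PP ε q χ * (starRingEnd ℂ) (PP ε q χ)) * χ (h : ZMod q) * (starRingEnd ℂ) (χ (k : ZMod q))
      = ((starRingEnd ℂ) (PP ε q χ) * χ (h : ZMod q)) * (PP ε q χ * (starRingEnd ℂ) (χ (k : ZMod q))) by ring,
      e1, e2, Finset.sum_mul_sum]
    refine Finset.sum_congr rfl fun d _ => Finset.sum_congr rfl fun c _ => ?_
    rw [map_mul, Complex.conj_ofReal, conj_inv]; ring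
  simp only [step]
  rw [Finset.sum_comm]
  have orth : ∀ d : ZMod q, ∑ χ : DirichletCharacter ℂ q, ∑ c : ZMod q, (χ d⁻¹ * χ c) *
        ((FF ε q (c * k) : ℂ) * (FF ε q (d * h) : ℂ)) = if d = 0 then 0 else
        (q.totient : ℂ) * ((FF ε q (d * k) : ℂ) * (FF ε q (d * h) : ℂ)) := by
    intro d
    rw [Finset.sum_comm]
    split_ifs with hd
    · subst hd
      refine Finset.sum_eq_zero fun c _ => Finset.sum_eq_zero fun χ _ => ?_
      rw [inv_zero, MulChar.map_zero]; ring
    · have := fun c => DirichletCharacter.sum_char_inv_mul_char_eq ℂ (IsUnit.mk0 d hd) c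
      simp only [← Finset.sum_mul, this, ite_mul, zero_mul, Finset.sum_ite_eq, Finset.mem_univ, if_true]
  simp only [orth]
  rw [SS_eq, ← Finset.add_sum_erase _ _ (Finset.mem_univ (0 : ZMod q)),
    ← Finset.add_sum_erase _ (fun a => FF ε q (a * (h : ZMod q)) * _) (Finset.mem_univ (0 : ZMod q))]
  have f0 : FF ε q 0 = f ε 0 := by simp [FF]
  simp only [if_true, zero_mul, f0]
  rw [show f ε 0 * f ε 0 + ∑ a ∈ Finset.univ.erase (0 : ZMod q), FF ε q (a * h) * FF ε q (a * k) -
    (f ε 0)^2 = ∑ a ∈ Finset.univ.erase (0 : ZMod q), FF ε q (a * h) * FF ε q (a * k) by ring]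
  push_cast
  rw [Finset.mul_sum, zero_add]
  refine Finset.sum_congr rfl fun a ha => ?_
  rw [if_neg (Finset.ne_of_mem_erase ha)]; ring

/-- bound for `f(0)` -/
noncomputable def K0 : ℝ := |f 1 0| + |f (-1) 0|

lemma f0_le {ε : ℝ} (he : ε = 1 ∨ ε = -1) : |f ε 0| ≤ K0 := by
  unfold K0
  rcases he with rfl | rfl
  · linarith [abs_nonneg (f (-1) 0)]
  · linarith [abs_nonneg (f 1 0)]

lemma Mpm_approx {q : ℕ} [NeZero q] (hq : q.Prime) (ε : ℤ) (he : ε = 1 ∨ ε = -1) {h k : ℤ}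
    (hh : (h : ZMod q) ≠ 0) (hk : (k : ZMod q) ≠ 0) :
    ‖Mpm ε h k q - ((1 / (4 * √q) * SS ε h k q : ℝ) : ℂ)‖ ≤ 3 * K0 ^ 2 := by
  have : Fact q.Prime := ⟨hq⟩
  have heR : (ε:ℝ) = 1 ∨ (ε:ℝ) = -1 := by rcases he with h | h <;> simp [h]
  have hq1 := hq.one_lt
  have hq0 : (0:ℝ) < q := by exact_mod_cast hq.pos
  have htot : (q.totient : ℝ) = q - 1 := by
    rw [Nat.totient_prime hq, Nat.cast_sub hq.one_le, Nat.cast_one]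
  have hq2 : (2:ℝ) ≤ q := by exact_mod_cast hq.two_le
  have hp : (0:ℝ) < q.totient := by rw [htot]; linarith
  have hpC : (q.totient:ℂ) ≠ 0 := by exact_mod_cast hp.ne'
  set f0 := f ε 0 with hf0
  have P1 : PP ε q 1 = ((√q * f0 - f0 : ℝ) : ℂ) := by
    rw [← sum_FF heR]
    unfold PP
    rw [← Finset.add_sum_erase _ _ (Finset.mem_univ (0 : ZMod q)),
      ← Finset.add_sum_erase _ (FF ε q) (Finset.mem_univ (0 : ZMod q))]
    have e0 : FF ε q 0 = f0 := by simp [FF, hf0]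
    rw [e0, add_sub_cancel_left, MulChar.map_zero, zero_mul, zero_add]
    push_cast
    refine Finset.sum_congr rfl fun a ha => ?_
    rw [MulChar.one_apply (IsUnit.mk0 a (Finset.ne_of_mem_erase ha)), one_mul]
  have key : Mpm ε h k q = (√q / (q.totient : ℝ)) * (1 / (4 * q) * ((q.totient : ℂ) *
      ((SS ε h k q - f0^2 : ℝ) : ℂ) - ((√q * f0 - f0 : ℝ) : ℂ)^2)) := by
    unfold Mpm
    congr 1
    rw [← sum_all (ε:ℝ) hh hk, ← Finset.add_sum_erase _ _ (Finset.mem_univ (1 : DirichletCharacter ℂ q)),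
      ← Finset.add_sum_erase _ (fun χ : DirichletCharacter ℂ q => (PP ε q χ * _) * _ * _)
        (Finset.mem_univ (1 : DirichletCharacter ℂ q)), if_neg (by simp), zero_add]
    rw [P1, Complex.conj_ofReal, MulChar.one_apply (IsUnit.mk0 _ hh),
      MulChar.one_apply (IsUnit.mk0 _ hk), map_one, mul_one, mul_one, ← pow_two, add_sub_cancel_left,
      Finset.mul_sum]
    refine Finset.sum_congr rfl fun χ hχ => ?_
    have hχ1 := Finset.ne_of_mem_erase hχ
    by_cases hpar : χ (-1) = (ε : ℂ)
    · rw [if_pos ⟨hχ1, hpar⟩, norm_L_sq hq1 heR χ hχ1 (by rw [hpar]; simp)]; ring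
    · rw [if_neg (fun h => hpar h.2), PP_zero heR χ (by simpa using hpar)]; ring
  have e2 : Mpm ε h k q - ((1 / (4 * √q) * SS ε h k q : ℝ) : ℂ) =
      ((-(f0^2 / (4 * √q)) - (√q - 1)^2 / (4 * √q * q.totient) * f0^2 : ℝ) : ℂ) := by
    rw [key]
    have hs : (√q:ℝ) ^ 2 = q := Real.sq_sqrt hq0.le
    have hsp : (√q:ℝ) ≠ 0 := (Real.sqrt_pos.mpr hq0).ne'
    have : √q / (q.totient : ℝ) * (1 / (4 * q) * ((q.totient : ℝ) *
      ((SS ε h k q - f0^2)) - (√q * f0 - f0)^2)) - 1 / (4 * √q) * SS ε h k q =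
      (-(f0^2 / (4 * √q)) - (√q - 1)^2 / (4 * √q * q.totient) * f0^2) := by
      rw [← hs]; rw [Real.sqrt_sq (Real.sqrt_nonneg _)]
      have hp' := hp.ne'
      field_simp
      ring
    have h := congrArg (fun x : ℝ => (x:ℂ)) this
    push_cast at h ⊢; exact h
  rw [e2, Complex.norm_real, Real.norm_eq_abs]
  have hsq : 1 ≤ √(q:ℝ) := by rw [Real.one_le_sqrt]; linarith
  have hs : (√q:ℝ) ^ 2 = q := Real.sq_sqrt hq0.le
  have b1 : f0^2 ≤ K0^2 := by
    rw [← sq_abs]; exact pow_le_pow_left₀ (abs_nonneg _) (f0_le heR) 2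
  have b2 : (√(q:ℝ) - 1)^2 / (4 * √q * q.totient) ≤ 1 := by
    rw [div_le_one (by positivity), htot]
    nlinarith
  have b3 : f0^2 / (4 * √q) ≤ f0^2 := div_le_self (by positivity) (by linarith)
  have b4 : (√(q:ℝ) - 1)^2 / (4 * √q * q.totient) * f0^2 ≤ f0^2 :=
    mul_le_of_le_one_left (by positivity) b2
  have c1 : 0 ≤ f0^2 / (4 * √q) := by positivity
  have c2 : 0 ≤ (√(q:ℝ) - 1)^2 / (4 * √q * q.totient) * f0^2 := by positivity
  have c3 : 0 ≤ K0^2 := by positivity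
  rw [abs_le]; constructor <;> linarith

end TTR

namespace TTR

/-! ### Regrouping -/

lemma summable_prod_fin {ι β : Type*} [Fintype ι] {G : ι × β → ℝ} (h : ∀ a, Summable (fun b => G (a, b))) :
    Summable G := by
  refine Summable.of_abs ?_
  rw [summable_prod_of_nonneg (fun _ => abs_nonneg _)]
  exact ⟨fun a => (h a).abs, (hasSum_fintype _).summable⟩

lemma summable_res {q : ℕ} [NeZero q] {g : ℤ → ℝ}
    (h : ∀ a : ZMod q, Summable (fun n : ℤ => g (a.val + q * n))) : Summable g := by
  rw [← (resEquiv q).summable_iff]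
  exact summable_prod_fin h

lemma hasSum_mul_real {f g : ℤ → ℝ} {a b : ℝ} (h1 : HasSum f a) (h2 : HasSum g b) :
    HasSum (fun p : ℤ × ℤ => f p.1 * g p.2) (a * b) := by
  have hs : Summable (fun p : ℤ × ℤ => f p.1 * g p.2) :=
    summable_mul_of_summable_norm (h1.summable.norm) (h2.summable.norm)
  exact HasSum.mul h1 h2 hs

noncomputable def bigEquiv (h k : ℤ) (q : ℕ) [NeZero q] (i0 j0 : ℤ) (hd : i0 * k - j0 * h = 1) :
    ZMod q × (ℤ × ℤ) ≃ ℤ × ℤ where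
  toFun p := (p.2.1 * k - p.2.2 * h, resEquiv q (p.1, -j0 * p.2.1 + i0 * p.2.2))
  invFun p := (((resEquiv q).symm p.2).1, (p.1 * i0 + h * ((resEquiv q).symm p.2).2,
      p.1 * j0 + k * ((resEquiv q).symm p.2).2))
  left_inv p := by
    obtain ⟨a, i, j⟩ := p
    simp only [Equiv.symm_apply_apply, Prod.mk.injEq, true_and]
    constructor
    · linear_combination i * hd
    · linear_combination j * hd
  right_inv p := by
    obtain ⟨w, m⟩ := p
    simp only [Prod.mk.injEq]
    constructor
    · linear_combination w * hd
    · conv_rhs => rw [← (resEquiv q).apply_symm_apply m]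
      congr 1
      ext
      · rfl
      · simp only
        linear_combination ((resEquiv q).symm m).2 * hd

noncomputable def Tw (ε : ℝ) (h k : ℤ) (q : ℕ) (i0 j0 : ℤ) (p : ℤ × ℤ) : ℝ :=
  tau ε q (p.2 + q * p.1 * i0 / h) * tau ε q (p.2 + q * p.1 * j0 / k)

lemma regroup {ε : ℝ} (he : ε = 1 ∨ ε = -1) {h k q : ℕ} [NeZero q] (hh : 0 < h) (hk : 0 < k)
    {i0 j0 : ℤ} (hd : i0 * k - j0 * h = 1) :
    HasSum (Tw ε h k q i0 j0) (√(h * k) / q * SS ε h k q) := by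
  have hq0 : (0:ℝ) < q := by exact_mod_cast NeZero.pos q
  have hh0 : (0:ℝ) < h := by exact_mod_cast hh
  have hk0 : (0:ℝ) < k := by exact_mod_cast hk
  have H : ∀ (m : ℕ) (hm : 0 < m) (a : ℝ), HasSum (fun i : ℤ => tau ε q (a + q / m * i)) (f ε (a * m / q) / √(q/m)) := by
    intro m hm a
    have hm0 : (0:ℝ) < m := by exact_mod_cast hm
    have := hasSum_tau_scaled he hm (l := (q:ℝ)/m) (by positivity) a
    rwa [div_mul_cancel₀ _ hm0.ne', div_div_eq_mul_div] at this
  have e : ∀ p, Tw ε h k q i0 j0 (bigEquiv h k q i0 j0 hd p) =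
      tau ε q (p.1.val + q / h * p.2.1) * tau ε q (p.1.val + q / k * p.2.2) := by
    rintro ⟨a, i, j⟩
    unfold Tw bigEquiv resEquiv
    simp only [Equiv.coe_fn_mk]
    push_cast
    have hdR : (i0:ℝ) * k - j0 * h = 1 := by exact_mod_cast hd
    congr 2
    · field_simp
      linear_combination (q * i : ℝ) * hdR
    · field_simp
      linear_combination (q * j : ℝ) * hdR
  have P : ∀ a : ZMod q, HasSum (fun p : ℤ × ℤ => tau ε q (a.val + q / h * p.1) * tau ε q (a.val + q / k * p.2))
      ((f ε (a.val * h / q) / √(q/h)) * (f ε (a.val * k / q) / √(q/k))) := by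
    intro a
    have h1 := H h hh a.val
    have h2 := H k hk a.val
    have h3 := hasSum_mul_real h1 h2
    exact h3
  rw [← (bigEquiv h k q i0 j0 hd).hasSum_iff]
  have S : Summable (fun p : ZMod q × (ℤ × ℤ) => 
      tau ε q (p.1.val + q / h * p.2.1) * tau ε q (p.1.val + q / k * p.2.2)) :=
    summable_prod_fin fun a => (P a).summable
  have e3 : (Tw ε h k q i0 j0) ∘ (bigEquiv h k q i0 j0 hd) = (fun p : ZMod q × (ℤ × ℤ) => 
      tau ε q (p.1.val + q / h * p.2.1) * tau ε q (p.1.val + q / k * p.2.2)) := funext e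
  rw [e3]
  have := S.hasSum
  rw [S.tsum_prod, tsum_fintype] at this
  simp only [fun a => (P a).tsum_eq] at this
  convert this using 1
  unfold SS
  rw [Finset.mul_sum]
  refine Finset.sum_congr rfl fun a _ => ?_
  have : √(q/h) * √((q:ℝ)/k) = q / √(h * k) := by
    rw [← Real.sqrt_mul (by positivity), div_mul_div_comm, Real.sqrt_div (by positivity), Real.sqrt_mul_self hq0.le]
  rw [div_mul_div_comm, this]
  push_cast
  field_simp

lemma dual_sum {ε : ℝ} (he : ε = 1 ∨ ε = -1) {h k q : ℕ} [NeZero h] [NeZero q] (hk : 0 < k)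
    {i0 : ℤ} (hd : (i0 : ZMod h) * k = 1) :
    HasSum (fun w : ℤ => tau ε q (q / (h * k) * w) * f ε (q * w * i0 / h)) (√(k / q) * SS ε k q h) := by
  have hq0 : (0:ℝ) < q := by exact_mod_cast NeZero.pos q
  have hh0 : (0:ℝ) < h := by exact_mod_cast NeZero.pos h
  have hk0 : (0:ℝ) < k := by exact_mod_cast hk
  have H : ∀ b : ZMod h, HasSum (fun n : ℤ => tau ε q (q / (h * k) * ((b.val + h * n : ℤ) : ℝ)) *
      f ε (q * ((b.val + h * n : ℤ) : ℝ) * i0 / h)) (√(k / q) * (FF ε h b * FF ε h (b * (q * i0 : ℤ)))) := by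
    intro b
    have h1 := hasSum_tau_scaled he hk (l := (q:ℝ)/k) (by positivity) (q / (h * k) * b.val)
    rw [div_mul_cancel₀ _ hk0.ne'] at h1
    have h2 := h1.mul_right (FF ε h (b * (q * i0 : ℤ)))
    have e : f ε (q / (h * k) * b.val / (q / k)) / √(q / k) * FF ε h (b * (q * i0 : ℤ)) =
       √(k / q) * (FF ε h b * FF ε h (b * (q * i0 : ℤ))) := by
      have e1 : (q:ℝ) / (h * k) * b.val / (q / k) = b.val / h := by field_simp
      rw [e1, show FF ε h b = f ε (b.val / h) from rfl, show (k:ℝ)/q = ((q:ℝ)/k)⁻¹ by rw [inv_div], Real.sqrt_inv]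
      ring
    rw [e] at h2
    refine h2.congr_fun fun n => ?_
    congr 1
    · push_cast; congr 1; field_simp
    · rw [FF_mul]
      push_cast
      have e4 : (q:ℝ) * (b.val + h * n) * i0 / h = b.val * (q * i0) / h + ((q * n * i0 : ℤ) : ℝ) := by
        push_cast; field_simp
      rw [e4, f_add_int]
  have S : Summable (fun w : ℤ => tau ε q (q / (h * k) * w) * f ε (q * w * i0 / h)) :=
    summable_res (q := h) fun b => (H b).summable
  have := S.hasSum
  rw [← sum_res (q := h) S] at this
  simp only [fun b => (H b).tsum_eq] at this
  rw [← Finset.mul_sum] at this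
  have e : ∑ b : ZMod h, FF ε h b * FF ε h (b * (q * i0 : ℤ)) = SS ε k q h := by
    rw [SS_eq]
    let eq : ZMod h ≃ ZMod h := ⟨fun c => c * k, fun c => c * i0,
      fun c => by simp only; rw [mul_assoc, mul_comm (k : ZMod h), hd, mul_one],
      fun c => by simp only; rw [mul_assoc, hd, mul_one]⟩
    rw [← Equiv.sum_comp eq]
    refine Finset.sum_congr rfl fun c _ => ?_
    simp only [eq, Equiv.coe_fn_mk]
    congr 2
    · simp
    · push_cast; linear_combination (c * q) * hd
  rwa [e] at this

lemma dual_sum' {ε : ℝ} (he : ε = 1 ∨ ε = -1) {h k q : ℕ} [NeZero k] [NeZero q] (hh : 0 < h)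
    {j0 : ℤ} (hd : -(j0 : ZMod k) * h = 1) :
    HasSum (fun w : ℤ => tau ε q (q / (h * k) * w) * f ε (q * w * j0 / k)) (ε * (√(h / q) * SS ε h q k)) := by
  have := (dual_sum he (h := k) (k := h) (q := q) hh (i0 := -j0) (by push_cast; exact hd)).mul_left ε
  refine this.congr_fun fun w => ?_
  have e : (q:ℝ) * w * (-j0 : ℤ) / k = -(q * w * j0 / k) := by push_cast; ring
  rw [e, f_neg he, mul_comm (k:ℝ) h]
  linear_combination (-(tau ε q (q / (h * k) * w) * f ε (q * w * j0 / k))) * sq_he he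

end TTR

namespace TTR

open MeasureTheory

/-! ### Integrability and sum-integral comparison -/

lemma integrable_abs {g : ℝ → ℝ} (h : IntegrableOn g (Set.Ioi 0)) : Integrable (fun x => g |x|) := by
  have h1 : IntegrableOn (fun x => g |x|) (Set.Ioi 0) :=
    h.congr_fun (fun x hx => by rw [abs_of_pos hx]) measurableSet_Ioi
  have h2 : IntegrableOn (fun x => g |x|) (Set.Iic 0) := by
    have := (integrableOn_Ici_iff_integrableOn_Ioi (f := fun x => g |x|) (μ := volume) (b := (0:ℝ))).mpr h1
    have h3 := this.comp_neg
    simp only [abs_neg] at h3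
    simpa using h3
  rw [← integrableOn_univ, ← Set.Iic_union_Ioi (a := (0:ℝ))]
  exact h2.union h1

noncomputable def ph1 (t : ℝ) : ℝ := if |t| ≤ 1 then 1 / √|t| else 0

noncomputable def php (p : ℝ → ℝ) (t : ℝ) : ℝ := if 1/2 ≤ |t| then p |t| else 0

noncomputable def p3 (t : ℝ) : ℝ := 1 / (t * √t)
noncomputable def p4 (t : ℝ) : ℝ := 1 / (t * t)

lemma inv_sqrt_rpow {x : ℝ} (hx : 0 < x) : 1 / √x = x ^ (-(1/2:ℝ)) := by
  rw [Real.rpow_neg hx.le, Real.sqrt_eq_rpow, one_div]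

lemma p3_rpow {x : ℝ} (hx : 0 < x) : p3 x = x ^ (-(3/2:ℝ)) := by
  rw [Real.rpow_neg hx.le, rpow_three_half hx.le, p3, one_div]

lemma p4_rpow {x : ℝ} (hx : 0 < x) : p4 x = x ^ (-(2:ℝ)) := by
  rw [Real.rpow_neg hx.le, Real.rpow_two, p4, one_div, sq]

lemma integrable_ph1 : Integrable ph1 := by
  have : ph1 = fun x => (fun t => if t ≤ 1 then 1 / √t else 0) |x| := rfl
  rw [this]
  apply integrable_abs (g := fun t => if t ≤ 1 then 1 / √t else 0)
  have h : IntegrableOn (fun x : ℝ => x ^ (-(1/2:ℝ))) (Set.Ioc 0 1) := by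
    have := intervalIntegral.intervalIntegrable_rpow' (a := 0) (b := 1) (r := -(1/2:ℝ)) (by norm_num)
    rwa [intervalIntegrable_iff_integrableOn_Ioc_of_le zero_le_one] at this
  rw [← Set.Ioc_union_Ioi_eq_Ioi (zero_le_one (α := ℝ))]
  refine IntegrableOn.union (h.congr_fun (fun x hx => ?_) measurableSet_Ioc)
    ((integrableOn_zero (α := ℝ) (ε' := ℝ)).congr_fun (fun x hx => ?_) measurableSet_Ioi)
  · simp only; rw [if_pos hx.2, inv_sqrt_rpow hx.1]
  · simp only; rw [if_neg (not_le.mpr hx)]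

lemma integrable_php {p : ℝ → ℝ} {s : ℝ} (hs : 1 < s) (hp : ∀ x, 0 < x → p x = x ^ (-s)) :
    Integrable (php p) := by
  have : php p = fun x => (fun t => if 1/2 ≤ t then p t else 0) |x| := rfl
  rw [this]
  apply integrable_abs (g := fun t => if 1/2 ≤ t then p t else 0)
  have h : IntegrableOn (fun x : ℝ => x ^ (-s)) (Set.Ioi (1/4)) :=
    integrableOn_Ioi_rpow_of_lt (by linarith) (by norm_num)
  rw [← Set.Ioc_union_Ioi_eq_Ioi (show (0:ℝ) ≤ 1/4 by norm_num)]
  refine IntegrableOn.union 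
    ((integrableOn_zero (α := ℝ) (ε' := ℝ)).congr_fun (fun x hx => ?_) measurableSet_Ioc) ?_
  · simp only; rw [if_neg (by have := hx.2; linarith)]
  · have h2 : IntegrableOn (Set.indicator (Set.Ici (1/2)) fun x : ℝ => x ^ (-s)) (Set.Ioi (1/4)) :=
      h.indicator measurableSet_Ici
    refine h2.congr_fun (fun x hx => ?_) measurableSet_Ioi
    simp only [Set.indicator, Set.mem_Ici]
    have hx0 : 0 < x := lt_trans (by norm_num) hx
    rw [hp x hx0]

lemma sum_int {R R' g : ℝ → ℝ} {S : Set ℝ} (hS : S.Countable) (hc : Continuous R)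
    (hd : ∀ x, x ∉ S → HasDerivAt R (R' x) x) (hg : Integrable g) (hb : ∀ x, x ∉ S → |R' x| ≤ g x)
    (hm : Measurable R') (hR : Integrable R) {p A : ℝ} (hs : HasSum (fun n : ℤ => R (n + p)) A) :
    |A - ∫ x, R x| ≤ ∫ x, g x := by
  have hae : ∀ᵐ x, |R' x| ≤ g x := by
    have : ∀ᵐ x : ℝ, x ∉ S := hS.ae_notMem volume
    filter_upwards [this] with x hx using hb x hx
  have hg0 : ∀ᵐ x, 0 ≤ g x := by filter_upwards [hae] with x hx using le_trans (abs_nonneg _) hx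
  have hI : Integrable R' := hg.mono' hm.aestronglyMeasurable hae
  have h1 := hR.hasSum_intervalIntegral p
  have h2 := hg.hasSum_intervalIntegral p
  have h3 := hs.sub h1
  rw [← h3.tsum_eq]
  refine tsum_of_norm_bounded (E := ℝ) h2 fun n => ?_
  set a : ℝ := p + n
  have ea : (n:ℝ) + p = a := add_comm _ _
  rw [ea]
  have e1 : R a - ∫ x in a..a+1, R x = ∫ x in a..a+1, (R a - R x) := by
    rw [intervalIntegral.integral_sub (by simp) (hR.intervalIntegrable)]
    simp
  rw [e1]
  have := intervalIntegral.norm_integral_le_of_norm_le_const (a := a) (b := a+1) (f := fun x => R a - R x)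
    (C := ∫ x in a..a+1, g x) (fun x hx => ?_)
  · simpa using this
  · rw [Set.uIoc_of_le (by linarith)] at hx
    have e2 : ∫ t in a..x, R' t = R x - R a :=
      MeasureTheory.integral_eq_of_hasDerivAt_off_countable R R' hS hc.continuousOn
        (fun t ht => hd t ht.2) hI.intervalIntegrable
    rw [norm_sub_rev, ← e2]
    have i1 : ‖∫ t in a..x, R' t‖ ≤ ∫ t in a..x, g t :=
      intervalIntegral.norm_integral_le_of_norm_le hx.1.le 
        (by filter_upwards [hae] with t ht _ using ht) hg.intervalIntegrable
    refine i1.trans ?_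
    have := intervalIntegral.integral_interval_sub_left (μ := volume) (f := g) (a := a) (b := a+1) (c := x)
      hg.intervalIntegrable hg.intervalIntegrable
    have h0 : 0 ≤ ∫ t in x..a+1, g t := intervalIntegral.integral_nonneg_of_ae hx.2 hg0
    linarith

/-! ### integrability of `tau` -/

lemma integrable_tau {ε : ℝ} (he : ε = 1 ∨ ε = -1) {V : ℝ} (hV : 0 < V) : Integrable (tau ε V) := by
  have hg : Integrable (fun x => 50 * ph1 x + 100 * V * php p3 x) :=
    (integrable_ph1.const_mul 50).add ((integrable_php (s := 3/2) (by norm_num) (fun x hx => p3_rpow hx)).const_mul _)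
  refine hg.mono' (measurable_tau he V).aestronglyMeasurable ?_
  have : ∀ᵐ x : ℝ, x ∉ ({0} : Set ℝ) := (Set.countable_singleton (0:ℝ)).ae_notMem volume
  filter_upwards [this] with x hx
  have hx0 : x ≠ 0 := hx
  have h1 := tau_bd1 he hV hx0
  have h2 := tau_bd3 he hV hx0
  have hp := abs_pos.mpr hx0
  rw [Real.norm_eq_abs]
  unfold ph1 php p3
  by_cases h : |x| ≤ 1
  · rw [if_pos h]
    have : 0 ≤ 100 * V * (if 1/2 ≤ |x| then 1/(|x| * √|x|) else 0) := by
      split_ifs <;> positivity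
    have e : 50 * (1 / √|x|) = 50 / √|x| := by ring
    linarith
  · rw [if_neg h, if_pos (by linarith)]
    have e : 100 * V * (1 / (|x| * √|x|)) = 100 * V / (|x| * √|x|) := by ring
    linarith

lemma tau_far {ε : ℝ} (he : ε = 1 ∨ ε = -1) {V : ℝ} (hV : 0 < V) {D x : ℝ} (hD : D ≠ 0) (hx : |D|/2 ≤ |x|) :
    |tau ε V x| ≤ 100 * V * (4 * p3 |D|) := by
  have hD0 := abs_pos.mpr hD
  have hx0 : 0 < |x| := by linarith
  refine (tau_bd3 he hV (abs_pos.mp hx0)).trans ?_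
  rw [div_eq_mul_one_div]
  refine mul_le_mul_of_nonneg_left ?_ (by positivity)
  unfold p3
  rw [mul_one_div, div_le_div_iff₀ (by positivity) (by positivity)]
  have h2 : √|D| ≤ 2 * √|x| := by
    rw [Real.sqrt_le_left (by positivity), mul_pow, Real.sq_sqrt hx0.le]; linarith
  nlinarith [mul_le_mul (show |D| ≤ 2 * |x| by linarith) h2 (by positivity) (by positivity)]

lemma tau_prod_bd {ε : ℝ} (he : ε = 1 ∨ ε = -1) {V : ℝ} (hV : 0 < V) {D : ℝ} (hD : D ≠ 0) (x : ℝ) :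
    |tau ε V x * tau ε V (x - D)| ≤ 100 * V * (4 * p3 |D|) * (|tau ε V x| + |tau ε V (x - D)|) := by
  have hc : 0 ≤ 100 * V * (4 * p3 |D|) := by unfold p3; positivity
  rw [abs_mul]
  by_cases h : |D|/2 ≤ |x|
  · have := tau_far he hV hD h
    nlinarith [mul_le_mul_of_nonneg_right this (abs_nonneg (tau ε V (x - D))), 
      mul_nonneg hc (abs_nonneg (tau ε V x))]
  · have h2 : |D|/2 ≤ |x - D| := by
      have := abs_sub_abs_le_abs_sub D x
      rw [abs_sub_comm] at this
      linarith
    have := tau_far he hV hD h2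
    nlinarith [mul_le_mul_of_nonneg_left this (abs_nonneg (tau ε V x)), 
      mul_nonneg hc (abs_nonneg (tau ε V (x - D)))]

lemma integrable_tau_prod {ε : ℝ} (he : ε = 1 ∨ ε = -1) {V : ℝ} (hV : 0 < V) {D : ℝ} (hD : D ≠ 0) :
    Integrable (fun x => tau ε V x * tau ε V (x - D)) := by
  have h := integrable_tau he hV
  have h2 := h.comp_sub_right D
  refine ((h.abs.add h2.abs).const_mul (100 * V * (4 * p3 |D|))).mono' ?_ (Filter.Eventually.of_forall fun x => ?_)
  · exact ((measurable_tau he V).mul ((measurable_tau he V).comp (measurable_id.sub_const D))).aestronglyMeasurable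
  · exact tau_prod_bd he hV hD x

/-- folding -/
lemma fold {g F : ℝ → ℝ} (hg : Integrable g) {l : ℝ} (hl : 0 < l) (y : ℝ)
    (hF : ∀ x ∈ Set.Ioc y (y + l), HasSum (fun n : ℤ => g (x + l * n)) (F x)) :
    ∫ x, g x = ∫ x in Set.Ioc y (y + l), F x := by
  have key : ∀ {u : ℝ → ℝ}, Integrable u → HasSum (fun n : ℤ => ∫ x in Set.Ioc y (y + l), u (x + l * n)) (∫ x, u x) := by
    intro u hu
    have h1 : Integrable (fun t => u (l * t)) := hu.comp_mul_left' hl.ne'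
    have h2 := (h1.hasSum_intervalIntegral (y / l)).mul_left l
    have e : l * ∫ t, u (l * t) = ∫ x, u x := by
      rw [Measure.integral_comp_mul_left, smul_eq_mul, abs_of_pos (by positivity), mul_inv_cancel_left₀ hl.ne']
    rw [e] at h2
    refine h2.congr_fun fun n => ?_
    rw [← intervalIntegral.integral_of_le (by linarith), intervalIntegral.integral_comp_mul_left _ hl.ne',
      smul_eq_mul, mul_inv_cancel_left₀ hl.ne', intervalIntegral.integral_comp_add_right]
    congr 1
    · field_simp
    · field_simp; ring
  have hInt0 : ∀ n : ℤ, Integrable (fun x => g (x + l * n)) (volume.restrict (Set.Ioc y (y + l))) := fun n =>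
    (hg.comp_add_right (l * n)).integrableOn
  have h3 := hasSum_integral_of_summable_integral_norm (μ := volume.restrict (Set.Ioc y (y + l)))
    (F := fun (n : ℤ) x => g (x + l * n)) hInt0 (key hg.norm).summable
  rw [(key hg).unique h3]
  refine setIntegral_congr_fun measurableSet_Ioc fun x hx => ?_
  exact (hF x hx).tsum_eq

lemma integral_tau {ε : ℝ} (he : ε = 1 ∨ ε = -1) {V : ℝ} (hV : 0 < V) : ∫ x, tau ε V x = 0 := by
  have h : ∀ m : ℕ, 0 < m → ∫ x, tau ε m x = ∫ x in Set.Ioc (0:ℝ) (0 + 1), f ε x := by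
    intro m hm
    refine fold (integrable_tau he (by exact_mod_cast hm)) one_pos 0 fun x _ => ?_
    simpa using hasSum_tau he hm x
  have sc : ∀ W : ℝ, 0 < W → ∫ x, tau ε W x = √W * ∫ x, tau ε 1 x := by
    intro W hW
    simp_rw [tau_eq_one ε hW]
    rw [integral_div, Measure.integral_comp_div (fun x => tau ε 1 x), smul_eq_mul, abs_of_pos hW]
    have := Real.mul_self_sqrt hW.le
    have h0 : 0 < √W := Real.sqrt_pos.mpr hW
    rw [div_eq_iff h0.ne']
    linear_combination (-(∫ x, tau ε 1 x)) * this
  have h1 := h 1 one_pos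
  have h2 := h 2 two_pos
  push_cast at h1 h2
  rw [sc 2 two_pos] at h2
  rw [← h1] at h2
  have h3 : (√2 - 1) * ∫ x, tau ε 1 x = 0 := by linear_combination h2
  have h4 : √2 - 1 ≠ 0 := by
    have : (1:ℝ) < √2 := by rw [Real.lt_sqrt] <;> norm_num
    intro h; linarith
  rw [sc V hV, (mul_eq_zero.mp h3).resolve_left h4, mul_zero]

end TTR

namespace TTR

open MeasureTheory

/-! ### The E-lemma -/

/-- properties of the power functions we use -/
structure IsPow (p : ℝ → ℝ) : Prop where
  mul : ∀ x y, 0 < x → 0 < y → p (x * y) = p x * p y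
  anti : ∀ x y, 0 < x → x ≤ y → p y ≤ p x
  pos : ∀ x, 0 < x → 0 < p x
  half : p (1/2) ≤ 4
  int : Integrable (php p)

lemma isPow_of_rpow {p : ℝ → ℝ} {s : ℝ} (hs : 1 < s) (hs2 : s ≤ 2) (hp : ∀ x, 0 < x → p x = x ^ (-s)) : IsPow p where
  mul x y hx hy := by rw [hp x hx, hp y hy, hp _ (mul_pos hx hy), Real.mul_rpow hx.le hy.le]
  anti x y hx hxy := by
    rw [hp x hx, hp y (hx.trans_le hxy)]
    exact Real.rpow_le_rpow_of_nonpos hx hxy (by linarith)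
  pos x hx := by rw [hp x hx]; positivity
  half := by
    rw [hp _ (by norm_num), one_div, Real.inv_rpow (by norm_num), Real.rpow_neg (by norm_num), inv_inv]
    calc (2:ℝ)^s ≤ 2^(2:ℝ) := Real.rpow_le_rpow_of_exponent_le (by norm_num) hs2
      _ = 4 := by norm_num
  int := integrable_php hs hp

lemma isPow_p3 : IsPow p3 := isPow_of_rpow (s := 3/2) (by norm_num) (by norm_num) fun x hx => p3_rpow hx
lemma isPow_p4 : IsPow p4 := isPow_of_rpow (s := 2) (by norm_num) (by norm_num) fun x hx => p4_rpow hx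

lemma IsPow.far {p : ℝ → ℝ} (hp : IsPow p) {D x : ℝ} (hD : 0 < D) (hx : D / 2 ≤ x) : p x ≤ 4 * p D := by
  refine (hp.anti _ _ (by positivity) hx).trans ?_
  rw [div_eq_mul_one_div, hp.mul _ _ hD (by norm_num), mul_comm]
  exact mul_le_mul_of_nonneg_right hp.half (hp.pos D hD).le

noncomputable def psi0 (p : ℝ → ℝ) (t : ℝ) : ℝ := 4 * ph1 t + 2 * php p t + 4 * ph1 (t - 1)

noncomputable def psi (p : ℝ → ℝ) (t : ℝ) : ℝ := psi0 p t + psi0 p (1 - t)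

lemma ph1_nonneg (t : ℝ) : 0 ≤ ph1 t := by unfold ph1; split_ifs <;> positivity

lemma IsPow.php_nonneg {p : ℝ → ℝ} (hp : IsPow p) (t : ℝ) : 0 ≤ php p t := by
  unfold php
  split_ifs with h
  · exact (hp.pos _ (by linarith)).le
  · exact le_rfl

lemma IsPow.int_psi0 {p : ℝ → ℝ} (hp : IsPow p) : Integrable (psi0 p) :=
  ((integrable_ph1.const_mul 4).add (hp.int.const_mul 2)).add ((integrable_ph1.comp_sub_right 1).const_mul 4)

lemma IsPow.int_psi {p : ℝ → ℝ} (hp : IsPow p) : Integrable (psi p) :=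
  hp.int_psi0.add (hp.int_psi0.comp_sub_left 1)

lemma td_tau_bd {ε : ℝ} (he : ε = 1 ∨ ε = -1) {V : ℝ} (hV : 0 < V) {p : ℝ → ℝ} (hp : IsPow p) {B : ℝ}
    (hB0 : 0 ≤ B) (hB : ∀ x, x ≠ 0 → |td ε V x| ≤ B * p |x|) {D y : ℝ} (hD : D ≠ 0) (hy : y ≠ 0) (hyD : y ≠ D) :
    |td ε V y * (tau ε V (y - D) - tau ε V (-D))| ≤ 50 * B * p |D| / √|D| * psi0 p (y / D) := by
  have hD0 := abs_pos.mpr hD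
  have hy0 := abs_pos.mpr hy
  have hyD0 := abs_pos.mpr (sub_ne_zero.mpr hyD)
  have hpD := hp.pos _ hD0
  have sD : 0 < √|D| := Real.sqrt_pos.mpr hD0
  have sy : 0 < √|y| := Real.sqrt_pos.mpr hy0
  have syD : 0 < √|y - D| := Real.sqrt_pos.mpr hyD0
  have n1 := ph1_nonneg (y / D)
  have n2 := hp.php_nonneg (y / D)
  have n3 := ph1_nonneg (y / D - 1)
  have hc : 0 ≤ 50 * B * p |D| / √|D| := by positivity
  have ayD : |y / D| = |y| / |D| := abs_div _ _
  by_cases h : |y| ≤ |D| / 2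
  · have e1 : ph1 (y / D) = √|D| / √|y| := by
      unfold ph1
      rw [if_pos (by rw [ayD, div_le_one hD0]; linarith), ayD, Real.sqrt_div hy0.le, one_div_div]
    have hm : |tau ε V (y - D) - tau ε V (-D)| ≤ 4 * B * p |D| * |y| := by
      have hconv := (convex_closedBall (-D) (|D|/2))
      have := hconv.norm_image_sub_le_of_norm_hasDerivWithin_le (f := tau ε V) (f' := td ε V) (C := 4 * B * p |D|)
        (x := -D) (y := y - D) ?_ ?_ (Metric.mem_closedBall_self (by positivity)) ?_
      · simpa using this
      · intro x hx
        rw [Metric.mem_closedBall, Real.dist_eq, sub_neg_eq_add] at hx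
        refine (hasDerivAt_tau he V ?_).hasDerivWithinAt
        rintro rfl
        rw [zero_add] at hx; linarith
      · intro x hx
        rw [Metric.mem_closedBall, Real.dist_eq, sub_neg_eq_add] at hx
        have hx2 : |D| / 2 ≤ |x| := by
          have := abs_sub_abs_le_abs_sub D (-x)
          rw [abs_neg, sub_neg_eq_add, add_comm] at this; linarith
        have hx0 : 0 < |x| := by linarith
        refine (hB x (abs_pos.mp hx0)).trans ?_
        have := mul_le_mul_of_nonneg_left (hp.far hD0 hx2) hB0
        linarith
      · rw [Metric.mem_closedBall, Real.dist_eq]; simpa using h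
    have ht := td_bd3 he hV hy
    rw [abs_mul]
    calc |td ε V y| * |tau ε V (y - D) - tau ε V (-D)| 
        ≤ (50 / (|y| * √|y|)) * (4 * B * p |D| * |y|) := mul_le_mul ht hm (abs_nonneg _) (by positivity)
      _ = 50 * B * p |D| / √|D| * (4 * ph1 (y / D)) := by rw [e1]; field_simp
      _ ≤ _ := by
        refine mul_le_mul_of_nonneg_left ?_ hc
        unfold psi0; linarith
  · push Not at h
    have e2 : p |y| = p |D| * php p (y / D) := by
      unfold php
      rw [if_pos (by rw [ayD, div_le_div_iff₀ (by norm_num) hD0]; linarith), ayD, 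
        ← hp.mul _ _ hD0 (by positivity), mul_div_cancel₀ _ hD0.ne']
    have t1 : |td ε V y| ≤ B * (p |D| * php p (y / D)) := by rw [← e2]; exact hB y hy
    have t2 : |td ε V y| ≤ 4 * B * p |D| := by
      refine (hB y hy).trans ?_
      have := mul_le_mul_of_nonneg_left (hp.far hD0 h.le) hB0
      linarith
    have u1 : |tau ε V (-D)| ≤ 50 / √|D| := by
      have := tau_bd1 he hV (neg_ne_zero.mpr hD)
      rwa [abs_neg] at this
    have v1 : |td ε V y| * |tau ε V (-D)| ≤ 50 * B * p |D| / √|D| * php p (y / D) := by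
      calc _ ≤ (B * (p |D| * php p (y / D))) * (50 / √|D|) := mul_le_mul t1 u1 (abs_nonneg _) (by positivity)
        _ = _ := by ring
    have v2 : |td ε V y| * |tau ε V (y - D)| ≤ 50 * B * p |D| / √|D| * (php p (y / D) + 4 * ph1 (y / D - 1)) := by
      have u2 := tau_bd1 he hV (sub_ne_zero.mpr hyD)
      have a3 : |y / D - 1| = |y - D| / |D| := by rw [← abs_div]; congr 1; field_simp
      by_cases h2 : |y - D| ≤ |D|
      · have e3 : ph1 (y / D - 1) = √|D| / √|y - D| := by
          unfold ph1
          rw [if_pos (by rw [a3, div_le_one hD0]; linarith), a3, Real.sqrt_div hyD0.le, one_div_div]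
        calc _ ≤ (4 * B * p |D|) * (50 / √|y - D|) := mul_le_mul t2 u2 (abs_nonneg _) (by positivity)
          _ = 50 * B * p |D| / √|D| * (4 * ph1 (y / D - 1)) := by rw [e3]; field_simp
          _ ≤ _ := by
            refine mul_le_mul_of_nonneg_left ?_ hc
            linarith
      · push Not at h2
        have u3 : |tau ε V (y - D)| ≤ 50 / √|D| := u2.trans 
          (div_le_div_of_nonneg_left (by norm_num) sD (Real.sqrt_le_sqrt h2.le))
        calc _ ≤ (B * (p |D| * php p (y / D))) * (50 / √|D|) := mul_le_mul t1 u3 (abs_nonneg _) (by positivity)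
          _ = 50 * B * p |D| / √|D| * (php p (y / D)) := by ring
          _ ≤ _ := by
            refine mul_le_mul_of_nonneg_left ?_ hc
            linarith
    rw [abs_mul]
    calc _ ≤ |td ε V y| * (|tau ε V (y - D)| + |tau ε V (-D)|) :=
          mul_le_mul_of_nonneg_left (abs_sub _ _) (abs_nonneg _)
      _ ≤ 50 * B * p |D| / √|D| * (2 * php p (y / D) + 4 * ph1 (y / D - 1)) := by
          rw [mul_add]; refine (add_le_add v2 v1).trans (le_of_eq ?_); ring
      _ ≤ _ := by
        refine mul_le_mul_of_nonneg_left ?_ hc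
        unfold psi0; linarith

noncomputable def RR (ε V D y : ℝ) : ℝ :=
  tau ε V y * tau ε V (y - D) - tau ε V (-D) * tau ε V y - tau ε V D * tau ε V (y - D)

noncomputable def RRd (ε V D y : ℝ) : ℝ :=
  td ε V y * (tau ε V (y - D) - tau ε V (-D)) + (tau ε V y - tau ε V D) * td ε V (y - D)

lemma RR_symm (ε V D y : ℝ) : RR ε V (-D) (y - D) = RR ε V D y := by
  unfold RR
  rw [neg_neg, sub_neg_eq_add, sub_add_cancel]; ring

lemma hasDerivAt_RR {ε : ℝ} (he : ε = 1 ∨ ε = -1) (V : ℝ) {D y : ℝ} (hy : y ≠ 0) (hyD : y ≠ D) :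
    HasDerivAt (RR ε V D) (RRd ε V D y) y := by
  have h1 := hasDerivAt_tau he V hy
  have h2 : HasDerivAt (fun y => tau ε V (y - D)) (td ε V (y - D)) y :=
    (hasDerivAt_tau he V (sub_ne_zero.mpr hyD)).comp_sub_const y D
  have h3 := ((h1.mul h2).sub (h1.const_mul (tau ε V (-D)))).sub (h2.const_mul (tau ε V D))
  refine h3.congr_deriv ?_
  unfold RRd; ring

lemma ker_mul_tendsto {ε : ℝ} (he : ε = 1 ∨ ε = -1) {u : ℝ → ℝ} {u' : ℝ} (hu : HasDerivAt u u' 0) (hu0 : u 0 = 0) :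
    ContinuousAt (fun y => ker ε y * u y) 0 := by
  have hO := hu.isBigO_sub
  rw [Asymptotics.isBigO_iff] at hO
  obtain ⟨c, hc⟩ := hO
  have hs : Filter.Tendsto (fun y : ℝ => c * √|y|) (nhds 0) (nhds 0) := by
    have : Continuous (fun y : ℝ => c * √|y|) := by fun_prop
    simpa using this.tendsto 0
  unfold ContinuousAt
  simp only [hu0, mul_zero]
  refine squeeze_zero_norm' ?_ hs
  filter_upwards [hc] with y hy
  rw [hu0, sub_zero, sub_zero, Real.norm_eq_abs, Real.norm_eq_abs] at hy
  rw [Real.norm_eq_abs, abs_mul, ker_abs he]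
  by_cases h0 : y = 0
  · subst h0; simp
  · have hy0 : 0 < √|y| := Real.sqrt_pos.mpr (abs_pos.mpr h0)
    rw [div_mul_eq_mul_div, one_mul, div_le_iff₀ hy0, mul_assoc, Real.mul_self_sqrt (abs_nonneg y)]
    exact hy

lemma continuousAt_RR_zero {ε : ℝ} (he : ε = 1 ∨ ε = -1) (V : ℝ) {D : ℝ} (hD : D ≠ 0) :
    ContinuousAt (RR ε V D) 0 := by
  have h2 : HasDerivAt (fun y => tau ε V (y - D)) (td ε V (0 - D)) 0 :=
    (hasDerivAt_tau he V (by simpa using hD)).comp_sub_const 0 D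
  have h3 := h2.sub_const (tau ε V (-D))
  have h4 := ker_mul_tendsto he h3 (by simp)
  have h5 := ((continuous_bb he V).continuousAt (x := (0:ℝ)))
  have h6 := ((h4.sub ((h5.add (continuousAt_const (y := tau ε V D))).mul h3.continuousAt)).sub 
    (continuousAt_const (y := tau ε V D * tau ε V (-D))))
  refine h6.congr (Filter.Eventually.of_forall fun y => ?_)
  simp only [RR, Pi.sub_apply, Pi.mul_apply, Pi.add_apply]
  rw [show tau ε V y = ker ε y - bb ε V y from rfl]
  ring

lemma continuous_RR {ε : ℝ} (he : ε = 1 ∨ ε = -1) (V : ℝ) {D : ℝ} (hD : D ≠ 0) : Continuous (RR ε V D) := by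
  rw [continuous_iff_continuousAt]
  intro y
  by_cases h : y = 0
  · subst h; exact continuousAt_RR_zero he V hD
  by_cases h2 : y = D
  · subst h2
    have h3 := continuousAt_RR_zero he V (neg_ne_zero.mpr hD)
    have h4 : ContinuousAt (fun x => RR ε V (-y) (x - y)) y :=
      ContinuousAt.comp (f := fun x => x - y) (g := RR ε V (-y)) (by simpa using h3) (by fun_prop)
    refine h4.congr (Filter.Eventually.of_forall fun x => RR_symm ε V y x)
  · exact (hasDerivAt_RR he V h h2).continuousAt

lemma RRd_bd {ε : ℝ} (he : ε = 1 ∨ ε = -1) {V : ℝ} (hV : 0 < V) {p : ℝ → ℝ} (hp : IsPow p) {B : ℝ}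
    (hB0 : 0 ≤ B) (hB : ∀ x, x ≠ 0 → |td ε V x| ≤ B * p |x|) {D y : ℝ} (hD : D ≠ 0) (hy : y ≠ 0) (hyD : y ≠ D) :
    |RRd ε V D y| ≤ 50 * B * p |D| / √|D| * psi p (y / D) := by
  have h1 := td_tau_bd he hV hp hB0 hB hD hy hyD
  have h2 := td_tau_bd he hV hp hB0 hB (neg_ne_zero.mpr hD) (y := y - D) (sub_ne_zero.mpr hyD) 
    (by intro h; apply hy; linarith)
  rw [abs_neg, neg_neg, sub_neg_eq_add, sub_add_cancel, 
    show (y - D) / (-D) = 1 - y / D by field_simp; ring] at h2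
  unfold RRd psi
  refine (abs_add_le _ _).trans ?_
  rw [mul_add]
  refine add_le_add h1 ?_
  rw [mul_comm (tau ε V y - tau ε V D)]; exact h2

noncomputable def KP (p : ℝ → ℝ) : ℝ := ∫ t, psi p t

lemma E_gen {ε : ℝ} (he : ε = 1 ∨ ε = -1) {V : ℝ} (hV : 0 < V) {p : ℝ → ℝ} (hp : IsPow p) {B : ℝ}
    (hB0 : 0 ≤ B) (hB : ∀ x, x ≠ 0 → |td ε V x| ≤ B * p |x|) {D : ℝ} (hD : D ≠ 0) {x A : ℝ}
    (hA : HasSum (fun n : ℤ => RR ε V D (n + x)) A) :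
    |A - ∫ y, tau ε V y * tau ε V (y - D)| ≤ 50 * B * p |D| * √|D| * KP p := by
  have hi := integrable_tau he hV
  have hi2 := hi.comp_sub_right D
  have hi3 := integrable_tau_prod he hV hD
  have hR : Integrable (RR ε V D) := (hi3.sub (hi.const_mul (tau ε V (-D)))).sub (hi2.const_mul (tau ε V D))
  have eR : ∫ y, RR ε V D y = ∫ y, tau ε V y * tau ε V (y - D) := by
    have e1 : ∫ y, RR ε V D y = (∫ y, (tau ε V y * tau ε V (y - D) - tau ε V (-D) * tau ε V y)) -
        ∫ y, tau ε V D * tau ε V (y - D) :=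
      integral_sub (hi3.sub (hi.const_mul (tau ε V (-D)))) (hi2.const_mul (tau ε V D))
    rw [e1, integral_sub hi3 (hi.const_mul (tau ε V (-D))), integral_const_mul, integral_const_mul,
      integral_sub_right_eq_self (fun y => tau ε V y), integral_tau he hV]
    ring
  have hD0 := abs_pos.mpr hD
  have hg : Integrable (fun y => 50 * B * p |D| / √|D| * psi p (y / D)) :=
    (hp.int_psi.comp_div hD).const_mul _
  have hm : Measurable (RRd ε V D) := by
    have m1 := measurable_tau he V
    have m2 := measurable_td ε V
    have m3 : Measurable (fun y : ℝ => y - D) := measurable_id.sub_const D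
    exact (m2.mul ((m1.comp m3).sub_const _)).add ((m1.sub_const _).mul (m2.comp m3))
  have := sum_int (R := RR ε V D) (R' := RRd ε V D) (S := {0, D}) (Set.toFinite _).countable (continuous_RR he V hD)
    (fun y hy => by
      simp only [Set.mem_insert_iff, Set.mem_singleton_iff, not_or] at hy
      exact hasDerivAt_RR he V hy.1 hy.2) hg
    (fun y hy => by
      simp only [Set.mem_insert_iff, Set.mem_singleton_iff, not_or] at hy
      exact RRd_bd he hV hp hB0 hB hD hy.1 hy.2) hm hR hA
  rw [eR] at this
  refine this.trans (le_of_eq ?_)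
  rw [integral_const_mul, Measure.integral_comp_div (fun x => psi p x), smul_eq_mul]
  unfold KP
  have := Real.mul_self_sqrt hD0.le
  have h0 : 0 < √|D| := Real.sqrt_pos.mpr hD0
  field_simp
  linear_combination (-(B * p |D| * ∫ y, psi p y)) * this

noncomputable def KE : ℝ := 2500 * |KP p3| + 5000 * |KP p4|

lemma KE_nonneg : 0 ≤ KE := by unfold KE; positivity

lemma E_bound {ε : ℝ} (he : ε = 1 ∨ ε = -1) {V : ℝ} (hV : 0 < V) {D : ℝ} (hD : D ≠ 0) {x A : ℝ}
    (hA : HasSum (fun n : ℤ => RR ε V D (n + x)) A) :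
    |A - ∫ y, tau ε V y * tau ε V (y - D)| ≤ KE * (1 / |D|) ∧
    |A - ∫ y, tau ε V y * tau ε V (y - D)| ≤ KE * (√V * p3 |D|) := by
  have hD0 := abs_pos.mpr hD
  have h0 : 0 < √|D| := Real.sqrt_pos.mpr hD0
  have hss := Real.mul_self_sqrt hD0.le
  have k3 := le_abs_self (KP p3)
  have k4 := le_abs_self (KP p4)
  constructor
  · refine (E_gen he hV isPow_p3 (B := 50) (by norm_num) (fun x hx => ?_) hD hA).trans ?_
    · refine (td_bd3 he hV hx).trans (le_of_eq ?_); unfold p3; ring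
    · have e : 50 * 50 * p3 |D| * √|D| * KP p3 = 2500 * KP p3 * (1 / |D|) := by
        generalize KP p3 = K
        unfold p3; field_simp; ring
      rw [e]
      refine mul_le_mul_of_nonneg_right ?_ (by positivity)
      unfold KE
      linarith [abs_nonneg (KP p4)]
  · refine (E_gen he hV isPow_p4 (B := 100 * √V) (by positivity) (fun x hx => ?_) hD hA).trans ?_
    · refine (td_bd4 he hV hx).trans (le_of_eq ?_); unfold p4; ring
    · have e : 50 * (100 * √V) * p4 |D| * √|D| * KP p4 = 5000 * KP p4 * (√V * p3 |D|) := by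
        generalize KP p4 = K
        unfold p3 p4; field_simp
        linear_combination 5000 * K * hss
      rw [e]
      refine mul_le_mul_of_nonneg_right ?_ (by unfold p3; positivity)
      unfold KE
      linarith [abs_nonneg (KP p3)]

end TTR

namespace TTR

open MeasureTheory

/-! ### Folding the diagonal terms -/

lemma integrable_of_hasSum {F : ℤ → ℝ → ℝ} {G : ℝ → ℝ} (hF : ∀ i, Integrable (F i))
    (hs : Summable fun i => ∫ a, ‖F i a‖) (hG : Measurable G) (hFG : ∀ x, HasSum (fun i => F i x) (G x)) :
    Integrable G := by
  refine ⟨hG.aestronglyMeasurable, ?_⟩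
  unfold HasFiniteIntegral
  have h1 : ∫⁻ a, ‖G a‖ₑ ≤ ∫⁻ a, ∑' i, ‖F i a‖ₑ := by
    refine lintegral_mono fun a => ?_
    rw [← (hFG a).tsum_eq]
    exact enorm_tsum_le_tsum_enorm
  refine lt_of_le_of_lt h1 ?_
  rw [lintegral_tsum fun i => (hF i).1.enorm]
  have (i : ℤ) : ∫⁻ a, ‖F i a‖ₑ = ‖∫ a, ‖F i a‖‖ₑ := by
    dsimp [enorm]
    rw [lintegral_coe_eq_integral _ (hF i).norm, ENNReal.coe_nnreal_eq, coe_nnnorm,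
      Real.norm_of_nonneg (integral_nonneg (fun a ↦ abs_nonneg (F i a)))]
    simp only [coe_nnnorm, Real.norm_eq_abs]
  rw [funext this]
  exact lt_top_iff_ne_top.mpr (ENNReal.tsum_coe_ne_top_iff_summable.2 <| NNReal.summable_coe.1 hs.abs)

noncomputable def fd (ε d x : ℝ) : ℝ := f ε (x / d) / √d

noncomputable def Phi0 (ε V d : ℝ) (w : ℤ) : ℝ :=
  if w = 0 then 0 else ∫ y, tau ε V y * tau ε V (y - d * w)

lemma fd_hasSum {ε : ℝ} (he : ε = 1 ∨ ε = -1) {m : ℕ} (hm : 0 < m) {d V : ℝ} (hd : 0 < d) (hV : V = d * m) (x : ℝ) :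
    HasSum (fun n : ℤ => tau ε V (x + d * n)) (fd ε d x) := by
  rw [hV]; exact hasSum_tau_scaled he hm hd x

lemma fd_shift {ε : ℝ} {d : ℝ} (hd : 0 < d) (x : ℝ) (n : ℤ) : fd ε d (x + d * n) = fd ε d x := by
  unfold fd
  rw [add_div, mul_div_cancel_left₀ _ hd.ne', f_add_int]

lemma measurable_fd {ε : ℝ} (he : ε = 1 ∨ ε = -1) (d : ℝ) : Measurable (fd ε d) := by
  unfold fd
  exact ((measurable_f he).comp (measurable_id.div_const d)).div_const _

lemma summable_p3 {d : ℝ} (hd : 0 < d) : Summable (fun w : ℤ => p3 |d * w|) := by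
  have h := (summable_base 0).mul_left (p3 d)
  refine h.congr fun w => ?_
  by_cases hw : w = 0
  · subst hw; simp [p3]
  · have : (0:ℝ) < |(w:ℝ)| := abs_pos.mpr (by exact_mod_cast hw)
    rw [abs_mul, abs_of_pos hd, isPow_p3.mul _ _ hd this, zero_add]; rfl

lemma Phi_F {ε : ℝ} (he : ε = 1 ∨ ε = -1) {m : ℕ} (hm : 0 < m) {d V : ℝ} (hd : 0 < d) (hV : V = d * m) :
    HasSum (Phi0 ε V d) (∫ x, tau ε V x * (fd ε d x - tau ε V x)) ∧
    Integrable (fun x => tau ε V x * (fd ε d x - tau ε V x)) := by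
  have hV0 : 0 < V := by rw [hV]; positivity
  set F : ℤ → ℝ → ℝ := fun w x => if w = 0 then 0 else tau ε V x * tau ε V (x - d * w) with hFdef
  have dw : ∀ w : ℤ, w ≠ 0 → d * w ≠ 0 := fun w hw => mul_ne_zero hd.ne' (by exact_mod_cast hw)
  have hF : ∀ w, Integrable (F w) := by
    intro w
    by_cases hw : w = 0
    · simp only [hFdef, if_pos hw]; exact integrable_zero _ _ _
    · simp only [hFdef, if_neg hw]; exact integrable_tau_prod he hV0 (dw w hw)
  have ht := integrable_tau he hV0
  have hs : Summable fun w => ∫ a, ‖F w a‖ := by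
    refine Summable.of_nonneg_of_le (fun w => integral_nonneg fun a => norm_nonneg _) (fun w => ?_)
      (((summable_p3 hd).mul_left (100 * V * 4)).mul_right (2 * ∫ x, |tau ε V x|))
    by_cases hw : w = 0
    · simp [hFdef, hw, p3]
    · simp only [hFdef, if_neg hw]
      have h2 := ht.comp_sub_right (d * w)
      have h3 := integral_mono (integrable_tau_prod he hV0 (dw w hw)).norm
        ((ht.abs.add h2.abs).const_mul (100 * V * (4 * p3 |d * w|)))
        (fun x => tau_prod_bd he hV0 (dw w hw) x)
      refine h3.trans (le_of_eq ?_)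
      rw [integral_const_mul]
      have e : ∫ a, ((fun x => |tau ε V x|) + fun t => |tau ε V (t - d * w)|) a = 
          (∫ x, |tau ε V x|) + ∫ x, |tau ε V (x - d * w)| := integral_add ht.abs h2.abs
      have e2 : ∫ x, |tau ε V (x - d * w)| = ∫ x, |tau ε V x| := 
        integral_sub_right_eq_self (fun x => |tau ε V x|) (d * w : ℝ)
      rw [e2] at e
      rw [e]; ring
  have hG : Measurable (fun x => tau ε V x * (fd ε d x - tau ε V x)) :=
    (measurable_tau he V).mul ((measurable_fd he d).sub (measurable_tau he V))
  have hFG : ∀ x, HasSum (fun w => F w x) (tau ε V x * (fd ε d x - tau ε V x)) := by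
    intro x
    have h1 := (Equiv.neg ℤ).hasSum_iff.mpr (fd_hasSum he hm hd hV x)
    have h2 := (h1.sub (hasSum_ite_eq (0:ℤ) (tau ε V x))).mul_left (tau ε V x)
    refine h2.congr_fun fun w => ?_
    simp only [hFdef, Function.comp_apply, Equiv.neg_apply]
    split_ifs with hw
    · simp [hw]
    · rw [sub_zero]; push_cast; congr 2; ring
  have h4 := hasSum_integral_of_summable_integral_norm hF hs
  have e : (∫ a, (∑' i, F i a)) = ∫ x, tau ε V x * (fd ε d x - tau ε V x) :=
    integral_congr_ae (Filter.Eventually.of_forall fun x => (hFG x).tsum_eq)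
  rw [e] at h4
  refine ⟨h4.congr_fun fun w => ?_, integrable_of_hasSum hF hs hG hFG⟩
  unfold Phi0
  simp only [hFdef]
  split_ifs with hw
  · simp
  · rfl

lemma integrableOn_tau_sq {ε : ℝ} (he : ε = 1 ∨ ε = -1) {V : ℝ} (hV : 0 < V) {c : ℝ} (hc : 0 < c) {S : Set ℝ}
    (hS : MeasurableSet S) (hSc : ∀ x ∈ S, c ≤ |x|) : IntegrableOn (fun x => tau ε V x ^ 2) S := by
  have h := (integrable_tau he hV).abs.integrableOn (s := S) 
  refine (h.const_mul (50 / √c)).mono' ((measurable_tau he V).pow_const 2).aestronglyMeasurable ?_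
  refine (ae_restrict_iff' hS).mpr (Filter.Eventually.of_forall fun x hx => ?_)
  have h1 := hSc x hx
  have hx0 : 0 < |x| := by linarith
  have h2 := tau_bd1 he hV (abs_pos.mp hx0)
  have h3 : 50 / √|x| ≤ 50 / √c := 
    div_le_div_of_nonneg_left (by norm_num) (Real.sqrt_pos.mpr hc) (Real.sqrt_le_sqrt h1)
  rw [Real.norm_eq_abs, abs_pow, sq]
  exact mul_le_mul_of_nonneg_right (h2.trans h3) (abs_nonneg _)

noncomputable def II (d : ℝ) : Set ℝ := Set.Ioc (-(d/2)) (d/2)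

lemma Phi_fold {ε : ℝ} (he : ε = 1 ∨ ε = -1) {m : ℕ} (hm : 0 < m) {d V : ℝ} (hd : 0 < d) (hV : V = d * m) :
    HasSum (Phi0 ε V d) ((∫ x in II d, (fd ε d x ^ 2 - tau ε V x ^ 2)) - ∫ x in (II d)ᶜ, tau ε V x ^ 2) := by
  have hV0 : 0 < V := by rw [hV]; positivity
  obtain ⟨h1, h2⟩ := Phi_F he hm hd hV
  have mI : MeasurableSet (II d) := measurableSet_Ioc
  have h3 : IntegrableOn (fun x => tau ε V x ^ 2) (II d)ᶜ := by
    refine integrableOn_tau_sq he hV0 (c := d/2) (by positivity) mI.compl fun x hx => ?_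
    by_contra h
    push Not at h
    rw [abs_lt] at h
    exact hx ⟨h.1, h.2.le⟩
  have h4 : Integrable ((II d)ᶜ.indicator (fun x => tau ε V x ^ 2)) := h3.integrable_indicator mI.compl
  have h5 := fold (h2.add h4) hd (-(d/2)) (F := fun x => fd ε d x ^ 2 - tau ε V x ^ 2) ?_
  · have e1 : (∫ x, ((fun x => tau ε V x * (fd ε d x - tau ε V x)) + (II d)ᶜ.indicator (fun x => tau ε V x ^ 2)) x)
      = (∫ x, tau ε V x * (fd ε d x - tau ε V x)) + ∫ x, (II d)ᶜ.indicator (fun x => tau ε V x ^ 2) x :=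
      integral_add h2 h4
    rw [e1, integral_indicator mI.compl] at h5
    rw [show -(d/2) + d = d/2 by ring] at h5
    unfold II at *
    rw [← h5, add_sub_cancel_right]; exact h1
  · intro x hx
    rw [show -(d/2) + d = d/2 by ring] at hx
    have k := ((fd_hasSum he hm hd hV x).mul_right (fd ε d x)).sub (hasSum_ite_eq (0:ℤ) (tau ε V x ^ 2))
    rw [← sq] at k
    refine k.congr_fun fun n => ?_
    simp only [Pi.add_apply, fd_shift hd]
    split_ifs with hn
    · subst hn
      have : x + d * ((0:ℤ):ℝ) = x := by simp
      have hx' : x ∉ (II d)ᶜ := fun h => h hx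
      rw [this, Set.indicator_of_notMem hx']; ring
    · rw [Set.indicator_of_mem]
      · ring
      · intro hmem
        have a1 := hmem.1
        have a2 := hmem.2
        have b1 := hx.1
        have b2 := hx.2
        rcases lt_or_gt_of_ne hn with h | h
        · have : (n:ℝ) ≤ -1 := by exact_mod_cast Int.le_sub_one_of_lt h
          nlinarith
        · have : (1:ℝ) ≤ n := by exact_mod_cast h
          nlinarith

end TTR

namespace TTR

open MeasureTheory

/-! ### The main term -/

noncomputable def uu (ε V x : ℝ) : ℝ := 1 / |x| - tau ε V x ^ 2

noncomputable def ud (ε V x : ℝ) : ℝ :=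
  bd ε V x * (ker ε x + tau ε V x) + bb ε V x * (kd ε x + td ε V x)

lemma ker_sq {ε : ℝ} (he : ε = 1 ∨ ε = -1) (x : ℝ) : ker ε x ^ 2 = 1 / |x| := by
  rw [← sq_abs, ker_abs he, div_pow, one_pow, Real.sq_sqrt (abs_nonneg x)]

lemma uu_eq {ε : ℝ} (he : ε = 1 ∨ ε = -1) (V x : ℝ) : uu ε V x = bb ε V x * (ker ε x + tau ε V x) := by
  unfold uu
  rw [← ker_sq he]; unfold tau; ring

lemma uu_bd {ε : ℝ} (he : ε = 1 ∨ ε = -1) {V x : ℝ} (hV : 0 < V) (hx : x ≠ 0) :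
    |uu ε V x| ≤ 1632 / √V * (1 / √|x|) := by
  have h1 := bb_bd he hV x
  have h2 := tau_bd1 he hV hx
  have h3 := ker_abs he x
  have hs : 0 < √|x| := Real.sqrt_pos.mpr (abs_pos.mpr hx)
  have hv : 0 < √V := Real.sqrt_pos.mpr hV
  rw [uu_eq he, abs_mul]
  have h4 : |ker ε x + tau ε V x| ≤ 51 / √|x| := by
    refine (abs_add_le _ _).trans ?_
    rw [h3]
    refine (add_le_add_right h2 _).trans (le_of_eq ?_); ring
  calc _ ≤ 32 / √V * (51 / √|x|) := mul_le_mul h1 h4 (abs_nonneg _) (by positivity)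
    _ = _ := by ring

lemma hasDerivAt_uu {ε : ℝ} (he : ε = 1 ∨ ε = -1) (V : ℝ) {x : ℝ} (hx : x ≠ 0) :
    HasDerivAt (uu ε V) (ud ε V x) x := by
  have h := (hasDerivAt_bb he V x).mul ((hasDerivAt_ker he hx).add (hasDerivAt_tau he V hx))
  have e : uu ε V = fun x => bb ε V x * (ker ε x + tau ε V x) := funext fun x => uu_eq he V x
  rw [e]
  exact h

lemma ud_bd {ε : ℝ} (he : ε = 1 ∨ ε = -1) {V x : ℝ} (hV : 0 < V) (hx : 0 < x) :
    |ud ε V x| ≤ 4500 / √V * p3 x := by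
  have hs : 0 < √x := Real.sqrt_pos.mpr hx
  have hv : 0 < √V := Real.sqrt_pos.mpr hV
  have ax : |x| = x := abs_of_pos hx
  have h1 := bb_bd he hV x
  have h2 := tau_bd1 he hV hx.ne'
  have h3 := ker_abs he x
  have h5 := kd_abs he x
  have h6 := td_bd3 he hV hx.ne'
  rw [ax] at h2 h3 h5 h6
  have h4 : |ker ε x + tau ε V x| ≤ 51 / √x := by
    refine (abs_add_le _ _).trans ?_
    rw [h3]
    refine (add_le_add_right h2 _).trans (le_of_eq ?_); ring
  have h7 : 1 / (2 * (x * √x)) ≤ 1 / (x * √x) := 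
    div_le_div_of_nonneg_left (by norm_num) (by positivity) (by nlinarith [mul_pos hx hs])
  have h8 : |kd ε x + td ε V x| ≤ 51 / (x * √x) := by
    refine (abs_add_le _ _).trans ?_
    rw [h5]
    refine (add_le_add h7 h6).trans (le_of_eq ?_); ring
  have h9 : |bd ε V x| ≤ 51 / (x * √x) := by
    have : bd ε V x = kd ε x - td ε V x := by unfold td; ring
    rw [this]
    refine (abs_sub _ _).trans ?_
    rw [h5]
    refine (add_le_add h7 h6).trans (le_of_eq ?_); ring
  have part2 : |bb ε V x * (kd ε x + td ε V x)| ≤ 1632 / √V * p3 x := by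
    rw [abs_mul]
    calc _ ≤ 32 / √V * (51 / (x * √x)) := mul_le_mul h1 h8 (abs_nonneg _) (by positivity)
      _ = _ := by unfold p3; ring
  have part1 : |bd ε V x * (ker ε x + tau ε V x)| ≤ 2601 / √V * p3 x := by
    rw [abs_mul]
    by_cases hxV : x ≤ V
    · have := bd_bd he hV (x := x) (by rwa [ax])
      calc _ ≤ 16 / (V * √V) * (51 / √x) := mul_le_mul this h4 (abs_nonneg _) (by positivity)
        _ = 816 / √V * (1 / (V * √x)) := by field_simp; norm_num
        _ ≤ 2601 / √V * p3 x := by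
          unfold p3
          refine mul_le_mul (div_le_div_of_nonneg_right (by norm_num) hv.le) ?_ (by positivity) (by positivity)
          exact div_le_div_of_nonneg_left (by norm_num) (by positivity) (mul_le_mul_of_nonneg_right hxV hs.le)
    · push Not at hxV
      calc _ ≤ 51 / (x * √x) * (51 / √x) := mul_le_mul h9 h4 (abs_nonneg _) (by positivity)
        _ = 2601 / √x * p3 x := by unfold p3; field_simp; norm_num
        _ ≤ 2601 / √V * p3 x := by
          refine mul_le_mul_of_nonneg_right ?_ (isPow_p3.pos x hx).le
          exact div_le_div_of_nonneg_left (by norm_num) hv (Real.sqrt_le_sqrt hxV.le)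
  unfold ud
  refine (abs_add_le _ _).trans ((add_le_add part1 part2).trans ?_)
  rw [← add_mul, ← add_div]
  refine mul_le_mul_of_nonneg_right ?_ (isPow_p3.pos x hx).le
  exact div_le_div_of_nonneg_right (by norm_num) hv.le

lemma continuousOn_uu {ε : ℝ} (he : ε = 1 ∨ ε = -1) (V : ℝ) : ContinuousOn (uu ε V) (Set.Ioi 0) :=
  fun _ hx => (hasDerivAt_uu he V (ne_of_gt hx)).continuousAt.continuousWithinAt

lemma continuousOn_tau {ε : ℝ} (he : ε = 1 ∨ ε = -1) (V : ℝ) : ContinuousOn (tau ε V) (Set.Ioi 0) :=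
  fun _ hx => (hasDerivAt_tau he V (ne_of_gt hx)).continuousAt.continuousWithinAt

lemma uIcc_pos {a b : ℝ} (ha : 0 < a) (hb : 0 < b) : Set.uIcc a b ⊆ Set.Ioi 0 := by
  intro x hx
  exact lt_of_lt_of_le (lt_min ha hb) hx.1

lemma ii_tau {ε : ℝ} (he : ε = 1 ∨ ε = -1) (V : ℝ) {a b : ℝ} (ha : 0 < a) (hb : 0 < b) :
    IntervalIntegrable (fun x => tau ε V x ^ 2) volume a b :=
  (((continuousOn_tau he V).mono (uIcc_pos ha hb)).pow 2).intervalIntegrable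

lemma ii_uu {ε : ℝ} (he : ε = 1 ∨ ε = -1) (V : ℝ) {a b : ℝ} (ha : 0 < a) (hb : 0 < b) :
    IntervalIntegrable (uu ε V) volume a b :=
  ((continuousOn_uu he V).mono (uIcc_pos ha hb)).intervalIntegrable

lemma int_uu {ε : ℝ} (he : ε = 1 ∨ ε = -1) (V : ℝ) {a b : ℝ} (ha : 0 < a) (hb : 0 < b) :
    ∫ x in a..b, tau ε V x ^ 2 = Real.log (b / a) - ∫ x in a..b, uu ε V x := by
  rw [← integral_one_div_of_pos ha hb, ← intervalIntegral.integral_sub]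
  · refine intervalIntegral.integral_congr fun x hx => ?_
    simp only [uu]
    rw [abs_of_pos (uIcc_pos ha hb hx)]; ring
  · refine ContinuousOn.intervalIntegrable fun x hx => ?_
    have := uIcc_pos ha hb hx
    exact (continuousAt_const.div continuousAt_id (ne_of_gt this)).continuousWithinAt
  · exact ii_uu he V ha hb

lemma uu_step {ε : ℝ} (he : ε = 1 ∨ ε = -1) {V : ℝ} (hV : 0 < V) {a : ℝ} (ha : 0 < a) :
    |uu ε V a - ∫ x in a..a+1, uu ε V x| ≤ 4500 / √V * p3 a := by
  have e1 : uu ε V a - ∫ x in a..a+1, uu ε V x = ∫ x in a..a+1, (uu ε V a - uu ε V x) := by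
    rw [intervalIntegral.integral_sub (by simp) (ii_uu he V ha (by linarith))]
    simp
  rw [e1]
  have := intervalIntegral.norm_integral_le_of_norm_le_const (a := a) (b := a+1) (f := fun x => uu ε V a - uu ε V x)
    (C := 4500 / √V * p3 a) (fun x hx => ?_)
  · simpa using this
  · rw [Set.uIoc_of_le (by linarith)] at hx
    have hm := (convex_Icc a (a+1)).norm_image_sub_le_of_norm_hasDerivWithin_le (f := uu ε V) (f' := ud ε V)
      (C := 4500 / √V * p3 a) (x := x) (y := a)
      (fun t ht => (hasDerivAt_uu he V (by have := ht.1; linarith)).hasDerivWithinAt)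
      (fun t ht => (ud_bd he hV (by have := ht.1; linarith)).trans
        (mul_le_mul_of_nonneg_left (isPow_p3.anti _ _ ha ht.1) (by positivity)))
      ⟨hx.1.le, hx.2⟩ ⟨le_rfl, by linarith⟩
    refine hm.trans ?_
    have h0 : 0 ≤ 4500 / √V * p3 a := mul_nonneg (by positivity) (isPow_p3.pos a ha).le
    refine mul_le_of_le_one_right h0 ?_
    rw [Real.norm_eq_abs, abs_sub_comm, abs_of_nonneg (by linarith [hx.1])]; linarith [hx.2]

lemma gamma_partial {ε : ℝ} (he : ε = 1 ∨ ε = -1) {V : ℝ} (hV : 0 < V) (N : ℕ) :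
    |∑ n ∈ range N, tau ε V (n + 1) ^ 2 - (∫ x in (1:ℝ)..(N + 1), tau ε V x ^ 2) - Real.eulerMascheroniSeq N| ≤
      4500 / √V * ∑ n ∈ range N, p3 (n + 1) := by
  induction N with
  | zero => simp [Real.eulerMascheroniSeq]
  | succ N ih =>
    have hN : (0:ℝ) < N + 1 := by positivity
    rw [Finset.sum_range_succ, Finset.sum_range_succ]
    have e1 : ∫ x in (1:ℝ)..((N + 1 : ℕ) + 1), tau ε V x ^ 2 = (∫ x in (1:ℝ)..(N + 1), tau ε V x ^ 2) +
        ∫ x in ((N:ℝ) + 1)..(N + 1 + 1), tau ε V x ^ 2 := by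
      rw [intervalIntegral.integral_add_adjacent_intervals (ii_tau he V one_pos hN) (ii_tau he V hN (by positivity))]
      push_cast; rfl
    have e2 : Real.eulerMascheroniSeq (N + 1) = Real.eulerMascheroniSeq N + 1 / (N + 1) - Real.log ((N + 1 + 1) / (N + 1)) := by
      unfold Real.eulerMascheroniSeq
      rw [harmonic_succ, Real.log_div (by positivity) (by positivity)]
      push_cast; ring
    have h3 := uu_step he hV hN
    have e3 := int_uu he V hN (show (0:ℝ) < N + 1 + 1 by positivity)
    have e4 : uu ε V (N + 1) = 1 / (N + 1) - tau ε V (N + 1) ^ 2 := by unfold uu; rw [abs_of_pos hN]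
    rw [e1, e2, e3, mul_add]
    rw [e4] at h3
    have h5 := abs_add_le (∑ n ∈ range N, tau ε V (n + 1) ^ 2 - (∫ x in (1:ℝ)..(N + 1), tau ε V x ^ 2) - Real.eulerMascheroniSeq N)
      (-(1 / ((N:ℝ) + 1) - tau ε V (N + 1) ^ 2 - ∫ x in ((N:ℝ) + 1)..(N + 1 + 1), uu ε V x))
    rw [abs_neg] at h5
    refine le_trans (le_of_eq ?_) (h5.trans (add_le_add ih h3))
    congr 1; ring

noncomputable def K3 : ℝ := ∑' n : ℕ, p3 (n + 1)

lemma summable_p3_nat : Summable (fun n : ℕ => p3 ((n:ℝ) + 1)) := by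
  have h := (summable_p3 one_pos).comp_injective (i := fun n : ℕ => (n : ℤ) + 1) 
    (fun a b h => by simpa using h)
  refine h.congr fun n => ?_
  simp only [Function.comp_apply, one_mul]
  push_cast
  rw [abs_of_pos (by positivity)]

lemma gamma_lim {ε : ℝ} (he : ε = 1 ∨ ε = -1) {V : ℝ} (hV : 0 < V) {S : ℝ}
    (hS : HasSum (fun n : ℕ => tau ε V (n + 1) ^ 2) S) :
    |S - (∫ x in Set.Ioi (1:ℝ), tau ε V x ^ 2) - Real.eulerMascheroniConstant| ≤ 4500 / √V * K3 := by
  have hI : IntegrableOn (fun x => tau ε V x ^ 2) (Set.Ioi 1) :=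
    integrableOn_tau_sq he hV one_pos measurableSet_Ioi fun x hx => le_trans (le_of_lt hx) (le_abs_self x)
  have h1 := hS.tendsto_sum_nat
  have h2 := intervalIntegral_tendsto_integral_Ioi (1:ℝ) hI 
    (Filter.tendsto_atTop_add_const_right _ (1:ℝ) tendsto_natCast_atTop_atTop)
  have h3 := ((h1.sub h2).sub Real.tendsto_eulerMascheroniSeq).abs
  refine le_of_tendsto h3 (Filter.Eventually.of_forall fun N => ?_)
  refine (gamma_partial he hV N).trans ?_
  refine mul_le_mul_of_nonneg_left ?_ (by positivity)
  exact summable_p3_nat.sum_le_tsum _ (fun n _ => (isPow_p3.pos _ (by positivity)).le)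

lemma sum_tau_sq {ε : ℝ} (he : ε = 1 ∨ ε = -1) {V : ℝ} {A : ℝ}
    (hA : HasSum (fun n : ℤ => tau ε V n ^ 2) A) :
    ∃ S, HasSum (fun n : ℕ => tau ε V (n + 1) ^ 2) S ∧ A = tau ε V 0 ^ 2 + 2 * S := by
  have hs : Summable (fun n : ℕ => tau ε V (n + 1) ^ 2) := by
    refine (hA.summable.comp_injective (i := fun n : ℕ => (n : ℤ) + 1) (fun a b h => by simpa using h)).congr fun n => ?_
    simp
  refine ⟨_, hs.hasSum, ?_⟩
  set S := ∑' n : ℕ, tau ε V (n + 1) ^ 2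
  have h1 : HasSum (fun n : ℕ => tau ε V ((n:ℤ):ℝ) ^ 2) (tau ε V 0 ^ 2 + S) := by
    have h := (hasSum_nat_add_iff' (f := fun n : ℕ => tau ε V ((n:ℤ):ℝ) ^ 2) (g := tau ε V 0 ^ 2 + S) 1).mp
    apply h
    simp only [Finset.sum_range_one]
    have : tau ε V 0 ^ 2 + S - tau ε V (((0:ℕ):ℤ):ℝ) ^ 2 = S := by simp
    rw [this]
    refine hs.hasSum.congr_fun fun n => ?_
    push_cast; rfl
  have h2 : HasSum (fun n : ℕ => tau ε V ((-((n:ℤ)+1) : ℤ):ℝ) ^ 2) S := by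
    refine hs.hasSum.congr_fun fun n => ?_
    push_cast
    rw [tau_neg he, mul_pow, sq ε, sq_he he, one_mul]
  have := h1.of_nat_of_neg_add_one (f := fun n : ℤ => tau ε V n ^ 2) h2
  rw [hA.unique this]; ring

end TTR

namespace TTR
open MeasureTheory

lemma even_II {F : ℝ → ℝ} (hF : ∀ x, F (-x) = F x) {c : ℝ} (hc : 0 < c) :
    ∫ x in Set.Ioc (-c) c, F x = 2 * ∫ x in Set.Ioc 0 c, F x := by
  have hF' : ∀ x, F |x| = F x := fun x => by
    rcases abs_choice x with h | h <;> rw [h]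
    exact hF x
  have h1 := integral_comp_abs (f := fun x => if x ≤ c then F x else 0)
  have h2 : ∫ x in Set.Ioc (-c) c, F x = ∫ x, (fun x => if x ≤ c then F x else 0) |x| := by
    rw [← integral_Icc_eq_integral_Ioc, ← integral_indicator measurableSet_Icc]
    congr 1
    funext x
    by_cases h : |x| ≤ c
    · rw [Set.indicator_of_mem (show x ∈ Set.Icc (-c) c from abs_le.mp h)]
      simp [h, hF']
    · rw [Set.indicator_of_notMem (show ¬ x ∈ Set.Icc (-c) c from fun hx => h (abs_le.mpr hx))]
      simp [h]
  rw [h2, h1]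
  congr 1
  rw [← integral_indicator measurableSet_Ioi, ← integral_indicator measurableSet_Ioc]
  congr 1
  funext x
  by_cases h0 : 0 < x <;> by_cases h : x ≤ c <;> simp [Set.indicator, h0, h]

lemma even_IIc {F : ℝ → ℝ} (hF : ∀ x, F (-x) = F x) {c : ℝ} (hc : 0 < c) :
    ∫ x in (Set.Ioc (-c) c)ᶜ, F x = 2 * ∫ x in Set.Ioi c, F x := by
  have hF' : ∀ x, F |x| = F x := fun x => by
    rcases abs_choice x with h | h <;> rw [h]
    exact hF x
  have h1 := integral_comp_abs (f := fun x => if x ≤ c then 0 else F x)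
  have h2 : ∫ x in (Set.Ioc (-c) c)ᶜ, F x = ∫ x, (fun x => if x ≤ c then 0 else F x) |x| := by
    rw [setIntegral_congr_set (Ioc_ae_eq_Icc (μ := volume)).compl, ← integral_indicator measurableSet_Icc.compl]
    congr 1
    funext x
    by_cases h : |x| ≤ c
    · rw [Set.indicator_of_notMem (by simpa using abs_le.mp h)]
      simp [h]
    · rw [Set.indicator_of_mem (show x ∈ (Set.Icc (-c) c)ᶜ from fun hx => h (abs_le.mpr hx))]
      simp [h, hF']
  rw [h2, h1]
  congr 1
  rw [← integral_indicator measurableSet_Ioi, ← integral_indicator measurableSet_Ioi]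
  congr 1
  funext x
  by_cases h0 : 0 < x <;> by_cases h : x ≤ c <;> simp [Set.indicator, h0, h]
  · intro h3; linarith

noncomputable def GG (ε x : ℝ) : ℝ := f ε x ^ 2 - 1 / |x|

noncomputable def C0 (ε : ℝ) : ℝ := 2 * ∫ x in (0:ℝ)..(1/2), GG ε x

lemma ii_inv_sqrt (a b : ℝ) (ha : 0 ≤ a) (hb : 0 ≤ b) : IntervalIntegrable (fun x : ℝ => 1 / √|x|) volume a b := by
  have h := intervalIntegral.intervalIntegrable_rpow' (a := a) (b := b) (r := -(1/2:ℝ)) (by norm_num)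
  refine h.congr_uIoo ?_
  intro x hx
  have : 0 < x := lt_of_le_of_lt (le_min ha hb) hx.1
  show x ^ (-(1/2:ℝ)) = 1 / √|x|
  rw [abs_of_pos this, inv_sqrt_rpow this]

lemma ii_GG {ε : ℝ} (he : ε = 1 ∨ ε = -1) : IntervalIntegrable (GG ε) volume 0 (1/2) := by
  have hb : IntervalIntegrable (fun x : ℝ => (KU + 2) * (KU + 2) + 2 * (KU + 2) * (1 / √|x|)) volume 0 (1/2) :=
    intervalIntegrable_const.add ((ii_inv_sqrt 0 (1/2) le_rfl (by norm_num)).const_mul _)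
  refine hb.mono_fun ?_ ?_
  · have : Measurable (GG ε) := ((measurable_f he).pow_const 2).sub (measurable_const.div measurable_id.abs)
    exact this.aestronglyMeasurable
  · refine (ae_restrict_iff' measurableSet_uIoc).mpr (Filter.Eventually.of_forall fun x hx => ?_)
    rw [Set.uIoc_of_le (by norm_num)] at hx
    have hx0 := hx.1
    have h1 := f_ker he hx0.ne' (by rw [abs_of_pos hx0]; exact hx.2)
    have h2 := ker_abs he x
    have h3 : GG ε x = (f ε x - ker ε x) * (f ε x - ker ε x) + 2 * (f ε x - ker ε x) * ker ε x := by
      rw [GG, ← ker_sq he x]; ring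
    have hK := KU_nonneg
    have hs : 0 ≤ 1 / √|x| := by positivity
    beta_reduce
    rw [Real.norm_eq_abs, Real.norm_eq_abs, h3]
    refine (abs_add_le _ _).trans (le_trans ?_ (le_abs_self _))
    rw [abs_mul, abs_mul, abs_mul, h2, abs_two]
    gcongr

lemma ii_uu0 {ε : ℝ} (he : ε = 1 ∨ ε = -1) {V : ℝ} (hV : 0 < V) {b : ℝ} (hb : 0 ≤ b) :
    IntervalIntegrable (uu ε V) volume 0 b := by
  refine ((ii_inv_sqrt 0 b le_rfl hb).const_mul (1632/√V)).mono_fun ?_ ?_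
  · have : Measurable (uu ε V) := by
      unfold uu
      exact (measurable_const.div measurable_id.abs).sub ((measurable_tau he V).pow_const 2)
    exact this.aestronglyMeasurable
  · refine (ae_restrict_iff' measurableSet_uIoc).mpr (Filter.Eventually.of_forall fun x hx => ?_)
    rw [Set.uIoc_of_le hb] at hx
    have := uu_bd he hV hx.1.ne'
    beta_reduce
    rw [Real.norm_eq_abs, Real.norm_eq_abs]
    exact this.trans (le_abs_self _)

noncomputable def Kp : ℝ := ∫ x in (0:ℝ)..1, 1 / √|x|

lemma uu01 {ε : ℝ} (he : ε = 1 ∨ ε = -1) {V : ℝ} (hV : 0 < V) :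
    |∫ x in (0:ℝ)..1, uu ε V x| ≤ 1632/√V * Kp := by
  rw [Kp, ← intervalIntegral.integral_const_mul]
  have := intervalIntegral.norm_integral_le_of_norm_le (μ := volume) (f := uu ε V) (g := fun x => 1632/√V * (1/√|x|)) (a := 0) (b := 1)
    zero_le_one (Filter.Eventually.of_forall fun x hx => by
      rw [Real.norm_eq_abs]; exact uu_bd he hV hx.1.ne')
    ((ii_inv_sqrt 0 1 le_rfl (by norm_num)).const_mul _)
  exact this

lemma scale_GG {ε : ℝ} {d : ℝ} (hd : 0 < d) : ∀ x, fd ε d x ^ 2 - 1/|x| = d⁻¹ * GG ε (x/d) := by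
  intro x
  unfold fd GG
  rw [div_pow, Real.sq_sqrt hd.le, abs_div, abs_of_pos hd, one_div_div]
  by_cases hx : |x| = 0
  · rw [hx]; simp; ring
  · field_simp

lemma main_int {ε : ℝ} (he : ε = 1 ∨ ε = -1) {d V : ℝ} (hd : 0 < d) (hV : 0 < V) :
    ((∫ x in II d, (fd ε d x^2 - tau ε V x^2)) - ∫ x in (II d)ᶜ, tau ε V x^2)
      = C0 ε + 2 * Real.log (d/2) + 2 * (∫ x in (0:ℝ)..1, uu ε V x) - 2 * ∫ x in Set.Ioi 1, tau ε V x^2 := by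
  have hd2 : 0 < d/2 := by positivity
  have ev1 : ∀ x, tau ε V (-x)^2 = tau ε V x^2 := fun x => by
    rw [tau_neg he, mul_pow, sq, sq_he he, one_mul]
  have ev2 : ∀ x, fd ε d (-x)^2 = fd ε d x^2 := fun x => by
    unfold fd
    rw [neg_div, f_neg he, div_pow, mul_pow, sq ε, sq_he he, one_mul, div_pow]
  unfold II
  rw [even_II (F := fun x => fd ε d x^2 - tau ε V x^2) (fun x => by simp only [ev1, ev2]) hd2,
    even_IIc (F := fun x => tau ε V x^2) ev1 hd2, ← intervalIntegral.integral_of_le hd2.le]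
  have hI1 : IntervalIntegrable (fun x => GG ε (x/d)) volume 0 (d/2) := by
    have := IntervalIntegrable.comp_mul_right (ii_GG he) (c := d⁻¹)
    simpa [show 2⁻¹ * d = d/2 by ring, div_eq_mul_inv, mul_comm] using this
  have e1 : ∫ x in (0:ℝ)..(d/2), (fd ε d x^2 - tau ε V x^2)
      = (∫ x in (0:ℝ)..(d/2), d⁻¹ * GG ε (x/d)) + ∫ x in (0:ℝ)..(d/2), uu ε V x := by
    rw [← intervalIntegral.integral_add (hI1.const_mul _) (ii_uu0 he hV hd2.le)]
    congr 1
    funext x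
    rw [← scale_GG hd, uu]; ring
  have e2 : (∫ x in (0:ℝ)..(d/2), d⁻¹ * GG ε (x/d)) = ∫ x in (0:ℝ)..(1/2), GG ε x := by
    rw [intervalIntegral.integral_const_mul, intervalIntegral.integral_comp_div _ hd.ne', smul_eq_mul,
      ← mul_assoc, inv_mul_cancel₀ hd.ne', one_mul]
    congr 1
    · simp
    · field_simp
  have e3 : ∫ x in (0:ℝ)..(d/2), uu ε V x = (∫ x in (0:ℝ)..1, uu ε V x) + ∫ x in (1:ℝ)..(d/2), uu ε V x :=
    (intervalIntegral.integral_add_adjacent_intervals (ii_uu0 he hV zero_le_one) (ii_uu he V one_pos hd2)).symm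
  have e4 := int_uu he V one_pos hd2
  have e5 : (∫ x in (1:ℝ)..(d/2), tau ε V x^2) + ∫ x in Set.Ioi (d/2), tau ε V x^2 = ∫ x in Set.Ioi 1, tau ε V x^2 := by
    refine intervalIntegral.integral_interval_add_Ioi ?_ ?_
    · exact integrableOn_tau_sq he hV one_pos measurableSet_Ioi (fun x hx => (le_of_lt hx).trans (le_abs_self _))
    · exact integrableOn_tau_sq he hV hd2 measurableSet_Ioi (fun x hx => (le_of_lt hx).trans (le_abs_self _))
  rw [e1, e2, e3, C0]
  rw [div_one] at e4
  linarith

noncomputable def KM : ℝ := 1024 + 9000 * K3 + 3264 * Kp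

lemma main_term {ε : ℝ} (he : ε = 1 ∨ ε = -1) {m : ℕ} (hm : 0 < m) {d V : ℝ} (hd : 0 < d) (hV : V = d * m) (hV1 : 1 ≤ V)
    {A X : ℝ} (hA : HasSum (fun n : ℤ => tau ε V n^2) A) (hX : HasSum (Phi0 ε V d) X) :
    |A + X - (C0 ε + 2 * Real.log (d/2) + 2 * Real.eulerMascheroniConstant)| ≤ KM / √V := by
  have hV0 : 0 < V := by linarith
  have h1 := (Phi_fold he hm hd hV).unique hX
  rw [main_int he hd hV0] at h1
  obtain ⟨S, hS, hA2⟩ := sum_tau_sq he hA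
  have h2 := gamma_lim he hV0 hS
  have h3 := uu01 he hV0
  have h4 : tau ε V 0 ^ 2 ≤ 1024 / √V := by
    have : tau ε V 0 = - bb ε V 0 := by simp [tau, ker]
    have h5 := bb_bd he hV0 0
    have h6 : 1 ≤ √V := by rw [Real.one_le_sqrt]; exact hV1
    rw [this, neg_sq, ← sq_abs]
    calc |bb ε V 0| ^ 2 ≤ (32/√V)^2 := by gcongr
      _ = 1024 / √V * (1/√V) := by rw [div_pow]; field_simp; norm_num
      _ ≤ 1024 / √V * 1 := by
        gcongr
        rw [div_le_one (by positivity)]; exact h6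
      _ = _ := by ring
  have e : KM / √V = 1024/√V + 2 * (4500/√V*K3) + 2 * (1632/√V*Kp) := by unfold KM; ring
  rw [e]
  have h0 := sq_nonneg (tau ε V 0)
  rw [abs_le] at h2 h3 ⊢
  constructor <;> linarith
end TTR

namespace TTR
open MeasureTheory

lemma int_lin (r a b : ℝ) : ∫ x in r..(r+1), (a + (x - r) * b) = a + b / 2 := by
  have h : ∀ x ∈ Set.uIcc r (r+1), HasDerivAt (fun x : ℝ => a * x + (x - r)^2 / 2 * b) (a + (x - r) * b) x := by
    intro x _
    have h1 := ((hasDerivAt_id x).sub_const r).pow 2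
    have h2 := ((hasDerivAt_id x).const_mul a).add ((h1.div_const 2).mul_const b)
    refine h2.congr_deriv ?_
    simp
  rw [intervalIntegral.integral_eq_sub_of_hasDerivAt h
    ((by fun_prop : Continuous fun x : ℝ => (a + (x - r) * b)).intervalIntegrable _ _)]
  ring

lemma ii_of_cont {p : ℝ → ℝ} (hp : ContinuousOn p (Set.Ici 0)) {a b : ℝ} (ha : 0 ≤ a) (hb : 0 ≤ b) :
    IntervalIntegrable p volume a b :=
  (hp.mono (fun x hx => (le_min ha hb).trans hx.1)).intervalIntegrable

lemma cell_lower {p : ℝ → ℝ} (hc : ConcaveOn ℝ (Set.Ici 0) p) (hp : ContinuousOn p (Set.Ici 0)) {r : ℝ} (hr : 0 ≤ r) :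
    (p r + p (r+1)) / 2 ≤ ∫ x in r..(r+1), p x := by
  have h1 := int_lin r (p r) (p (r+1) - p r)
  have h2 : (p r + p (r+1)) / 2 = p r + (p (r+1) - p r) / 2 := by ring
  rw [h2, ← h1]
  refine intervalIntegral.integral_mono_on (by linarith)
    ((by fun_prop : Continuous fun x : ℝ => (p r + (x - r) * (p (r+1) - p r))).intervalIntegrable _ _)
    (ii_of_cont hp hr (by linarith)) ?_
  intro x hx
  have h3 := hc.2 (show r ∈ Set.Ici 0 from hr) (show r + 1 ∈ Set.Ici 0 from by simp; linarith)
    (show 0 ≤ 1 - (x - r) by linarith [hx.2]) (show 0 ≤ x - r by linarith [hx.1]) (by ring)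
  simp only [smul_eq_mul] at h3
  rw [show (1 - (x - r)) * r + (x - r) * (r + 1) = x by ring] at h3
  linarith

lemma cell_upper {p : ℝ → ℝ} (hc : ConcaveOn ℝ (Set.Ici 0) p) (hp : ContinuousOn p (Set.Ici 0)) {r : ℝ} (hr : 0 ≤ r) :
    ∫ x in (r+1)..(r+1+1), p x ≤ p (r+1) + (p (r+1) - p r) / 2 := by
  rw [← int_lin (r+1)]
  refine intervalIntegral.integral_mono_on (by linarith)
    (ii_of_cont hp (by linarith) (by linarith))
    ((by fun_prop : Continuous fun x : ℝ => (p (r+1) + (x - (r+1)) * (p (r+1) - p r))).intervalIntegrable _ _) ?_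
  intro x hx
  have hx1 := hx.1
  have hs : 0 < x - r := by linarith
  have h3 := hc.2 (show r ∈ Set.Ici 0 from hr) (show x ∈ Set.Ici 0 from by simp; linarith)
    (show 0 ≤ (x - r - 1) / (x - r) from div_nonneg (by linarith) hs.le) (show 0 ≤ 1 / (x - r) by positivity)
    (by field_simp; ring)
  simp only [smul_eq_mul] at h3
  rw [show (x - r - 1) / (x - r) * r + 1 / (x - r) * x = r + 1 by field_simp; ring] at h3
  have h4 : (x - r - 1) / (x - r) * p r + 1 / (x - r) * p x = ((x - r - 1) * p r + p x) / (x - r) := by ring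
  rw [h4, div_le_iff₀ hs] at h3
  linarith

lemma trap_aux {p : ℝ → ℝ} (hc : ConcaveOn ℝ (Set.Ici 0) p) (hm : MonotoneOn p (Set.Ici 0))
    (hp : ContinuousOn p (Set.Ici 0)) (N : ℕ) :
    (∑ r ∈ range (N+1), p r) + (p (N+1) - p 0) / 2 ≤ ∫ x in (0:ℝ)..(N+1), p x ∧
    ∫ x in (0:ℝ)..(N+1), p x ≤ (∑ r ∈ range (N+1), p r) + (p (N+1) - p 0) / 2 + (p 1 - p 0) - (p (N+1) - p N) / 2 := by
  induction N with
  | zero =>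
    constructor
    · have := cell_lower hc hp (r := 0) le_rfl
      simp at this ⊢
      linarith
    · have h : ∫ x in (0:ℝ)..1, p x ≤ ∫ x in (0:ℝ)..1, p 1 := by
        refine intervalIntegral.integral_mono_on (by norm_num) (ii_of_cont hp le_rfl zero_le_one)
          intervalIntegrable_const ?_
        intro x hx
        exact hm hx.1 (by simp) hx.2
      simp at h ⊢
      linarith
  | succ N ih =>
    have hN : (0:ℝ) ≤ N := Nat.cast_nonneg N
    have h1 := cell_lower hc hp (r := (N:ℝ)+1) (by linarith)
    have h2 := cell_upper hc hp hN
    have h3 : ∫ x in (0:ℝ)..(N+1+1), p x = (∫ x in (0:ℝ)..(N+1), p x) + ∫ x in ((N:ℝ)+1)..(N+1+1), p x :=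
      (intervalIntegral.integral_add_adjacent_intervals (ii_of_cont hp le_rfl (by linarith))
        (ii_of_cont hp (by linarith) (by linarith))).symm
    rw [sum_range_succ]
    push_cast
    rw [h3]
    constructor <;> linarith [ih.1, ih.2]

lemma trap {p : ℝ → ℝ} (hc : ConcaveOn ℝ (Set.Ici 0) p) (hm : MonotoneOn p (Set.Ici 0))
    (hp : ContinuousOn p (Set.Ici 0)) :
    Filter.Tendsto (fun N : ℕ => (∑ r ∈ range (N+1), p (r / ((N+1:ℕ):ℝ))) - ((N+1:ℕ):ℝ) * ∫ x in (0:ℝ)..1, p x)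
      Filter.atTop (nhds ((p 0 - p 1) / 2)) := by
  have h0 : Filter.Tendsto (fun N : ℕ => (p 0 - p 1)/2 - (p (1/((N:ℝ)+1)) - p 0)) Filter.atTop (nhds ((p 0 - p 1)/2 - (p 0 - p 0))) := by
    refine tendsto_const_nhds.sub (Filter.Tendsto.sub_const ?_ _)
    have h1 : Filter.Tendsto (fun N : ℕ => 1/((N:ℝ)+1)) Filter.atTop (nhdsWithin 0 (Set.Ici 0)) := by
      refine tendsto_nhdsWithin_iff.mpr ⟨tendsto_one_div_add_atTop_nhds_zero_nat, Filter.Eventually.of_forall fun n => ?_⟩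
      simp only [Set.mem_Ici]; positivity
    exact (hp 0 (by simp)).tendsto.comp h1
  rw [sub_self, sub_zero] at h0
  refine tendsto_of_tendsto_of_tendsto_of_le_of_le h0 tendsto_const_nhds ?_ ?_ <;> intro N <;> beta_reduce
  all_goals
    have hN : (0:ℝ) < (N:ℝ) + 1 := by positivity
    have hc' : ConcaveOn ℝ (Set.Ici 0) (fun x => p (x / ((N:ℝ)+1))) := by
      refine ⟨convex_Ici 0, ?_⟩
      intro x hx y hy a b ha hb hab
      have := hc.2 (show x/((N:ℝ)+1) ∈ Set.Ici 0 from div_nonneg hx hN.le) (show y/((N:ℝ)+1) ∈ Set.Ici 0 from div_nonneg hy hN.le) ha hb hab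
      simp only [smul_eq_mul] at this ⊢
      rw [show (a * x + b * y) / ((N:ℝ)+1) = a * (x/((N:ℝ)+1)) + b * (y/((N:ℝ)+1)) by ring]
      exact this
    have hm' : MonotoneOn (fun x => p (x / ((N:ℝ)+1))) (Set.Ici 0) := by
      intro x hx y hy hxy
      exact hm (div_nonneg hx hN.le) (div_nonneg hy hN.le) (by gcongr)
    have hp' : ContinuousOn (fun x => p (x / ((N:ℝ)+1))) (Set.Ici 0) :=
      hp.comp (by fun_prop) (fun x hx => div_nonneg hx hN.le)
    have key := trap_aux hc' hm' hp' N
    have hi : ∫ x in (0:ℝ)..((N:ℝ)+1), p (x/((N:ℝ)+1)) = ((N:ℝ)+1) * ∫ x in (0:ℝ)..1, p x := by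
      rw [intervalIntegral.integral_comp_div _ hN.ne', smul_eq_mul, zero_div, div_self hN.ne']
    rw [hi] at key
    simp only [div_self hN.ne', zero_div] at key
    push_cast
    have hmm : p (N/((N:ℝ)+1)) ≤ p 1 := hm (by simp; positivity) (by simp) (by rw [div_le_one hN]; linarith)
    obtain ⟨k1, k2⟩ := key
    linarith

lemma conc1 : ConcaveOn ℝ (Set.Ici 0) (fun x => Real.log (1 + √x)) ∧ MonotoneOn (fun x => Real.log (1 + √x)) (Set.Ici 0) ∧
    ContinuousOn (fun x => Real.log (1 + √x)) (Set.Ici 0) := by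
  have hp : ∀ x : ℝ, 0 < 1 + √x := fun x => by positivity
  have hd : ∀ x : ℝ, 0 < x → HasDerivAt (fun x => Real.log (1 + √x)) (1/(2*√x*(1+√x))) x := fun x hx => by
    have h := ((Real.hasDerivAt_sqrt hx.ne').const_add 1).log (hp x).ne'
    refine h.congr_deriv ?_
    have := hp x
    field_simp
  have hcont : ContinuousOn (fun x => Real.log (1 + √x)) (Set.Ici 0) :=
    (ContinuousOn.log (by fun_prop) (fun x _ => (hp x).ne'))
  refine ⟨AntitoneOn.concaveOn_of_deriv (convex_Ici 0) hcont ?_ ?_, ?_, hcont⟩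
  · rw [interior_Ici]; exact fun x hx => (hd x hx).differentiableAt.differentiableWithinAt
  · rw [interior_Ici]
    intro x hx y hy hxy
    have hx' : 0 < x := hx
    rw [(hd x hx).deriv, (hd y hy).deriv]
    gcongr
  · intro x hx y hy hxy
    have := hp x
    beta_reduce
    gcongr

lemma conc2 : ConcaveOn ℝ (Set.Ici 0) (fun x => Real.arctan √x) ∧ MonotoneOn (fun x => Real.arctan √x) (Set.Ici 0) ∧
    ContinuousOn (fun x => Real.arctan √x) (Set.Ici 0) := by
  have hd : ∀ x : ℝ, 0 < x → HasDerivAt (fun x => Real.arctan √x) (1/(2*√x*(1+x))) x := fun x hx => by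
    have h := (Real.hasDerivAt_sqrt hx.ne').arctan
    refine h.congr_deriv ?_
    rw [Real.sq_sqrt hx.le]
    field_simp
  have hcont : ContinuousOn (fun x => Real.arctan √x) (Set.Ici 0) := by fun_prop
  refine ⟨AntitoneOn.concaveOn_of_deriv (convex_Ici 0) hcont ?_ ?_, ?_, hcont⟩
  · rw [interior_Ici]; exact fun x hx => (hd x hx).differentiableAt.differentiableWithinAt
  · rw [interior_Ici]
    intro x hx y hy hxy
    have hx' : 0 < x := hx
    rw [(hd x hx).deriv, (hd y hy).deriv]
    gcongr
  · intro x hx y hy hxy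
    exact Real.arctan_strictMono.monotone (Real.sqrt_le_sqrt hxy)

lemma int1 : ∫ x in (0:ℝ)..1, Real.log (1 + √x) = 1/2 := by
  have hp : ∀ x : ℝ, 0 < 1 + √x := fun x => by positivity
  rw [intervalIntegral.integral_eq_sub_of_hasDerivAt_of_le (f := fun x => (x-1)*Real.log (1 + √x) + √x - x/2) zero_le_one ?_ ?_
    (ii_of_cont conc1.2.2 le_rfl zero_le_one)]
  · simp; norm_num
  · have : ContinuousOn (fun x : ℝ => Real.log (1 + √x)) (Set.Icc 0 1) := conc1.2.2.mono (fun x hx => hx.1)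
    fun_prop
  · intro x hx
    have hx0 := hx.1
    have h := ((Real.hasDerivAt_sqrt hx0.ne').const_add 1).log (hp x).ne'
    have h2 := ((((hasDerivAt_id x).sub_const 1).mul h).add (Real.hasDerivAt_sqrt hx0.ne')).sub ((hasDerivAt_id x).div_const 2)
    refine h2.congr_deriv ?_
    have h3 := hp x
    have h4 : 0 < √x := Real.sqrt_pos.mpr hx0
    have h5 : x - 1 = (√x - 1) * (1 + √x) := by nlinarith [Real.sq_sqrt hx0.le]
    simp only [id]
    rw [h5]
    field_simp
    ring

lemma int2 : ∫ x in (0:ℝ)..1, Real.arctan √x = π/2 - 1 := by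
  rw [intervalIntegral.integral_eq_sub_of_hasDerivAt_of_le (f := fun x => (x+1)*Real.arctan √x - √x) zero_le_one ?_ ?_
    (ii_of_cont conc2.2.2 le_rfl zero_le_one)]
  · simp; ring
  · fun_prop
  · intro x hx
    have hx0 := hx.1
    have h := (Real.hasDerivAt_sqrt hx0.ne').arctan
    have h2 := (((hasDerivAt_id x).add_const 1).mul h).sub (Real.hasDerivAt_sqrt hx0.ne')
    refine h2.congr_deriv ?_
    have h4 : 0 < √x := Real.sqrt_pos.mpr hx0
    simp only [id]
    rw [Real.sq_sqrt hx0.le]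
    field_simp
    ring

noncomputable def Psi (N : ℕ) : ℝ := ∑ n ∈ range N, Real.log (√n + √N)

lemma Psi_eq (N : ℕ) : Psi (N+1) = ((N+1:ℕ):ℝ)/2 * Real.log ((N+1:ℕ):ℝ) + ∑ r ∈ range (N+1), Real.log (1 + √(r / ((N+1:ℕ):ℝ))) := by
  have hN : (0:ℝ) < ((N+1:ℕ):ℝ) := by positivity
  have : ∀ r : ℕ, Real.log (√r + √((N+1:ℕ):ℝ)) = Real.log ((N+1:ℕ):ℝ) / 2 + Real.log (1 + √(r / ((N+1:ℕ):ℝ))) := by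
    intro r
    rw [← Real.log_sqrt hN.le, ← Real.log_mul (by positivity) (by positivity), Real.sqrt_div' _ hN.le]
    congr 1
    field_simp
    ring
  unfold Psi
  simp only [this, sum_add_distrib, sum_const, card_range, nsmul_eq_mul]
  ring

lemma limQ : Filter.Tendsto (fun N : ℕ => 4 * Psi (N+1) - 2 * Real.log ((N+1).factorial : ℝ) + Real.log ((N+1:ℕ):ℝ) - 4 * ((N+1:ℕ):ℝ))
    Filter.atTop (nhds (- Real.log (8 * π))) := by
  have h1 := trap conc1.1 conc1.2.1 conc1.2.2
  rw [int1] at h1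
  have h2 := (Stirling.tendsto_stirlingSeq_sqrt_pi.comp (Filter.tendsto_add_atTop_nat 1)).log (by positivity)
  have h3 := (h1.const_mul 4).sub (h2.const_mul 2)
  have e : 4 * ((Real.log (1 + √0) - Real.log (1 + √1)) / 2) - 2 * Real.log √π - Real.log 2 = - Real.log (8*π) := by
    rw [Real.log_sqrt pi_pos.le, Real.log_mul (by norm_num) pi_pos.ne', show (8:ℝ) = 2^3 by norm_num, Real.log_pow]
    simp
    norm_num
    ring
  rw [← e]
  refine (h3.sub_const (Real.log 2)).congr fun N => ?_
  have hN : (0:ℝ) < ((N+1:ℕ):ℝ) := by positivity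
  simp only [Function.comp]
  rw [Stirling.log_stirlingSeq_formula, Psi_eq, Real.log_mul (by norm_num) hN.ne', Real.log_div hN.ne' (Real.exp_pos 1).ne', Real.log_exp]
  ring

lemma limP : Filter.Tendsto (fun N : ℕ => 2 * (((N+1:ℕ):ℝ) * π - 2 * (∑ r ∈ range (N+1), Real.arctan √(r / ((N+1:ℕ):ℝ))) - π/2)  - 4 * ((N+1:ℕ):ℝ))
    Filter.atTop (nhds (- (π/2))) := by
  have h1 := trap conc2.1 conc2.2.1 conc2.2.2
  rw [int2] at h1
  have h3 := (h1.const_mul (-4)).sub_const π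
  have e : -4 * ((Real.arctan √0 - Real.arctan √1) / 2) - π = - (π/2) := by
    simp; ring
  rw [← e]
  refine h3.congr fun N => ?_
  ring
end TTR

namespace TTR
open MeasureTheory

/-- FTC for nonnegative derivatives. -/
lemma ftc_nonneg {F g : ℝ → ℝ} (hc : ContinuousOn F (Set.Icc 0 1))
    (hd : ∀ x ∈ Set.Ioo (0:ℝ) 1, HasDerivAt F (g x) x) (hg : ∀ x ∈ Set.Ioo (0:ℝ) 1, 0 ≤ g x) :
    IntervalIntegrable g volume 0 1 ∧ ∫ x in (0:ℝ)..1, g x = F 1 - F 0 := by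
  have hi : IntervalIntegrable g volume 0 1 := by
    refine intervalIntegral.intervalIntegrable_deriv_of_nonneg (g := F) ?_ ?_ ?_
    · rwa [Set.uIcc_of_le zero_le_one]
    · simpa using hd
    · simpa using hg
  exact ⟨hi, intervalIntegral.integral_eq_sub_of_hasDerivAt_of_le zero_le_one hc hd hi⟩

lemma sq_add_pos (n : ℕ) {x : ℝ} (hx : 0 < x) : 0 < √((n:ℝ) + x) := Real.sqrt_pos.mpr (by positivity)

lemma hd_sq (n : ℕ) {x : ℝ} (hx : 0 < x) : HasDerivAt (fun x : ℝ => √((n:ℝ) + x)) (1 / (2 * √((n:ℝ)+x))) x := by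
  have h := ((hasDerivAt_id x).const_add (n:ℝ)).sqrt (show (n:ℝ) + id x ≠ 0 by simp only [id]; positivity)
  exact h

lemma int_Z (N : ℕ) : IntervalIntegrable (Z N) volume 0 1 ∧ ∫ x in (0:ℝ)..1, Z N x = 2 * √N := by
  have h := ftc_nonneg (F := fun x => ∑ n ∈ range N, 2 * √((n:ℝ) + x)) (g := Z N) (by fun_prop) ?_ ?_
  · refine ⟨h.1, h.2.trans ?_⟩
    rw [← sum_sub_distrib]
    have := Finset.sum_range_sub (fun n : ℕ => 2 * √(n:ℝ)) N
    simp only [add_zero]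
    push_cast at this
    simpa using this
  · intro x hx
    refine HasDerivAt.fun_sum fun n _ => ?_
    refine ((hd_sq n hx.1).const_mul 2).congr_deriv ?_
    have := sq_add_pos n hx.1
    field_simp
  · intro x hx
    exact sum_nonneg fun n _ => by positivity

noncomputable def Lam (a b : ℝ) : ℝ := Real.log (√a + √b)

lemma int_Q (N : ℕ) : IntervalIntegrable (fun x => Z (N+1) x ^ 2 - 1/x) volume 0 1 ∧
    ∫ x in (0:ℝ)..1, (Z (N+1) x ^ 2 - 1/x) =
      4 * Psi (N+1) - 2 * Real.log ((N+1).factorial : ℝ) + Real.log ((N+1:ℕ):ℝ) := by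
  have hZ : ∀ x ∈ Set.Ioo (0:ℝ) 1, Z (N+1) x ^ 2 - 1/x = ∑ m ∈ range (N+1), ∑ n ∈ range (N+1),
      (if m = 0 ∧ n = 0 then 0 else (√((m:ℝ)+x))⁻¹ * (√((n:ℝ)+x))⁻¹) := by
    intro x hx
    have e : ∀ m n : ℕ, (if m = 0 ∧ n = 0 then 0 else (√((m:ℝ)+x))⁻¹ * (√((n:ℝ)+x))⁻¹)
      = (√((m:ℝ)+x))⁻¹ * (√((n:ℝ)+x))⁻¹ - (if m = 0 then (if n = 0 then 1/x else 0) else 0) := by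
      intro m n
      by_cases hm : m = 0 <;> by_cases hn : n = 0 <;> simp [hm, hn]
      rw [← mul_inv, Real.mul_self_sqrt hx.1.le, sub_self]
    simp only [e, sum_sub_distrib]
    rw [Z, sq, Finset.sum_mul_sum]
    simp
  have h := ftc_nonneg (F := fun x => ∑ m ∈ range (N+1), ∑ n ∈ range (N+1),
      (if m = 0 ∧ n = 0 then 0 else 2 * Lam ((m:ℝ) + x) (n + x))) (g := fun x => Z (N+1) x ^ 2 - 1/x) ?_ ?_ ?_
  · refine ⟨h.1, h.2.trans ?_⟩
    have e1 : ∀ m n : ℕ, (if m = 0 ∧ n = 0 then 0 else 2 * Lam ((m:ℝ) + 1) (n + 1))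
        = 2 * Lam ((m+1:ℕ):ℝ) ((n+1:ℕ):ℝ) - (if m = 0 then (if n = 0 then 2 * Real.log 2 else 0) else 0) := by
      intro m n
      by_cases hm : m = 0 <;> by_cases hn : n = 0 <;> simp [hm, hn, Lam]
      norm_num
    have e0 : ∀ m n : ℕ, (if m = 0 ∧ n = 0 then 0 else 2 * Lam ((m:ℝ) + 0) (n + 0))
        = 2 * Lam (m:ℝ) (n:ℝ) := by
      intro m n
      by_cases hm : m = 0 <;> by_cases hn : n = 0 <;> simp [hm, hn, Lam]
    simp only [e1, e0, sum_sub_distrib, ← Finset.mul_sum]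
    have tel : ∀ g : ℕ → ℝ, ∑ n ∈ range (N+1), g (n+1) = ∑ n ∈ range (N+1), g n + g (N+1) - g 0 := by
      intro g
      have := sum_range_succ' g (N+1)
      rw [sum_range_succ] at this
      linarith
    have t1 : ∀ m : ℕ, ∑ n ∈ range (N+1), Lam ((m+1:ℕ):ℝ) ((n+1:ℕ):ℝ) = _ :=
      fun m => tel (fun n => Lam ((m+1:ℕ):ℝ) (n:ℝ))
    simp only [t1, sum_sub_distrib, sum_add_distrib]
    have t2 := tel (fun m => ∑ n ∈ range (N+1), Lam (m:ℝ) (n:ℝ))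
    have t3 := tel (fun m => Lam (m:ℝ) ((N+1:ℕ):ℝ))
    beta_reduce at t2 t3
    rw [t2, t3]
    have s1 : ∑ n ∈ range (N+1), Lam ((N+1:ℕ):ℝ) (n:ℝ) = Psi (N+1) := by
      unfold Psi Lam
      exact sum_congr rfl fun n _ => by rw [add_comm]
    have s2 : ∑ n ∈ range (N+1), Lam (n:ℝ) ((N+1:ℕ):ℝ) = Psi (N+1) := rfl
    have s4 : ∀ M : ℕ, ∑ n ∈ range M, Lam ((n+1:ℕ):ℝ) ((0:ℕ):ℝ) = Real.log (M.factorial : ℝ) / 2 := by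
      intro M
      induction M with
      | zero => simp
      | succ M ih =>
        rw [sum_range_succ, ih, Nat.factorial_succ, Nat.cast_mul, Real.log_mul (by positivity) (by positivity), Lam]
        simp only [Nat.cast_zero, Real.sqrt_zero, add_zero]
        rw [Real.log_sqrt (by positivity)]; ring
    have s3 : ∑ n ∈ range (N+1), Lam ((0:ℕ):ℝ) (n:ℝ) = Real.log (N.factorial : ℝ) / 2 := by
      rw [sum_range_succ', ← s4]
      simp [Lam]
    have hN : (0:ℝ) < ((N+1:ℕ):ℝ) := by positivity
    have s5 : Lam ((N+1:ℕ):ℝ) ((N+1:ℕ):ℝ) = Real.log 2 + Real.log ((N+1:ℕ):ℝ) / 2 := by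
      rw [Lam, ← two_mul, Real.log_mul (by norm_num) (by positivity), Real.log_sqrt hN.le]
    have s6 : Lam ((0:ℕ):ℝ) ((N+1:ℕ):ℝ) = Real.log ((N+1:ℕ):ℝ) / 2 := by
      simp only [Lam, Nat.cast_zero, Real.sqrt_zero, zero_add]
      rw [Real.log_sqrt hN.le]
    have s7 : Real.log ((N+1).factorial : ℝ) = Real.log ((N+1:ℕ):ℝ) + Real.log (N.factorial : ℝ) := by
      rw [Nat.factorial_succ, Nat.cast_mul, Real.log_mul (by positivity) (by positivity)]
    have s8 : ∑ m ∈ range (N+1), ∑ n ∈ range (N+1), (if m = 0 then (if n = 0 then 2 * Real.log 2 else 0) else 0) = 2 * Real.log 2 := by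
      simp
    rw [s1, s2, s3, s4, s5, s6, s8]
    linarith
  · refine continuousOn_finsetSum _ fun m _ => continuousOn_finsetSum _ fun n _ => ?_
    by_cases hmn : m = 0 ∧ n = 0
    · simp [hmn]; exact continuousOn_const
    · simp only [hmn, if_false, Lam]
      refine continuousOn_const.mul (ContinuousOn.log (by fun_prop) fun x hx => ?_)
      have hx0 : 0 ≤ x := hx.1
      rcases not_and_or.mp hmn with h | h
      · have : (0:ℝ) < m := by exact_mod_cast Nat.pos_of_ne_zero h
        have : 0 < √((m:ℝ)+x) := Real.sqrt_pos.mpr (by linarith)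
        positivity
      · have : (0:ℝ) < n := by exact_mod_cast Nat.pos_of_ne_zero h
        have : 0 < √((n:ℝ)+x) := Real.sqrt_pos.mpr (by linarith)
        positivity
  · intro x hx
    rw [hZ x hx]
    refine HasDerivAt.fun_sum fun m _ => HasDerivAt.fun_sum fun n _ => ?_
    by_cases hmn : m = 0 ∧ n = 0
    · simp only [hmn, and_self, if_true]; exact hasDerivAt_const _ _
    · simp only [hmn, if_false, Lam]
      have a1 := sq_add_pos m hx.1
      have a2 := sq_add_pos n hx.1
      have := (((hd_sq m hx.1).add (hd_sq n hx.1)).log (by simp only [Pi.add_apply]; positivity)).const_mul 2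
      refine this.congr_deriv ?_
      simp only [Pi.add_apply]
      field_simp
      ring
  · intro x hx
    rw [hZ x hx]
    refine sum_nonneg fun m _ => sum_nonneg fun n _ => ?_
    split_ifs <;> positivity

noncomputable def Th (a b : ℝ) : ℝ := Real.arcsin √(a / (a + b))

lemma Th_arctan {a b : ℝ} (ha : 0 ≤ a) (hb : 0 < b) : Th a b = Real.arctan √(a/b) := by
  rw [Th, Real.arctan_eq_arcsin]
  congr 1
  rw [Real.sq_sqrt (by positivity), ← Real.sqrt_div' _ (by positivity)]
  congr 1
  field_simp
  ring

lemma Th_symm {a b : ℝ} (ha : 0 < a) (hb : 0 ≤ b) : Th a b = π/2 - Real.arctan √(b/a) := by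
  rcases hb.eq_or_lt with h | h
  · rw [← h, Th]; simp [ha.ne']
  · rw [Th_arctan ha.le h, ← inv_div b a, Real.sqrt_inv, Real.arctan_inv_of_pos (by positivity)]

lemma int_P (N : ℕ) : IntervalIntegrable (fun x => Z (N+1) x * Z (N+1) (1-x)) volume 0 1 ∧
    ∫ x in (0:ℝ)..1, (Z (N+1) x * Z (N+1) (1-x)) =
      2 * (((N+1:ℕ):ℝ) * π - 2 * (∑ r ∈ range (N+1), Real.arctan √(r / ((N+1:ℕ):ℝ))) - π/2) := by
  have h := ftc_nonneg (F := fun x => ∑ m ∈ range (N+1), ∑ n ∈ range (N+1),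
      2 * Th ((m:ℝ) + x) (n + (1 - x))) (g := fun x => Z (N+1) x * Z (N+1) (1-x)) ?_ ?_ ?_
  · refine ⟨h.1, h.2.trans ?_⟩
    simp only [sub_self, sub_zero, add_zero, ← Finset.mul_sum]
    have tel : ∀ g : ℕ → ℝ, ∑ n ∈ range (N+1), g (n+1) = ∑ n ∈ range (N+1), g n + g (N+1) - g 0 := by
      intro g
      have := sum_range_succ' g (N+1)
      rw [sum_range_succ] at this
      linarith
    have t2 := tel (fun m => ∑ n ∈ range (N+1), Th (m:ℝ) (n:ℝ))
    have t1 : ∀ m : ℕ, ∑ n ∈ range (N+1), Th (m:ℝ) ((n+1:ℕ):ℝ) = _ :=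
      fun m => tel (fun n => Th (m:ℝ) (n:ℝ))
    have hN : (0:ℝ) < ((N+1:ℕ):ℝ) := by positivity
    have c1 : ∑ m ∈ range (N+1), ∑ n ∈ range (N+1), Th ((m:ℝ)+1) (n:ℝ) = ∑ m ∈ range (N+1), ∑ n ∈ range (N+1), Th ((m+1:ℕ):ℝ) (n:ℝ) := by
      push_cast; rfl
    have c2 : ∑ m ∈ range (N+1), ∑ n ∈ range (N+1), Th (m:ℝ) ((n:ℝ)+1) = ∑ m ∈ range (N+1), ∑ n ∈ range (N+1), Th (m:ℝ) ((n+1:ℕ):ℝ) := by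
      push_cast; rfl
    rw [c1, c2]
    simp only [t1, sum_sub_distrib, sum_add_distrib]
    beta_reduce at t2
    rw [t2]
    have s1 : ∑ n ∈ range (N+1), Th ((N+1:ℕ):ℝ) (n:ℝ) = ((N+1:ℕ):ℝ) * (π/2) - ∑ r ∈ range (N+1), Real.arctan √(r / ((N+1:ℕ):ℝ)) := by
      simp only [fun n : ℕ => Th_symm hN (Nat.cast_nonneg n), sum_sub_distrib, sum_const, card_range, nsmul_eq_mul]
    have s2 : ∑ n ∈ range (N+1), Th (n:ℝ) ((N+1:ℕ):ℝ) = ∑ r ∈ range (N+1), Real.arctan √(r / ((N+1:ℕ):ℝ)) :=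
      sum_congr rfl fun n _ => Th_arctan (Nat.cast_nonneg n) hN
    have s3 : ∑ n ∈ range (N+1), Th ((0:ℕ):ℝ) (n:ℝ) = 0 := by simp [Th]
    have s4 : ∑ n ∈ range (N+1), Th (n:ℝ) ((0:ℕ):ℝ) = (N:ℝ) * (π/2) := by
      rw [sum_range_succ']
      have : ∀ n : ℕ, Th ((n+1:ℕ):ℝ) ((0:ℕ):ℝ) = π/2 := fun n => by
        rw [Th_symm (by positivity) (by simp)]; simp
      simp only [this]
      simp [Th]
    rw [s1, s2, s3, s4]
    push_cast
    ring
  · refine continuousOn_finsetSum _ fun m _ => continuousOn_finsetSum _ fun n _ => ?_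
    have e : ∀ x : ℝ, Th ((m:ℝ)+x) (n + (1-x)) = Real.arcsin √(((m:ℝ)+x)/((m:ℝ)+n+1)) := fun x => by
      rw [Th]; congr 3; ring
    simp only [e]
    refine continuousOn_const.mul (Real.continuous_arcsin.comp_continuousOn ?_)
    fun_prop
  · intro x hx
    rw [Z, Z, Finset.sum_mul_sum]
    refine HasDerivAt.fun_sum fun m _ => HasDerivAt.fun_sum fun n _ => ?_
    have e : ∀ x : ℝ, Th ((m:ℝ)+x) (n + (1-x)) = Real.arcsin √(((m:ℝ)+x)/((m:ℝ)+n+1)) := fun x => by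
      rw [Th]; congr 3; ring
    simp only [e]
    have hx0 := hx.1
    have hx1 : 0 < 1 - x := by linarith [hx.2]
    have hm : (0:ℝ) < m + x := by positivity
    have hn : (0:ℝ) < n + (1 - x) := by positivity
    have hs : (0:ℝ) < m + n + 1 := by positivity
    have hu1 : ((m:ℝ)+x)/((m:ℝ)+n+1) < 1 := by rw [div_lt_one hs]; linarith
    have hu0 : 0 < ((m:ℝ)+x)/((m:ℝ)+n+1) := by positivity
    have d1 : HasDerivAt (fun x : ℝ => √(((m:ℝ)+x)/((m:ℝ)+n+1))) _ x := HasDerivAt.sqrt (((hasDerivAt_id x).const_add (m:ℝ)).div_const ((m:ℝ)+n+1)) hu0.ne'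
    have hlt : √(((m:ℝ)+x)/((m:ℝ)+n+1)) < 1 := by rw [Real.sqrt_lt' one_pos]; simpa using hu1
    have d2 := (Real.hasDerivAt_arcsin (x := √(((m:ℝ)+x)/((m:ℝ)+n+1))) (by linarith [Real.sqrt_nonneg (((m:ℝ)+x)/((m:ℝ)+n+1))]) hlt.ne)
    have d3 := (HasDerivAt.comp x d2 d1).const_mul 2
    refine d3.congr_deriv ?_
    rw [Real.sq_sqrt hu0.le, show 1 - ((m:ℝ)+x)/((m:ℝ)+n+1) = (n+(1-x))/((m:ℝ)+n+1) by field_simp; ring]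
    rw [Real.sqrt_div' _ hs.le, Real.sqrt_div' _ hs.le]
    have a1 : 0 < √((m:ℝ)+x) := Real.sqrt_pos.mpr hm
    have a2 : 0 < √((n:ℝ)+(1-x)) := Real.sqrt_pos.mpr hn
    have a3 : 0 < √((m:ℝ)+n+1) := Real.sqrt_pos.mpr hs
    field_simp
    rw [Real.sq_sqrt hs.le]
  · intro x hx
    exact mul_nonneg (sum_nonneg fun n _ => by positivity) (sum_nonneg fun n _ => by positivity)
end TTR

namespace TTR
open MeasureTheory

noncomputable def HN (ε : ℝ) (N : ℕ) (x : ℝ) : ℝ := gN ε (N+1) x ^ 2 - 1/x - 1/(1-x)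

lemma flip_ii {g : ℝ → ℝ} (h : IntervalIntegrable g volume 0 1) :
    IntervalIntegrable (fun x => g (1-x)) volume 0 1 := by
  have := h.comp_sub_left 1
  simpa using this.symm

lemma flip_int (g : ℝ → ℝ) : ∫ x in (0:ℝ)..1, g (1-x) = ∫ x in (0:ℝ)..1, g x := by
  rw [intervalIntegral.integral_comp_sub_left]; simp

lemma int_HN {ε : ℝ} (he : ε = 1 ∨ ε = -1) (N : ℕ) : ∫ x in (0:ℝ)..1, HN ε N x =
    2 * (4 * Psi (N+1) - 2 * Real.log ((N+1).factorial : ℝ) + Real.log ((N+1:ℕ):ℝ) - 4 * ((N+1:ℕ):ℝ)) +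
    2 * ε * (2 * (((N+1:ℕ):ℝ) * π - 2 * (∑ r ∈ range (N+1), Real.arctan √(r / ((N+1:ℕ):ℝ))) - π/2)  - 4 * ((N+1:ℕ):ℝ)) := by
  obtain ⟨z1, z2⟩ := int_Z (N+1)
  obtain ⟨q1, q2⟩ := int_Q N
  obtain ⟨p1, p2⟩ := int_P N
  rw [← q2, ← p2]
  have hN : (0:ℝ) < ((N+1:ℕ):ℝ) := by positivity
  generalize hs : √((N+1:ℕ):ℝ) = s at z2
  have hs2 : ((N+1:ℕ):ℝ) = s^2 := by rw [← hs, Real.sq_sqrt hN.le]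
  have z3 := flip_ii z1
  have q3 := flip_ii q1
  have fz := flip_int (Z (N+1))
  have fq := flip_int (fun x => Z (N+1) x ^ 2 - 1/x)
  have e : ∀ x, HN ε N x = ((Z (N+1) x ^ 2 - 1/x) + (Z (N+1) (1-x) ^ 2 - 1/(1-x))) +
      (2*ε*(Z (N+1) x * Z (N+1) (1-x)) + ((-4*s*(1+ε)) * (Z (N+1) x + Z (N+1) (1-x)) + (8*(1+ε)*s^2))) := by
    intro x
    unfold HN gN
    rw [hs]
    have := sq_he he
    linear_combination (Z (N+1) (1-x) - 2*s)^2 * this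
  simp only [e]
  have i1 := q1.add q3
  have i2 := z1.add z3
  have i3 := i2.const_mul (-4*s*(1+ε))
  have i4 := i3.add (intervalIntegrable_const (c := 8*(1+ε)*s^2) (μ := volume) (a := 0) (b := 1))
  have i5 := p1.const_mul (2*ε)
  have e1 := intervalIntegral.integral_add i1 (i5.add i4)
  have e2 := intervalIntegral.integral_add q1 q3
  have e3 := intervalIntegral.integral_add i5 i4
  have e4 := intervalIntegral.integral_add i3 (intervalIntegrable_const (c := 8*(1+ε)*s^2) (μ := volume) (a := 0) (b := 1))
  have e5 := intervalIntegral.integral_add z1 z3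
  beta_reduce at e1 e2 e3 e4 e5 fq fz
  rw [e1, e2, e3, e4, intervalIntegral.integral_const_mul, intervalIntegral.integral_const_mul, e5, fq, fz, z2, hs2]
  simp only [intervalIntegral.integral_const, smul_eq_mul]
  ring

lemma sq_bound {x : ℝ} (hx : x ∈ Set.Ioo (0:ℝ) 1) : 1/√x * (1/√(1-x)) ≤ 2 * (1/√x) + 2 * (1/√(1-x)) := by
  have h0 := hx.1
  have h1 : 0 < 1 - x := by linarith [hx.2]
  have a : 0 < 1/√x := by have := Real.sqrt_pos.mpr h0; positivity
  have b : 0 < 1/√(1-x) := by have := Real.sqrt_pos.mpr h1; positivity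
  rcases le_total (1/2) x with h | h
  · have : 1/√x ≤ 2 := by
      rw [div_le_iff₀ (Real.sqrt_pos.mpr h0)]
      have : 1/2 ≤ √x := by rw [Real.le_sqrt' (by norm_num)]; norm_num; linarith
      linarith
    nlinarith
  · have : 1/√(1-x) ≤ 2 := by
      rw [div_le_iff₀ (Real.sqrt_pos.mpr h1)]
      have : 1/2 ≤ √(1-x) := by rw [Real.le_sqrt' (by norm_num)]; norm_num; linarith
      linarith
    nlinarith

lemma HN_bd {ε : ℝ} (he : ε = 1 ∨ ε = -1) {g x : ℝ} (hx : x ∈ Set.Ioo (0:ℝ) 1) {K : ℝ} (hK : 0 ≤ K)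
    (hg : |g - ker ε x - ker ε (x-1)| ≤ K) :
    |g^2 - 1/x - 1/(1-x)| ≤ (4 + 2*K) * (1/√x + 1/√(1-x)) + K^2 := by
  have h0 := hx.1
  have h1 : 0 < 1 - x := by linarith [hx.2]
  have k1 := ker_abs he x
  have k2 := ker_abs he (x-1)
  have s1 := ker_sq he x
  have s2 := ker_sq he (x-1)
  rw [abs_of_pos h0] at k1 s1
  rw [abs_sub_comm, abs_of_pos h1] at k2 s2
  have hb := sq_bound hx
  rw [← k1, ← k2] at hb ⊢
  rw [← s1, ← s2]
  generalize ker ε x = a at *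
  generalize ker ε (x-1) = b at *
  generalize hr : g - a - b = r at *
  have e : g^2 - a^2 - b^2 = 2 * (a * b) + (2 * a * r + 2 * b * r) + r^2 := by
    rw [← hr]; ring
  rw [e]
  have t1 : |2 * (a*b)| ≤ 2 * (2 * |a| + 2 * |b|) := by rw [abs_mul, abs_mul, abs_two]; linarith
  have t2 : |2 * a * r| ≤ 2 * |a| * K := by rw [abs_mul, abs_mul, abs_two]; gcongr
  have t3 : |2 * b * r| ≤ 2 * |b| * K := by rw [abs_mul, abs_mul, abs_two]; gcongr
  have t4 : |r^2| ≤ K^2 := by rw [abs_pow]; gcongr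
  have u1 := abs_add_le (2 * (a * b) + (2 * a * r + 2 * b * r)) (r^2)
  have u2 := abs_add_le (2 * (a * b)) (2 * a * r + 2 * b * r)
  have u3 := abs_add_le (2 * a * r) (2 * b * r)
  linarith

lemma ii_bd (K : ℝ) : IntervalIntegrable (fun x : ℝ => (4 + 2*K) * (1/√x + 1/√(1-x)) + K^2) volume 0 1 := by
  have h : IntervalIntegrable (fun x : ℝ => 1/√x) volume 0 1 := by
    refine (ii_inv_sqrt 0 1 le_rfl zero_le_one).congr_uIoo ?_
    intro x hx
    have : 0 < x := by simpa using hx.1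
    show 1/√|x| = 1/√x
    rw [abs_of_pos this]
  exact ((h.add (flip_ii h)).const_mul _).add intervalIntegrable_const

noncomputable def HL (ε x : ℝ) : ℝ := f ε x ^ 2 - 1/x - 1/(1-x)

lemma meas_HN (ε : ℝ) (N : ℕ) : Measurable (HN ε N) := by
  unfold HN gN Z
  fun_prop

lemma meas_HL {ε : ℝ} (he : ε = 1 ∨ ε = -1) : Measurable (HL ε) := by
  have := measurable_f he
  unfold HL
  fun_prop

lemma ae_Ioo01 : ∀ᵐ x : ℝ, x ∈ Set.uIoc (0:ℝ) 1 → x ∈ Set.Ioo (0:ℝ) 1 := by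
  have : ∀ᵐ x : ℝ, x ≠ 1 := by simp [ae_iff]
  filter_upwards [this] with x h1 hx
  rw [Set.uIoc_of_le zero_le_one] at hx
  exact ⟨hx.1, lt_of_le_of_ne hx.2 h1⟩

lemma ii_HL {ε : ℝ} (he : ε = 1 ∨ ε = -1) : IntervalIntegrable (HL ε) volume 0 1 := by
  refine (ii_bd KU).mono_fun (meas_HL he).aestronglyMeasurable ?_
  refine (ae_restrict_iff' measurableSet_uIoc).mpr ?_
  filter_upwards [ae_Ioo01] with x hx1 hx
  have := HN_bd he (hx1 hx) KU_nonneg (f_bdd he (hx1 hx))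
  rw [Real.norm_eq_abs, Real.norm_eq_abs]
  exact this.trans (le_abs_self _)

lemma int_HL {ε : ℝ} (he : ε = 1 ∨ ε = -1) : ∫ x in (0:ℝ)..1, HL ε x = - 2 * Real.log (8 * π) - ε * π := by
  have h1 : Filter.Tendsto (fun N => ∫ x in (0:ℝ)..1, HN ε N x) Filter.atTop (nhds (∫ x in (0:ℝ)..1, HL ε x)) := by
    refine intervalIntegral.tendsto_integral_filter_of_dominated_convergence _ ?_ ?_ (ii_bd (KU+4)) ?_
    · exact Filter.Eventually.of_forall fun N => (meas_HN ε N).aestronglyMeasurable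
    · refine Filter.Eventually.of_forall fun N => ?_
      filter_upwards [ae_Ioo01] with x hx1 hx
      exact HN_bd he (hx1 hx) (by linarith [KU_nonneg]) (gN_bdd he (hx1 hx) (by omega))
    · filter_upwards [ae_Ioo01] with x hx1 hx
      have := (gN_tendsto he (hx1 hx)).comp (Filter.tendsto_add_atTop_nat 1)
      exact ((this.pow 2).sub_const _).sub_const _
  have h2 := (limQ.const_mul 2).add (limP.const_mul (2*ε))
  have h3 := h2.congr (fun N => (int_HN he N).symm)
  rw [tendsto_nhds_unique h1 h3]
  ring

lemma C0_eq {ε : ℝ} (he : ε = 1 ∨ ε = -1) : C0 ε = - 2 * Real.log (8 * π) - ε * π + 2 * Real.log 2 := by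
  have hi := ii_HL he
  have hi1 : IntervalIntegrable (HL ε) volume 0 (1/2) := hi.mono_set (by
    rw [Set.uIcc_of_le (by norm_num), Set.uIcc_of_le (by norm_num)]; exact Set.Icc_subset_Icc le_rfl (by norm_num))
  have hi2 : IntervalIntegrable (HL ε) volume (1/2) 1 := hi.mono_set (by
    rw [Set.uIcc_of_le (by norm_num), Set.uIcc_of_le (by norm_num)]; exact Set.Icc_subset_Icc (by norm_num) le_rfl)
  have h1 := intervalIntegral.integral_add_adjacent_intervals hi1 hi2
  have hsym : ∀ x, HL ε (1-x) = HL ε x := by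
    intro x
    unfold HL
    have : f ε (1-x) = ε * f ε x := by
      rw [← f_neg he, ← f_add_int ε (-x) 1]; congr 1; push_cast; ring
    rw [this, mul_pow, sq ε, sq_he he]
    ring_nf
  have h2 : ∫ x in (1/2:ℝ)..1, HL ε x = ∫ x in (0:ℝ)..(1/2), HL ε x := by
    have := intervalIntegral.integral_comp_sub_left (a := 0) (b := 1/2) (HL ε) 1
    simp only [hsym] at this
    rw [this]; norm_num
  have h3 : ∫ x in (0:ℝ)..(1/2), HL ε x = (∫ x in (0:ℝ)..(1/2), GG ε x) - ∫ x in (0:ℝ)..(1/2), 1/(1-x) := by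
    have hc : IntervalIntegrable (fun x : ℝ => 1/(1-x)) volume 0 (1/2) := by
      refine ContinuousOn.intervalIntegrable ?_
      rw [Set.uIcc_of_le (by norm_num)]
      refine continuousOn_const.div (by fun_prop) fun x hx => ?_
      linarith [hx.2]
    rw [← intervalIntegral.integral_sub (ii_GG he) hc]
    refine intervalIntegral.integral_congr fun x hx => ?_
    rw [Set.uIcc_of_le (by norm_num)] at hx
    simp only [HL, GG]
    rw [abs_of_nonneg hx.1]
  have h4 : ∫ x in (0:ℝ)..(1/2), 1/(1-x) = Real.log 2 := by
    have := intervalIntegral.integral_comp_sub_left (a := 0) (b := 1/2) (fun x : ℝ => 1/x) 1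
    rw [this, integral_one_div_of_pos (by norm_num) (by norm_num)]
    norm_num
  rw [h2, h3, h4, int_HL he] at h1
  rw [C0]
  linarith
end TTR

namespace TTR
open MeasureTheory

noncomputable def cc (V : ℝ) (n : ℕ) : ℝ := min (1/((n:ℝ)+1)) (√V * p3 ((n:ℝ)+1))

lemma p3_nonneg {x : ℝ} (hx : 0 ≤ x) : 0 ≤ p3 x := by unfold p3; positivity

lemma cc_nonneg (V : ℝ) (n : ℕ) : 0 ≤ cc V n :=
  le_min (by positivity) (mul_nonneg (Real.sqrt_nonneg _) (p3_nonneg (by positivity)))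

lemma p3_step {n : ℝ} (hn : 0 < n) : p3 (n+1) ≤ 2 / √n - 2 / √(n+1) := by
  unfold p3
  have ha : 0 < √n := Real.sqrt_pos.mpr hn
  have hb : 0 < √(n+1) := Real.sqrt_pos.mpr (by linarith)
  have ha2 := Real.sq_sqrt hn.le
  have hb2 := Real.sq_sqrt (show 0 ≤ n + 1 by linarith)
  have hab : √n ≤ √(n+1) := Real.sqrt_le_sqrt (by linarith)
  generalize √n = a at *
  generalize √(n+1) = b at *
  rw [← hb2]
  have e : 2/a - 2/b = 2 / ((a+b)*a*b) := by
    have : (b - a) * (a + b) = 1 := by linarith [show (b - a) * (a + b) = b^2 - a^2 by ring]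
    field_simp
    linear_combination this
  rw [e, div_le_div_iff₀ (by positivity) (by positivity)]
  have h1 : (a+b)*a*b ≤ (b+b)*b*b := by gcongr
  linarith

lemma cc_sum {V : ℝ} (hV : 1 ≤ V) (N : ℕ) : ∑ n ∈ range N, cc V n ≤ 4 + Real.log V := by
  have small : ∀ N : ℕ, (N:ℝ) ≤ V → ∑ n ∈ range N, cc V n ≤ 1 + Real.log V := by
    intro N hN
    rcases Nat.eq_zero_or_pos N with h | h
    · subst h; simp; linarith [Real.log_nonneg hV]
    have h1 : ∑ n ∈ range N, cc V n ≤ ((harmonic N : ℚ) : ℝ) := by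
      unfold harmonic
      push_cast
      refine sum_le_sum fun n _ => (min_le_left _ _).trans (by simp)
    have h2 := harmonic_le_one_add_log N
    have h3 : Real.log N ≤ Real.log V := Real.log_le_log (by exact_mod_cast h) hN
    linarith
  set M := ⌊V⌋₊ with hM
  have hM1 : 1 ≤ M := Nat.one_le_floor_iff _ |>.mpr hV
  have hMV : (M:ℝ) ≤ V := Nat.floor_le (by linarith)
  have hVM : V < M + 1 := Nat.lt_floor_add_one V
  have hM0 : (1:ℝ) ≤ M := by exact_mod_cast hM1
  rcases le_total N M with h | h
  · have := small N (le_trans (by exact_mod_cast h) hMV)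
    linarith
  · have key : ∑ n ∈ range N, cc V n ≤ 1 + Real.log V + √V * (2/√M - 2/√N) := by
      induction N, h using Nat.le_induction with
      | base => have := small M hMV; simpa using this
      | succ N hN ih =>
        rw [sum_range_succ]
        have hN0 : (0:ℝ) < N := by exact_mod_cast (by omega : 0 < N)
        have h1 : cc V N ≤ √V * (2/√N - 2/√(N+1)) :=
          (min_le_right _ _).trans (mul_le_mul_of_nonneg_left (p3_step hN0) (Real.sqrt_nonneg _))
        push_cast
        linarith [ih]
    have h2 : √V * (2/√M - 2/√N) ≤ 3 := by
      have hsM : 0 < √(M:ℝ) := Real.sqrt_pos.mpr (by linarith)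
      have h3 : √V ≤ 3/2 * √M := by
        rw [Real.sqrt_le_left (by positivity), mul_pow, Real.sq_sqrt (by linarith)]
        linarith
      calc √V * (2/√M - 2/√N) ≤ √V * (2/√M) := by
            gcongr
            have : 0 ≤ 2 / √(N:ℝ) := by positivity
            linarith
        _ ≤ 3/2 * √M * (2/√M) := by gcongr
        _ = 3 := by field_simp
    linarith

lemma int_sum_bound {E : ℤ → ℝ} {S V K e0 : ℝ} (hV : 1 ≤ V) (hK : 0 ≤ K) (hE : HasSum E S) (h0 : |E 0| ≤ e0)
    (h1 : ∀ w : ℤ, w ≠ 0 → |E w| ≤ K * min (1/|(w:ℝ)|) (√V * p3 |(w:ℝ)|)) :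
    |S| ≤ e0 + 2 * K * (4 + Real.log V) := by
  have hs : Summable (cc V) := summable_of_sum_range_le (cc_nonneg V) (cc_sum hV)
  have hle : ∑' n, cc V n ≤ 4 + Real.log V := Real.tsum_le_of_sum_range_le (cc_nonneg V) (cc_sum hV)
  have hc := hs.hasSum
  generalize ∑' n, cc V n = C at *
  set b : ℤ → ℝ := fun w => if w = 0 then e0 else K * min (1/|(w:ℝ)|) (√V * p3 |(w:ℝ)|) with hb
  have hp : ∀ n : ℕ, b ((n:ℤ)+1) = K * cc V n := by
    intro n
    have : ((n:ℤ)+1) ≠ 0 := by omega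
    simp only [hb, this, if_false, cc]
    push_cast
    rw [abs_of_nonneg (by positivity : (0:ℝ) ≤ (n:ℝ)+1)]
  have hn : ∀ n : ℕ, b (-((n:ℤ)+1)) = K * cc V n := by
    intro n
    have : (-((n:ℤ)+1)) ≠ 0 := by omega
    simp only [hb, this, if_false, cc]
    push_cast
    rw [abs_neg, abs_of_nonneg (by positivity : (0:ℝ) ≤ (n:ℝ)+1)]
  have hB1 : HasSum (fun n : ℕ => b n) (K * C + e0) := by
    have := (hasSum_nat_add_iff (f := fun n : ℕ => b n) 1 (g := K * C)).mp ?_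
    · simpa [hb] using this
    · refine (hc.mul_left K).congr_fun fun n => ?_
      push_cast; exact hp n
  have hB2 : HasSum (fun n : ℕ => b (-((n:ℤ)+1))) (K * C) := (hc.mul_left K).congr_fun hn
  have hB := HasSum.of_nat_of_neg_add_one hB1 hB2
  have := hE.norm_le_of_bounded hB (fun w => by
    by_cases hw : w = 0
    · subst hw; simpa [hb] using h0
    · simpa [hb, hw] using h1 w hw)
  rw [Real.norm_eq_abs] at this
  nlinarith

lemma min_scale {V d n : ℝ} (hd : 1 ≤ d) (hn : 0 < n) {x K : ℝ} (hK : 0 ≤ K) (h1 : x ≤ K * (1/(d*n))) (h2 : x ≤ K * (√V * p3 (d*n))) :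
    x ≤ K / d * min (1/n) (√V * p3 n) := by
  have hd0 : 0 < d := by linarith
  rw [mul_min_of_nonneg _ _ (by positivity)]
  refine le_min (h1.trans (le_of_eq ?_)) (h2.trans ?_)
  · field_simp
  · have e : p3 (d*n) = p3 n * (1/d) * (1/√d) := by
      unfold p3
      rw [Real.sqrt_mul hd0.le]
      field_simp
    have h3 : 1/√d ≤ 1 := by
      rw [div_le_one (Real.sqrt_pos.mpr hd0), Real.one_le_sqrt]; exact hd
    have h4 := p3_nonneg hn.le
    calc K * (√V * p3 (d*n)) = K/d * (√V * p3 n) * (1/√d) := by rw [e]; ring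
      _ ≤ K/d * (√V * p3 n) * 1 := by gcongr
      _ = _ := by ring

lemma core {ε : ℝ} (he : ε = 1 ∨ ε = -1) {h k q : ℕ} [NeZero h] [NeZero k] [NeZero q]
    {i0 j0 : ℤ} (hb : i0 * k - j0 * h = 1) (hd : 1 ≤ (q:ℝ)/(h*k)) :
    |√(h * k) / q * SS ε h k q - ε * (√(k / q) * SS ε k q h) - ε * (√(h / q) * SS ε h q k)
      - (C0 ε + 2 * Real.log ((q:ℝ)/(h*k)/2) + 2 * Real.eulerMascheroniConstant)|
      ≤ (KM + 64 * K0) / √q + 2 * (KE / ((q:ℝ)/(h*k))) * (4 + Real.log q) := by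
  have hh : 0 < h := NeZero.pos h
  have hk : 0 < k := NeZero.pos k
  have hq : 0 < q := NeZero.pos q
  have hh0 : (0:ℝ) < h := by exact_mod_cast hh
  have hk0 : (0:ℝ) < k := by exact_mod_cast hk
  have hq0 : (0:ℝ) < q := by exact_mod_cast hq
  have hq1 : (1:ℝ) ≤ q := by exact_mod_cast hq
  have hb1 : (i0 : ZMod h) * k = 1 := by
    have := congrArg (fun z : ℤ => (z : ZMod h)) hb
    push_cast at this
    simpa using this
  have hb2 : -(j0 : ZMod k) * h = 1 := by
    have := congrArg (fun z : ℤ => (z : ZMod k)) hb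
    push_cast at this
    simpa using this
  have R := regroup he (q := q) hh hk hb
  have D1 := dual_sum he (q := q) hk hb1
  have D2 := dual_sum' he (q := q) hh hb2
  set d : ℝ := (q:ℝ)/(h*k) with hdd
  have hd0 : 0 < d := by positivity
  have hV : (q:ℝ) = d * (h*k:ℕ) := by rw [hdd]; push_cast; field_simp
  have hP := Phi_fold he (m := h*k) (by positivity) hd0 hV
  have hbR : (i0:ℝ) * k - j0 * h = 1 := by exact_mod_cast hb
  have hxy : ∀ w : ℝ, (q:ℝ) * w * i0 / h - q * w * j0 / k = d * w := by
    intro w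
    have : (q:ℝ) * w * i0 / h - q * w * j0 / k = q * w * (i0 * k - j0 * h) / (h * k) := by field_simp
    rw [this, hbR, hdd]; ring
  -- fibers
  have fib : ∀ w : ℤ, Summable (fun a : ℤ => Tw ε h k q i0 j0 (w, a)) := fun w =>
    R.summable.prod_factor w
  have RA := R.prod_fiberwise (fun w => (fib w).hasSum)
  set A : ℤ → ℝ := fun w => ∑' a, Tw ε h k q i0 j0 (w, a) with hA
  have hA0 : HasSum (fun n : ℤ => tau ε q n ^ 2) (A 0) := by
    refine (fib 0).hasSum.congr_fun fun n => ?_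
    simp [Tw, sq]
  have main := main_term he (m := h*k) (by positivity) hd0 hV hq1 hA0 hP
  generalize ((∫ x in II d, (fd ε d x^2 - tau ε q x^2)) - ∫ x in (II d)ᶜ, tau ε q x^2) = X at hP main
  have H0 : HasSum (fun w : ℤ => if w = 0 then A 0 else 0) (A 0) := by
    have := hasSum_ite_eq (0:ℤ) (A 0)
    exact this
  have HE := (((RA.sub H0).sub hP).sub (D1.mul_left ε)).sub D2
  have bnd := int_sum_bound (V := q) (K := KE / d) (e0 := 64 * K0 / √q) hq1 (div_nonneg KE_nonneg hd0.le) HE ?_ ?_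
  · have e : (KM + 64 * K0) / √q + 2 * (KE / d) * (4 + Real.log q) = KM/√q + (64 * K0 / √q + 2 * (KE / d) * (4 + Real.log q)) := by ring
    rw [e]
    rw [abs_le] at main bnd ⊢
    constructor <;> linarith [main.1, main.2, bnd.1, bnd.2]
  · have t0 : |tau ε q 0| ≤ 32/√q := by
      have : tau ε q 0 = - bb ε q 0 := by simp [tau, ker]
      rw [this, abs_neg]
      exact bb_bd he hq0 0
    have f0 := f0_le he
    simp [Phi0]
    have h1 : |tau ε q 0 * f ε 0| ≤ 32/√q * K0 := by
      rw [abs_mul]; gcongr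
    have h2 := abs_sub (-(ε * (tau ε q 0 * f ε 0))) (tau ε q 0 * f ε 0)
    rw [abs_neg, abs_mul, abs_he he, one_mul] at h2
    refine h2.trans ?_
    have : 64 * K0 / √q = 32/√q * K0 + 32/√q * K0 := by ring
    linarith
  · intro w hw
    have hwR : (w:ℝ) ≠ 0 := by exact_mod_cast hw
    have hD : d * (w:ℝ) ≠ 0 := mul_ne_zero hd0.ne' hwR
    set x : ℝ := (q:ℝ) * w * i0 / h with hx
    set y : ℝ := (q:ℝ) * w * j0 / k with hy
    have hyx : ∀ a : ℝ, a + x - d * w = a + y := fun a => by linarith [hxy w]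
    have hT := hasSum_tau he hq x
    have hT2 := hasSum_tau he hq y
    have hRR : HasSum (fun n : ℤ => RR ε q (d*w) (n + x))
        (A w - tau ε q (-(d*w)) * f ε x - tau ε q (d*w) * f ε y) := by
      refine HasSum.congr_fun (((fib w).hasSum.sub (hT.mul_left (tau ε q (-(d*w))))).sub (hT2.mul_left (tau ε q (d*w)))) fun n => ?_
      rw [RR, hyx]
      simp only [Tw]
      rw [add_comm x, add_comm y]
      simp only [Int.cast_natCast, hx, hy]
    have eb := E_bound he hq0 hD hRR
    rw [tau_neg he] at eb
    rw [abs_mul, abs_of_pos hd0] at eb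
    have := min_scale (V := q) hd (abs_pos.mpr hwR) KE_nonneg eb.1 eb.2
    refine le_trans (le_of_eq ?_) this
    simp only [hw, if_false, Phi0]
    congr 1
    ring
end TTR

namespace TTR

lemma cast_ne {p q : ℕ} (hp : p.Prime) (hq : q.Prime) (h : p ≠ q) : (((p:ℕ):ℤ) : ZMod q) ≠ 0 := by
  rw [Int.cast_natCast, Ne, ZMod.natCast_eq_zero_iff, Nat.prime_dvd_prime_iff_eq hq hp]
  exact fun e => h e.symm

lemma real_bound {ε : ℝ} (he : ε = 1 ∨ ε = -1) {h k q : ℕ} [NeZero h] [NeZero k] [NeZero q]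
    {i0 j0 : ℤ} (hb : i0 * k - j0 * h = 1) (hd : 1 ≤ (q:ℝ)/(h*k)) (hlog : 1 ≤ Real.log q) :
    |1/(4*√q) * SS ε h k q - ε * (1/(4*√k) * SS ε h q k) - ε * (1/(4*√h) * SS ε k q h)
      - 1/2 * √((q:ℝ)/(h*k)) * (Real.log ((q:ℝ)/(h*k)) + Real.eulerMascheroniConstant - Real.log (8*π) - ε*π/2)|
      ≤ (|KM| + 64 * K0 + 3 * KE) * Real.log q := by
  have hh0 : (0:ℝ) < h := by exact_mod_cast NeZero.pos h
  have hk0 : (0:ℝ) < k := by exact_mod_cast NeZero.pos k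
  have hq0 : (0:ℝ) < q := by exact_mod_cast NeZero.pos q
  have hh1 : (1:ℝ) ≤ h := by exact_mod_cast NeZero.pos h
  have hk1 : (1:ℝ) ≤ k := by exact_mod_cast NeZero.pos k
  have K0n : 0 ≤ K0 := (abs_nonneg _).trans (f0_le he)
  have KEn := KE_nonneg
  have c := core he (q := q) hb hd
  rw [C0_eq he] at c
  have e1 : √((q:ℝ)/(h*k)) = √q / (√h * √k) := by
    rw [Real.sqrt_div' _ (by positivity), Real.sqrt_mul hh0.le]
  have sh : 0 < √(h:ℝ) := Real.sqrt_pos.mpr hh0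
  have sk : 0 < √(k:ℝ) := Real.sqrt_pos.mpr hk0
  have sq : 0 < √(q:ℝ) := Real.sqrt_pos.mpr hq0
  have q2 : (q:ℝ) = √q * √q := (Real.mul_self_sqrt hq0.le).symm
  have t1 : √((q:ℝ)/(h*k))/4 * (√(h * k) / q) = 1/(4*√q) := by
    rw [e1, Real.sqrt_mul hh0.le]
    nth_rewrite 2 [q2]
    field_simp
  have t2 : √((q:ℝ)/(h*k))/4 * √(k/q) = 1/(4*√h) := by
    rw [e1, Real.sqrt_div' _ hq0.le]
    field_simp
  have t3 : √((q:ℝ)/(h*k))/4 * √(h/q) = 1/(4*√k) := by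
    rw [e1, Real.sqrt_div' _ hq0.le]
    field_simp
  set d : ℝ := (q:ℝ)/(h*k) with hdd
  have hd0 : 0 < d := by linarith
  have hdq : d ≤ q := by
    rw [hdd, div_le_iff₀ (by positivity)]
    nlinarith [mul_le_mul hh1 hk1 zero_le_one hh0.le]
  have hs : 0 < √d := Real.sqrt_pos.mpr hd0
  have hsq : √d ≤ √q := Real.sqrt_le_sqrt hdq
  have hsd : √d ≤ d := by
    rw [Real.sqrt_le_left hd0.le]; nlinarith
  have c2 := mul_le_mul_of_nonneg_left c (by positivity : 0 ≤ √d/4)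
  rw [← abs_of_nonneg (by positivity : 0 ≤ √d/4), ← abs_mul, abs_of_nonneg (by positivity : 0 ≤ √d/4)] at c2
  have e : 1/(4*√q) * SS ε h k q - ε * (1/(4*√k) * SS ε h q k) - ε * (1/(4*√h) * SS ε k q h)
      - 1/2 * √d * (Real.log d + Real.eulerMascheroniConstant - Real.log (8*π) - ε*π/2)
     = √d/4 * (√(h * k) / q * SS ε h k q - ε * (√(k / q) * SS ε k q h) - ε * (√(h / q) * SS ε h q k)
      - (-2 * Real.log (8*π) - ε*π + 2*Real.log 2 + 2 * Real.log (d/2) + 2 * Real.eulerMascheroniConstant)) := by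
    rw [← t1, ← t2, ← t3, Real.log_div hd0.ne' two_ne_zero]
    ring
  rw [e]
  refine c2.trans ?_
  have hL : 0 ≤ 4 + Real.log q := by linarith
  have b1 : √d/4 * ((KM + 64 * K0)/√q) ≤ |KM| + 64 * K0 := by
    have : √d/4 * ((KM + 64 * K0)/√q) = (KM + 64*K0) * (√d/√q/4) := by ring
    rw [this]
    have h1 : √d/√q/4 ≤ 1 := by
      have : √d/√q ≤ 1 := (div_le_one sq).mpr hsq
      linarith
    calc (KM + 64*K0) * (√d/√q/4) ≤ (|KM| + 64*K0) * (√d/√q/4) := by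
          gcongr; exact le_abs_self _
      _ ≤ (|KM| + 64*K0) * 1 := by gcongr
      _ = _ := by ring
  have b2 : √d/4 * (2 * (KE/d) * (4 + Real.log q)) ≤ KE/2 * (5 * Real.log q) := by
    have : √d/4 * (2 * (KE/d) * (4 + Real.log q)) = KE/2 * (4 + Real.log q) * (√d/d) := by field_simp; ring
    rw [this]
    calc KE/2 * (4 + Real.log q) * (√d/d) ≤ KE/2 * (4 + Real.log q) * 1 := by
          gcongr; exact (div_le_one hd0).mpr hsd
      _ ≤ KE/2 * (5 * Real.log q) := by
          rw [mul_one]; gcongr; linarith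
  rw [mul_add]
  have b3 : |KM| + 64 * K0 ≤ (|KM| + 64 * K0) * Real.log q := le_mul_of_one_le_right (by positivity) hlog
  have b4 : 0 ≤ KE * Real.log q := by positivity
  linarith
end TTR

theorem three_term_relation :
    ∃ C : ℝ, 0 < C ∧
      ∀ (h k q : ℕ) (hh : h.Prime) (hk : k.Prime) (hq : q.Prime),
        h ≠ k → h ≠ q → k ≠ q → 4 * h * k ≤ q →
        ∀ (ε : ℤ), ε = 1 ∨ ε = -1 →
        haveI : NeZero q := ⟨hq.ne_zero⟩
        haveI : NeZero k := ⟨hk.ne_zero⟩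
        haveI : NeZero h := ⟨hh.ne_zero⟩
        ‖Mpm ε h k q - (ε : ℂ) * Mpm ε h q k - (ε : ℂ) * Mpm ε k q h -
            ((1/2 * Real.sqrt ((q : ℝ)/(h*k)) *
              (Real.log ((q : ℝ)/(h*k)) + Real.eulerMascheroniConstant
                - Real.log (8*π) - (ε : ℝ) * π/2) : ℝ) : ℂ)‖
          ≤ C * Real.log q := by
  have K0n : 0 ≤ TTR.K0 := (abs_nonneg _).trans (TTR.f0_le (ε := 1) (Or.inl rfl))
  have KEn := TTR.KE_nonneg
  refine ⟨|TTR.KM| + 64 * TTR.K0 + 3 * TTR.KE + 9 * TTR.K0 ^ 2 + 1, by positivity, ?_⟩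
  intro h k q hh hk hq hhk hhq hkq h4 ε he
  haveI : NeZero q := ⟨hq.ne_zero⟩
  haveI : NeZero k := ⟨hk.ne_zero⟩
  haveI : NeZero h := ⟨hh.ne_zero⟩
  show ‖Mpm ε h k q - (ε : ℂ) * Mpm ε h q k - (ε : ℂ) * Mpm ε k q h -
            ((1/2 * Real.sqrt ((q : ℝ)/(h*k)) *
              (Real.log ((q : ℝ)/(h*k)) + Real.eulerMascheroniConstant
                - Real.log (8*π) - (ε : ℝ) * π/2) : ℝ) : ℂ)‖ ≤ _
  have heR : (ε:ℝ) = 1 ∨ (ε:ℝ) = -1 := by rcases he with h | h <;> simp [h]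
  have hh0 : (0:ℝ) < h := by exact_mod_cast hh.pos
  have hk0 : (0:ℝ) < k := by exact_mod_cast hk.pos
  have h4R : 4 * (h:ℝ) * k ≤ q := by exact_mod_cast h4
  have hd : 1 ≤ (q:ℝ)/(h*k) := by
    rw [le_div_iff₀ (by positivity)]
    have : 0 < (h:ℝ) * k := by positivity
    linarith
  have hq3 : (3:ℝ) ≤ q := by
    have : 1 ≤ h * k := Nat.mul_pos hh.pos hk.pos
    have h5 : 3 ≤ q := by rw [mul_assoc] at h4; omega
    exact_mod_cast h5
  have hlog : 1 ≤ Real.log q := by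
    rw [Real.le_log_iff_exp_le (by linarith)]
    have := Real.exp_one_lt_d9
    linarith
  have hcop : IsCoprime (h:ℤ) (k:ℤ) := Nat.isCoprime_iff_coprime.mpr ((Nat.coprime_primes hh hk).mpr hhk)
  obtain ⟨a, b, hab⟩ := hcop
  have R := TTR.real_bound heR (q := q) (i0 := b) (j0 := -a) (by linarith) hd hlog
  have m1 := TTR.Mpm_approx hq ε he (TTR.cast_ne hh hq hhq) (TTR.cast_ne hk hq hkq)
  have m2 := TTR.Mpm_approx hk ε he (TTR.cast_ne hh hk hhk) (TTR.cast_ne hq hk hkq.symm)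
  have m3 := TTR.Mpm_approx hh ε he (TTR.cast_ne hk hh hhk.symm) (TTR.cast_ne hq hh hhq.symm)
  rw [← Real.norm_eq_abs, ← Complex.norm_real] at R
  have hε : ‖(ε:ℂ)‖ = 1 := by rcases he with h | h <;> simp [h]
  generalize 1/2 * Real.sqrt ((q : ℝ)/(h*k)) * (Real.log ((q : ℝ)/(h*k)) + Real.eulerMascheroniConstant
                - Real.log (8*π) - (ε : ℝ) * π/2) = T at R ⊢
  generalize 1/(4*√(q:ℝ)) * TTR.SS ε h k q = a1 at *
  generalize 1/(4*√(k:ℝ)) * TTR.SS ε h q k = a2 at *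
  generalize 1/(4*√(h:ℝ)) * TTR.SS ε k q h = a3 at *
  have e : Mpm ε h k q - (ε : ℂ) * Mpm ε h q k - (ε : ℂ) * Mpm ε k q h - (T:ℂ)
      = (Mpm ε h k q - (a1:ℂ)) - (ε:ℂ) * (Mpm ε h q k - (a2:ℂ)) - (ε:ℂ) * (Mpm ε k q h - (a3:ℂ))
        + ((a1 - ε * a2 - ε * a3 - T : ℝ) : ℂ) := by
    push_cast; ring
  rw [e]
  have n1 := norm_add_le ((Mpm ε h k q - (a1:ℂ)) - (ε:ℂ) * (Mpm ε h q k - (a2:ℂ)) - (ε:ℂ) * (Mpm ε k q h - (a3:ℂ)))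
    ((a1 - ε * a2 - ε * a3 - T : ℝ) : ℂ)
  have n2 := norm_sub_le ((Mpm ε h k q - (a1:ℂ)) - (ε:ℂ) * (Mpm ε h q k - (a2:ℂ))) ((ε:ℂ) * (Mpm ε k q h - (a3:ℂ)))
  have n3 := norm_sub_le (Mpm ε h k q - (a1:ℂ)) ((ε:ℂ) * (Mpm ε h q k - (a2:ℂ)))
  rw [norm_mul, hε, one_mul] at n2 n3
  have b3 : 9 * TTR.K0^2 ≤ 9 * TTR.K0^2 * Real.log q := le_mul_of_one_le_right (by positivity) hlog
  refine n1.trans ?_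
  linarith
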